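/- Let G be a finite insoluble para-Nil-Hamiltonian group. Then G is isomorphic to A₅ or to SL(2,5). In particular, the only prime divisors of the order of G are 2, 3 and 5. -/

import Mathlib

/-- A group is *minimal non-nilpotent* if it is not nilpotent but every proper
subgroup of it is nilpotent. -/
def MinimalNonNilpotent (G : Type*) [Group G] : Prop :=
  ¬ Group.IsNilpotent G ∧ ∀ H : Subgroup G, H ≠ ⊤ → Group.IsNilpotent H

/-- A group is *biminimal non-nilpotent* if it is neither nilpotent nor minimal
non-nilpotent, but every proper subgroup of it is nilpotent or minimal non-nilpotent. -/
def BiminimalNonNilpotent (G : Type*) [Group G] : Prop :=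
  ¬ Group.IsNilpotent G ∧ ¬ MinimalNonNilpotent G ∧
    ∀ H : Subgroup G, H ≠ ⊤ → (Group.IsNilpotent H ∨ MinimalNonNilpotent H)

/-- A group is *para-Nil-Hamiltonian* if it is not nilpotent and every non-normal
subgroup of it is either nilpotent or minimal non-nilpotent. -/
def ParaNilHamiltonian (G : Type*) [Group G] : Prop :=
  ¬ Group.IsNilpotent G ∧
    ∀ H : Subgroup G, ¬ H.Normal → (Group.IsNilpotent H ∨ MinimalNonNilpotent H)

/-- A group is *meta-Nil-Hamiltonian* if every non-nilpotent subgroup of it is normal. -/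
def MetaNilHamiltonian (G : Type*) [Group G] : Prop :=
  ∀ H : Subgroup G, ¬ Group.IsNilpotent H → H.Normal

/-- A group is *locally graded* if every non-trivial finitely generated subgroup of it
contains a proper subgroup of finite index. -/
def LocallyGraded (G : Type*) [Group G] : Prop :=
  ∀ H : Subgroup G, H ≠ ⊥ → Group.FG H → ∃ K : Subgroup H, K ≠ ⊤ ∧ K.FiniteIndex

/-- A group is abelian if its multiplication commutes. -/
def Abelian (G : Type*) [Group G] : Prop := ∀ a b : G, a * b = b * a

/-- A group is *minimal non-abelian* if it is not abelian but every proper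
subgroup of it is abelian. -/
def MinimalNonAbelian (G : Type*) [Group G] : Prop :=
  ¬ Abelian G ∧ ∀ H : Subgroup G, H ≠ ⊤ → Abelian H

/-- A group is *biminimal non-abelian* if it is neither abelian nor minimal non-abelian,
but every proper subgroup of it is abelian or minimal non-abelian. -/
def BiminimalNonAbelian (G : Type*) [Group G] : Prop :=
  ¬ Abelian G ∧ ¬ MinimalNonAbelian G ∧
    ∀ H : Subgroup G, H ≠ ⊤ → (Abelian H ∨ MinimalNonAbelian H)

/-- A group is *parahamiltonian* if it is not abelian and every non-normal subgroup
of it is either abelian or minimal non-abelian. -/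
def Parahamiltonian (G : Type*) [Group G] : Prop :=
  ¬ Abelian G ∧ ∀ H : Subgroup G, ¬ H.Normal → (Abelian H ∨ MinimalNonAbelian H)

/-- A group is *locally nilpotent* if every finitely generated subgroup of it is nilpotent. -/
def LocallyNilpotent (G : Type*) [Group G] : Prop :=
  ∀ H : Subgroup G, Group.FG H → Group.IsNilpotent H

/-- A group that is nilpotent or minimal non-nilpotent. -/
def NilpotentOrMinimal (G : Type*) [Group G] : Prop :=
  Group.IsNilpotent G ∨ MinimalNonNilpotent G

section Basic

variable {G H : Type*} [Group G] [Group H]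

theorem isNilpotent_of_injective (f : G →* H) (hf : Function.Injective f)
    (hH : Group.IsNilpotent H) : Group.IsNilpotent G :=
  have := hH
  Subgroup.isNilpotent_of_ker_le_center f (((MonoidHom.ker_eq_bot_iff f).mpr hf).trans_le bot_le)

theorem isNilpotent_of_le {A B : Subgroup G} (h : A ≤ B) (hB : Group.IsNilpotent B) :
    Group.IsNilpotent A :=
  isNilpotent_of_injective (Subgroup.inclusion h) (Subgroup.inclusion_injective h) hB

theorem isNilpotent_map (f : G →* H) {A : Subgroup G} (hA : Group.IsNilpotent A) :
    Group.IsNilpotent (A.map f) :=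
  Group.nilpotent_of_surjective (f.subgroupMap A) (f.subgroupMap_surjective A)

theorem isNilpotent_of_isNilpotent_map {f : G →* H} (hf : Function.Injective f) {A : Subgroup G}
    (hA : Group.IsNilpotent (A.map f)) : Group.IsNilpotent A :=
  isNilpotent_of_injective (A.equivMapOfInjective f hf).toMonoidHom
    (A.equivMapOfInjective f hf).injective hA

theorem isNilpotent_of_isNilpotent_top (h : Group.IsNilpotent (⊤ : Subgroup G)) :
    Group.IsNilpotent G :=
  Group.isNilpotent_top.mp h

theorem MinimalNonNilpotent.of_mulEquiv (e : G ≃* H) (h : MinimalNonNilpotent G) :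
    MinimalNonNilpotent H := by
  refine ⟨fun hn => h.1 (isNilpotent_of_injective e.toMonoidHom e.injective hn), fun L hL => ?_⟩
  have h2 := h.2 (L.comap e.toMonoidHom) (fun h3 => hL ?_)
  · have := isNilpotent_map e.toMonoidHom h2
    rwa [Subgroup.map_comap_eq_self_of_surjective e.surjective] at this
  · have := congrArg (Subgroup.map e.toMonoidHom) h3
    rw [Subgroup.map_comap_eq_self_of_surjective e.surjective] at this
    rw [this, Subgroup.map_top_of_surjective _ e.surjective]

theorem NilpotentOrMinimal.of_surjective (h : NilpotentOrMinimal G) {f : G →* H}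
    (hf : Function.Surjective f) : NilpotentOrMinimal H := by
  rcases h with h | h
  · exact Or.inl (Group.nilpotent_of_surjective f hf)
  · by_cases hH : Group.IsNilpotent H
    · exact Or.inl hH
    refine Or.inr ⟨hH, fun L hL => ?_⟩
    have h2 := h.2 (L.comap f) (fun h3 => hL ?_)
    · have := isNilpotent_map f h2
      rwa [Subgroup.map_comap_eq_self_of_surjective hf] at this
    · have := congrArg (Subgroup.map f) h3
      rw [Subgroup.map_comap_eq_self_of_surjective hf] at this
      rw [this, Subgroup.map_top_of_surjective _ hf]

theorem NilpotentOrMinimal.of_mulEquiv (h : NilpotentOrMinimal G) (e : G ≃* H) :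
    NilpotentOrMinimal H :=
  h.of_surjective (f := e.toMonoidHom) e.surjective

theorem NilpotentOrMinimal.map {A : Subgroup G} (h : NilpotentOrMinimal A) (f : G →* H) :
    NilpotentOrMinimal (A.map f) :=
  h.of_surjective (f := f.subgroupMap A) (f.subgroupMap_surjective A)

theorem MinimalNonNilpotent.isNilpotent_of_lt {A B : Subgroup G} (hB : MinimalNonNilpotent B)
    (h : A < B) : Group.IsNilpotent A := by
  have h1 := hB.2 (A.subgroupOf B) (fun h2 => h.not_ge (Subgroup.subgroupOf_eq_top.mp h2))
  exact isNilpotent_of_injective (Subgroup.subgroupOfEquivOfLe h.le).symm.toMonoidHom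
    (Subgroup.subgroupOfEquivOfLe h.le).symm.injective h1

theorem NilpotentOrMinimal.isNilpotent_of_lt {A B : Subgroup G} (hB : NilpotentOrMinimal B)
    (h : A < B) : Group.IsNilpotent A :=
  hB.elim (isNilpotent_of_le h.le) (fun hB => hB.isNilpotent_of_lt h)

/-- In a finite nilpotent group, normalizers grow. -/
theorem lt_normalizer_inf_of_lt [Finite G] {A B : Subgroup G} (hB : Group.IsNilpotent B)
    (h : A < B) : A < Subgroup.normalizer (A : Set G) ⊓ B := by
  refine lt_of_le_of_ne (le_inf Subgroup.le_normalizer h.le) (fun heq => ?_)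
  have h1 : A.subgroupOf B < ⊤ :=
    lt_top_iff_ne_top.mpr fun h2 => h.not_ge (Subgroup.subgroupOf_eq_top.mp h2)
  have h2 := Group.normalizerCondition_of_isNilpotent (G := B) _ h1
  rw [← Subgroup.subgroupOf_normalizer_eq h.le] at h2
  obtain ⟨x, hx, hxA⟩ := SetLike.exists_of_lt h2
  apply hxA
  rw [Subgroup.mem_subgroupOf] at hx ⊢
  rw [heq]
  exact ⟨hx, x.2⟩

/-- The set of conjugates of the elements of `A`. -/
def conjSet (A : Set G) : Set G := {x | ∃ g, ∃ a ∈ A, x = g * a * g⁻¹}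

theorem card_mul_card_conjSet [Finite G] (N : Subgroup G) (A : Set G)
    (h1 : ∀ n ∈ N, ∀ a ∈ A, n * a * n⁻¹ ∈ A)
    (h2 : ∀ g, ∀ a ∈ A, g * a * g⁻¹ ∈ A → g ∈ N) :
    Nat.card N * Nat.card (conjSet A) = Nat.card G * Nat.card A := by
  rw [← Nat.card_prod, ← Nat.card_prod]
  have hc : ∀ u : conjSet A, ∃ p : G × A, u.1 = p.1 * p.2.1 * p.1⁻¹ := by
    rintro ⟨u, g, a, ha, rfl⟩
    exact ⟨⟨g, a, ha⟩, rfl⟩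
  choose c hc using hc
  refine Nat.card_congr (Equiv.ofBijective (fun p : N × conjSet A =>
    ((c p.2).1 * p.1, ⟨(p.1 : G)⁻¹ * (c p.2).2 * p.1, by
      have := h1 _ (N.inv_mem p.1.2) _ (c p.2).2.2
      simpa using this⟩)) ⟨?_, ?_⟩)
  · rintro ⟨⟨n, hn⟩, u⟩ ⟨⟨n', hn'⟩, u'⟩ h
    simp only [Prod.mk.injEq, Subtype.mk.injEq] at h
    have hu : u = u' := by
      apply Subtype.ext
      rw [hc u, hc u']
      have e1 : (c u).1 = (c u').1 * n' * n⁻¹ := by rw [← h.1]; group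
      have e2 : ((c u').2 : G) = n' * (n⁻¹ * (c u).2 * n) * n'⁻¹ := by rw [h.2]; group
      rw [e1, e2]; group
    subst hu
    simpa using h.1
  · rintro ⟨g, a, ha⟩
    have hu : g * a * g⁻¹ ∈ conjSet A := ⟨g, a, ha, rfl⟩
    have e := hc ⟨_, hu⟩
    set q := c ⟨_, hu⟩ with hq
    have e' : (q.2 : G) = q.1⁻¹ * g * a * (q.1⁻¹ * g)⁻¹ := by
      have : (q.2 : G) = q.1⁻¹ * (q.1 * q.2 * q.1⁻¹) * q.1 := by group
      rw [this, ← e]; group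
    have hn : q.1⁻¹ * g ∈ N := h2 _ a ha (by rw [← e']; exact q.2.2)
    refine ⟨⟨⟨_, hn⟩, ⟨_, hu⟩⟩, ?_⟩
    simp only [← hq, Prod.mk.injEq, Subtype.mk.injEq]
    refine ⟨by group, ?_⟩
    rw [e']; group

end Basic

section Schmidt

variable {G : Type*} [Group G]

theorem isCoatom_map_conj {M : Subgroup G} (hM : IsCoatom M) (g : G) :
    IsCoatom (M.map (MulAut.conj g).toMonoidHom) :=
  ((MulAut.conj g).mapSubgroup.isCoatom_iff M).mpr hM

theorem normalizer_ne_top [IsSimpleGroup G] {H : Subgroup G} (h1 : H ≠ ⊥) (h2 : H ≠ ⊤) :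
    Subgroup.normalizer (H : Set G) ≠ ⊤ := fun h =>
  ((IsSimpleGroup.eq_bot_or_eq_top_of_normal H (Subgroup.normalizer_eq_top_iff.mp h)).elim h1 h2)

theorem normalizer_eq_of_isCoatom [IsSimpleGroup G] {M : Subgroup G} (hM : IsCoatom M)
    (h : M ≠ ⊥) : Subgroup.normalizer (M : Set G) = M :=
  ((hM.le_iff.mp Subgroup.le_normalizer).resolve_left (normalizer_ne_top h hM.1))

theorem mem_normalizer_iff_map_conj {H : Subgroup G} {g : G} :
    g ∈ Subgroup.normalizer (H : Set G) ↔ H.map (MulAut.conj g).toMonoidHom = H :=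
  Subgroup.mem_normalizer_iff_map_conj_eq

theorem inf_eq_bot_of_isCoatom [Finite G] [IsSimpleGroup G] (h : MinimalNonNilpotent G)
    {M N : Subgroup G} (hM : IsCoatom M) (hN : IsCoatom N) (hMN : M ≠ N) : M ⊓ N = ⊥ := by
  classical
  by_contra hne
  have hfin : Set.Finite {D : Subgroup G | D ≠ ⊥ ∧ ∃ A B : Subgroup G, IsCoatom A ∧ IsCoatom B ∧
    A ≠ B ∧ D = A ⊓ B} := Set.toFinite _
  obtain ⟨D, -, hD⟩ := hfin.exists_le_maximal ⟨hne, M, N, hM, hN, hMN, rfl⟩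
  obtain ⟨⟨hDb, A, B, hA, hB, hAB, rfl⟩, hmax⟩ := hD
  have hAB1 : A ⊓ B < A := lt_of_le_of_ne inf_le_left fun h1 =>
    hAB ((hA.le_iff.mp (inf_eq_left.mp h1)).resolve_left hB.1).symm
  have hAB2 : A ⊓ B < B := lt_of_le_of_ne inf_le_right fun h1 =>
    hAB ((hB.le_iff.mp (inf_eq_right.mp h1)).resolve_left hA.1)
  obtain ⟨C, hC, hDC⟩ := (eq_top_or_exists_le_coatom
    (Subgroup.normalizer ((A ⊓ B : Subgroup G) : Set G))).resolve_left
    (normalizer_ne_top hDb (hAB1.trans_le le_top).ne)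
  have key : ∀ E : Subgroup G, IsCoatom E → A ⊓ B < E → C = E := by
    intro E hE hlt
    by_contra hCE
    have h1 := lt_normalizer_inf_of_lt (h.2 E hE.1) hlt
    have h2 : A ⊓ B < C ⊓ E := h1.trans_le (inf_le_inf_right _ hDC)
    exact h2.not_ge (hmax ⟨(bot_le.trans_lt h2).ne', C, E, hC, hE, hCE, rfl⟩ h2.le)
  exact hAB ((key A hA hAB1).symm.trans (key B hB hAB2))

theorem isNilpotent_of_isCyclic (h : IsCyclic G) : Group.IsNilpotent G :=
  letI := IsCyclic.commGroup (α := G)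
  CommGroup.isNilpotent

theorem not_minimalNonNilpotent_of_isSimpleGroup [Finite G] [IsSimpleGroup G] :
    ¬ MinimalNonNilpotent G := by
  intro h
  have hz : ∀ x : G, Subgroup.zpowers x ≠ ⊤ := fun x hx =>
    h.1 (isNilpotent_of_isCyclic ⟨x, fun y => by
      have : y ∈ (⊤ : Subgroup G) := trivial
      rwa [← hx] at this⟩)
  have hco : ∀ x : G, ∃ M : Subgroup G, IsCoatom M ∧ x ∈ M := fun x => by
    obtain ⟨M, hM, hx⟩ := (eq_top_or_exists_le_coatom _).resolve_left (hz x)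
    exact ⟨M, hM, hx (Subgroup.mem_zpowers x)⟩
  have hbot : ∀ M : Subgroup G, IsCoatom M → M ≠ ⊥ := by
    rintro M hM rfl
    obtain ⟨x, hx⟩ := exists_ne (1 : G)
    rcases hM.le_iff.mp (bot_le (a := Subgroup.zpowers x)) with h1 | h1
    · exact hz x h1
    · exact hx (Subgroup.zpowers_eq_bot.mp h1)
  have hcount : ∀ M : Subgroup G, IsCoatom M →
      Nat.card M * Nat.card (conjSet {x | x ∈ M ∧ x ≠ 1}) = Nat.card G * (Nat.card M - 1) := by
    intro M hM
    have hc : Nat.card {x | x ∈ M ∧ x ≠ 1} = Nat.card M - 1 := by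
      have : {x | x ∈ M ∧ x ≠ 1} = (M : Set G) \ {1} := by ext; simp
      rw [this, Nat.card_coe_set_eq, Set.ncard_sdiff_singleton_of_mem M.one_mem]
      rfl
    rw [← hc]
    refine card_mul_card_conjSet M _ ?_ ?_
    · rintro n hn a ⟨ha, ha1⟩
      refine ⟨M.mul_mem (M.mul_mem hn ha) (M.inv_mem hn), fun h1 => ha1 ?_⟩
      simpa using h1
    · rintro g a ⟨ha, ha1⟩ ⟨hb, hb1⟩
      by_contra hg
      rw [← normalizer_eq_of_isCoatom hM (hbot M hM), mem_normalizer_iff_map_conj] at hg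
      have := inf_eq_bot_of_isCoatom h (isCoatom_map_conj hM g) hM hg
      have h2 : g * a * g⁻¹ ∈ M.map (MulAut.conj g).toMonoidHom ⊓ M :=
        ⟨⟨a, ha, rfl⟩, hb⟩
      rw [this] at h2
      exact hb1 h2
  obtain ⟨x0, hx0⟩ := exists_ne (1 : G)
  obtain ⟨M, hM, -⟩ := hco x0
  have hhalf : ∀ M : Subgroup G, IsCoatom M →
      Nat.card G ≤ 2 * Nat.card (conjSet {x | x ∈ M ∧ x ≠ 1}) := by
    intro M hM
    have h1 := hcount M hM
    have h2 : 2 ≤ Nat.card M := by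
      have : Nontrivial M := (Subgroup.nontrivial_iff_ne_bot M).mpr (hbot M hM)
      exact Finite.one_lt_card
    obtain ⟨m, hm⟩ : ∃ m, Nat.card M = m + 2 := ⟨_, (Nat.sub_add_cancel h2).symm⟩
    rw [hm] at h1
    simp only [Nat.add_succ_sub_one] at h1
    nlinarith
  have hlt : ∃ y : G, y ≠ 1 ∧ y ∉ conjSet {x | x ∈ M ∧ x ≠ 1} := by
    by_contra! hcon
    have h1 : Nat.card G - 1 ≤ Nat.card (conjSet {x | x ∈ M ∧ x ≠ 1}) := by
      have : (Set.univ : Set G) \ {1} ⊆ conjSet {x | x ∈ M ∧ x ≠ 1} := fun y hy => hcon y hy.2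
      have h2 := Set.ncard_le_ncard this (Set.toFinite _)
      rw [Set.ncard_sdiff_singleton_of_mem (Set.mem_univ _), Set.ncard_univ] at h2
      exact h2
    have h3 := hcount M hM
    have h4 : Nat.card M < Nat.card G := by
      have := Subgroup.card_le_card_group M
      refine lt_of_le_of_ne this (fun h5 => hM.1 (Subgroup.eq_top_of_card_eq _ h5))
    have h5 : 1 ≤ Nat.card M := Nat.card_pos
    obtain ⟨m, hm⟩ : ∃ m, Nat.card M = m + 1 := ⟨_, (Nat.sub_add_cancel h5).symm⟩
    obtain ⟨g, hg⟩ : ∃ g, Nat.card G = g + m + 2 := ⟨Nat.card G - (m + 2), by omega⟩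
    rw [hm, hg] at h3
    rw [hg] at h1
    simp only [Nat.add_succ_sub_one] at h1 h3
    nlinarith
  obtain ⟨y, hy1, hy⟩ := hlt
  obtain ⟨N, hN, hyN⟩ := hco y
  have hdisj : Disjoint (conjSet {x | x ∈ M ∧ x ≠ 1}) (conjSet {x | x ∈ N ∧ x ≠ 1}) := by
    rw [Set.disjoint_left]
    rintro _ ⟨g, a, ⟨ha, ha1⟩, rfl⟩ ⟨k, b, ⟨hb, hb1⟩, hab⟩
    by_cases hMN : M.map (MulAut.conj g).toMonoidHom = N.map (MulAut.conj k).toMonoidHom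
    · apply hy
      have : k * y * k⁻¹ ∈ M.map (MulAut.conj g).toMonoidHom := by
        rw [hMN]; exact ⟨y, hyN, rfl⟩
      obtain ⟨z, hz, hzy⟩ := this
      have hzy' : g * z * g⁻¹ = k * y * k⁻¹ := hzy
      refine ⟨k⁻¹ * g, z, ⟨hz, ?_⟩, ?_⟩
      · rintro rfl
        apply hy1
        have : k * y * k⁻¹ = 1 := by rw [← hzy']; simp
        simpa using this
      · have : y = k⁻¹ * (k * y * k⁻¹) * k := by group
        rw [this, ← hzy']; group
    · have := inf_eq_bot_of_isCoatom h (isCoatom_map_conj hM g) (isCoatom_map_conj hN k) hMN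
      have h2 : g * a * g⁻¹ ∈ M.map (MulAut.conj g).toMonoidHom ⊓
          N.map (MulAut.conj k).toMonoidHom :=
        ⟨⟨a, ha, rfl⟩, ⟨b, hb, hab.symm⟩⟩
      rw [this] at h2
      apply ha1
      have h3 : g * a * g⁻¹ = 1 := h2
      simpa using h3
  have h1 := Set.ncard_union_eq hdisj (Set.toFinite _) (Set.toFinite _)
  have h2 : (conjSet {x | x ∈ M ∧ x ≠ 1} ∪ conjSet {x | x ∈ N ∧ x ≠ 1}) ⊆
      (Set.univ : Set G) \ {1} := by
    rintro z (⟨g, a, ⟨ha, ha1⟩, rfl⟩ | ⟨g, a, ⟨ha, ha1⟩, rfl⟩) <;>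
    · refine ⟨trivial, fun h3 => ha1 ?_⟩
      have h4 : g * a * g⁻¹ = 1 := h3
      simpa using h4
  have h3 := Set.ncard_le_ncard h2 (Set.toFinite _)
  rw [Set.ncard_sdiff_singleton_of_mem (Set.mem_univ _), Set.ncard_univ, h1] at h3
  have h4 := hhalf M hM
  have h5 := hhalf N hN
  have h6 : 0 < Nat.card G := Nat.card_pos
  rw [Nat.card_coe_set_eq] at h4 h5
  omega

theorem NilpotentOrMinimal.isSolvable [Finite G] (h : NilpotentOrMinimal G) :
    Group.IsSolvable G := by
  induction hn : Nat.card G using Nat.strong_induction_on generalizing G with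
  | _ n ih =>
  rcases h with h | h
  · infer_instance
  have : Nontrivial G := by
    by_contra h1
    rw [not_nontrivial_iff_subsingleton] at h1
    exact h.1 inferInstance
  by_cases hs : IsSimpleGroup G
  · exact (not_minimalNonNilpotent_of_isSimpleGroup h).elim
  obtain ⟨N, hN, hb, ht⟩ : ∃ N : Subgroup G, N.Normal ∧ N ≠ ⊥ ∧ N ≠ ⊤ := by
    by_contra! h1
    exact hs ⟨fun H hH => or_iff_not_imp_left.mpr fun h2 => h1 H hH h2⟩
  have hQ : NilpotentOrMinimal (G ⧸ N) :=
    NilpotentOrMinimal.of_surjective (Or.inr h) (QuotientGroup.mk'_surjective N)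
  have hc : Nat.card (G ⧸ N) < n := by
    have h1 := Subgroup.card_eq_card_quotient_mul_card_subgroup N
    have h2 : 1 < Nat.card N := (Subgroup.one_lt_card_iff_ne_bot N).mpr hb
    have h3 : 0 < Nat.card (G ⧸ N) := Nat.card_pos
    nlinarith
  have h1 := ih _ hc hQ rfl
  have h2 : Group.IsNilpotent N := h.2 N ht
  have h3 : Group.IsSolvable N := inferInstance
  exact Group.isSolvable_of_ker_le_range N.subtype (QuotientGroup.mk' N) (by simp)

end Schmidt

section SchmidtStructure

open scoped commutatorElement

variable {G : Type*} [Group G]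

theorem commute_of_isPGroup_of_isNilpotent [Finite G] {p q : ℕ} [Fact p.Prime] [Fact q.Prime]
    (hpq : p ≠ q) {A B C : Subgroup G} (hA : IsPGroup p A) (hB : IsPGroup q B) (hAC : A ≤ C)
    (hBC : B ≤ C) (hC : Group.IsNilpotent C) {a b : G} (ha : a ∈ A) (hb : b ∈ B) :
    Commute a b := by
  obtain ⟨P, hP⟩ := (hA.of_equiv (Subgroup.subgroupOfEquivOfLe hAC).symm).exists_le_sylow
  obtain ⟨Q, hQ⟩ := (hB.of_equiv (Subgroup.subgroupOfEquivOfLe hBC).symm).exists_le_sylow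
  have h := Subgroup.commute_of_normal_of_disjoint (P : Subgroup C) Q inferInstance inferInstance
    (IsPGroup.disjoint_of_ne p q hpq _ _ P.2 Q.2) ⟨a, hAC ha⟩ ⟨b, hBC hb⟩
    (hP (Subgroup.mem_subgroupOf.mpr ha)) (hQ (Subgroup.mem_subgroupOf.mpr hb))
  exact congrArg Subtype.val h

theorem exists_normal_index_prime [Finite G] [Group.IsSolvable G] [Nontrivial G] :
    ∃ M : Subgroup G, M.Normal ∧ M.index.Prime := by
  have h := Group.IsSolvable.commutator_lt_top_of_nontrivial G
  obtain ⟨M, hM, hle⟩ := (eq_top_or_exists_le_coatom (commutator G)).resolve_left h.ne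
  have hN : M.Normal := Subgroup.Normal.of_commutator_le G hle
  refine ⟨M, hN, ?_⟩
  have hc : IsMulCommutative (G ⧸ M) := ⟨⟨by
    intro a b
    induction a using QuotientGroup.induction_on with | _ a
    induction b using QuotientGroup.induction_on with | _ b
    rw [← QuotientGroup.mk_mul, ← QuotientGroup.mk_mul, QuotientGroup.eq]
    have h2 : ⁅b⁻¹, a⁻¹⁆ ∈ M :=
      hle (Subgroup.commutator_mem_commutator (Subgroup.mem_top _) (Subgroup.mem_top _))
    rw [commutatorElement_def] at h2
    convert h2 using 1
    group⟩⟩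
  rw [Subgroup.index, ← Group.is_simple_iff_prime_card]
  have : Nontrivial (G ⧸ M) := QuotientGroup.nontrivial_iff.mpr hM.1
  refine ⟨fun H _ => ?_⟩
  have h1 : M ≤ H.comap (QuotientGroup.mk' M) := fun x hx => by
    rw [Subgroup.mem_comap, QuotientGroup.mk'_apply, (QuotientGroup.eq_one_iff x).mpr hx]
    exact H.one_mem
  have h2 := Subgroup.map_comap_eq_self_of_surjective (QuotientGroup.mk'_surjective M) H
  rcases hM.le_iff.mp h1 with h3 | h3
  · right; rw [← h2, h3, Subgroup.map_top_of_surjective _ (QuotientGroup.mk'_surjective M)]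
  · left; rw [← h2, h3]; simp

/-- The structure of a finite minimal non-nilpotent subgroup `M`: an extension of its normal Sylow
`p`-subgroup `P` by a cyclic `q`-group generated by `x`. -/
structure IsSchmidt (p q : ℕ) (M P : Subgroup G) (x : G) : Prop where
  prime_p : p.Prime
  prime_q : q.Prime
  ne : p ≠ q
  isPGroup : IsPGroup p P
  le : P ≤ M
  mem : x ∈ M
  le_normalizer : M ≤ Subgroup.normalizer (P : Set G)
  sup_eq : P ⊔ Subgroup.zpowers x = M
  isPGroup_zpowers : IsPGroup q (Subgroup.zpowers x)
  pow_commute : ∀ y ∈ P, Commute (x ^ q) y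
  commute_of_lt : ∀ R < P, (∀ y ∈ R, x * y * x⁻¹ ∈ R) → ∀ y ∈ R, Commute x y
  not_commute : ∃ y ∈ P, ¬ Commute x y

theorem eq_of_sup_eq_of_disjoint {A B C : Subgroup G} (hN : C ≤ Subgroup.normalizer (B : Set G))
    (hA : A ≤ C) (hd : Disjoint C B) (h : C ≤ A ⊔ B) : A = C := by
  refine le_antisymm hA fun x hx => ?_
  have h1 : x ∈ ((A ⊔ B : Subgroup G) : Set G) := h hx
  rw [Subgroup.coe_mul_of_left_le_normalizer_right A B (hA.trans hN)] at h1
  obtain ⟨a, ha, b, hb, rfl⟩ := h1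
  have hb' : b ∈ C := by
    have := C.mul_mem (C.inv_mem (hA ha)) hx
    simpa using this
  have : b = 1 := by
    have h2 : b ∈ C ⊓ B := ⟨hb', hb⟩
    rwa [hd.eq_bot] at h2
  subst this
  simpa using ha

theorem exists_isSchmidt_top [Finite G] (h : MinimalNonNilpotent G) :
    ∃ (p q : ℕ) (P : Subgroup G) (x : G), IsSchmidt p q ⊤ P x := by
  have : Nontrivial G := by
    by_contra h1
    rw [not_nontrivial_iff_subsingleton] at h1
    exact h.1 inferInstance
  have : Group.IsSolvable G := NilpotentOrMinimal.isSolvable (Or.inr h)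
  obtain ⟨M, hM, hq⟩ := exists_normal_index_prime (G := G)
  set q := M.index with hqdef
  have : Fact q.Prime := ⟨hq⟩
  have hMt : M ≠ ⊤ := by
    rintro rfl
    rw [Subgroup.index_top] at hqdef
    exact hq.one_lt.ne' hqdef
  have hMn : Group.IsNilpotent M := h.2 M hMt
  have hnormal : ∀ (p : ℕ) (_ : Fact p.Prime) (P : Sylow p G), p ≠ q → (P : Subgroup G).Normal := by
    intro p _ P hpq
    have hPM : (P : Subgroup G) ≤ M := by
      intro x hx
      obtain ⟨k, hk⟩ := P.2 ⟨x, hx⟩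
      have hk' : x ^ p ^ k = 1 := congrArg Subtype.val hk
      have h1 : (x : G ⧸ M) ^ p ^ k = 1 := by rw [← QuotientGroup.mk_pow, hk']; rfl
      have h2 : (x : G ⧸ M) ^ q = 1 := by rw [hqdef, Subgroup.index]; exact pow_card_eq_one'
      have h3 : (p ^ k).gcd q = 1 :=
        Nat.Coprime.pow_left k ((Nat.coprime_primes Fact.out hq).mpr hpq)
      have h4 := pow_gcd_eq_one.mpr ⟨h1, h2⟩
      rw [h3, pow_one] at h4
      exact (QuotientGroup.eq_one_iff x).mp h4
    have h1 : ((P.subtype hPM : Sylow p M) : Subgroup M).Characteristic :=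
      Sylow.characteristic_of_normal _ inferInstance
    have h2 : (((P.subtype hPM : Sylow p M) : Subgroup M).map M.subtype).Normal :=
      ConjAct.normal_of_characteristic_of_normal
    rwa [Sylow.coe_subtype, Subgroup.map_subgroupOf_eq_of_le hPM] at h2
  obtain ⟨Q⟩ : Nonempty (Sylow q G) := inferInstance
  have hQ : ¬ (Q : Subgroup G).Normal := by
    intro hQ
    apply h.1
    refine (Group.isNilpotent_of_finite_tfae.out 3 0 rfl rfl).mp fun p hp P => ?_
    by_cases hpq : p = q
    · subst hpq
      have := Sylow.unique_of_normal Q hQ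
      rwa [Subsingleton.elim P Q]
    · exact hnormal p hp P hpq
  obtain ⟨p, hp, P, hpq, hPN⟩ : ∃ (p : ℕ) (_ : Fact p.Prime) (P : Sylow p G), p ≠ q ∧
      ¬ (P : Subgroup G) ≤ Subgroup.normalizer ((Q : Subgroup G) : Set G) := by
    by_contra! hcon
    apply hQ
    rw [← Subgroup.normalizer_eq_top_iff]
    apply Subgroup.eq_top_of_card_eq
    refine Nat.dvd_antisymm (Subgroup.card_subgroup_dvd_card _) ?_
    rw [← Nat.factorization_prime_le_iff_dvd Nat.card_pos.ne' Nat.card_pos.ne']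
    intro p hp
    have : Fact p.Prime := ⟨hp⟩
    have key : ∀ P : Sylow p G, (P : Subgroup G) ≤ Subgroup.normalizer ((Q : Subgroup G) : Set G) →
      (Nat.card G).factorization p ≤
        (Nat.card (Subgroup.normalizer ((Q : Subgroup G) : Set G))).factorization p := by
      intro P hP
      have h1 := Subgroup.card_dvd_of_le hP
      rw [P.card_eq_multiplicity] at h1
      exact (hp.pow_dvd_iff_le_factorization Nat.card_pos.ne').mp h1
    by_cases hpq : p = q
    · subst hpq; exact key Q Subgroup.le_normalizer
    · obtain ⟨P⟩ : Nonempty (Sylow p G) := inferInstance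
      exact key P (hcon p ‹_› P hpq)
  have hPn := hnormal p hp P hpq
  have htop : (P : Subgroup G) ⊔ Q = ⊤ := by
    by_contra hne
    apply hPN
    intro y hy
    rw [Subgroup.mem_normalizer_iff]
    intro z
    have hc : ∀ z ∈ (Q : Subgroup G), Commute y z := fun z hz =>
      commute_of_isPGroup_of_isNilpotent hpq P.2 Q.2 le_sup_left le_sup_right (h.2 _ hne) hy hz
    constructor
    · intro hz
      rw [(hc z hz).eq]; simpa using hz
    · intro hz
      have h1 := (hc _ hz).eq
      have : y * z * y⁻¹ = z := by
        have : z = y⁻¹ * (y * z * y⁻¹) * y := by group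
        rw [mul_assoc, ← h1] at this
        calc y * z * y⁻¹ = y⁻¹ * (y * (y * z * y⁻¹)) := by group
          _ = z := this.symm
      rwa [this] at hz
  have hdisj : Disjoint (P : Subgroup G) Q := IsPGroup.disjoint_of_ne p q hpq _ _ P.2 Q.2
  -- proper subgroups of `Q` centralize `P`
  have hcent : ∀ R : Subgroup G, R < Q → ∀ r ∈ R, ∀ y ∈ (P : Subgroup G), Commute r y := by
    intro R hR r hr y hy
    have hne : R ⊔ P ≠ ⊤ := by
      intro h1
      refine hR.ne (eq_of_sup_eq_of_disjoint (B := P) ?_ hR.le hdisj.symm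
        (by rw [h1]; exact le_top))
      rw [Subgroup.normalizer_eq_top_iff.mpr hPn]; exact le_top
    exact commute_of_isPGroup_of_isNilpotent hpq.symm (Q.2.to_le hR.le) P.2 le_sup_left
      le_sup_right (h.2 _ hne) hr hy
  obtain ⟨x, hxQ, y0, hy0, hxy⟩ : ∃ x ∈ (Q : Subgroup G), ∃ y ∈ (P : Subgroup G),
      ¬ Commute x y := by
    by_contra! hcon
    apply hPN
    intro y hy
    rw [Subgroup.mem_normalizer_iff]
    intro z
    constructor
    · intro hz
      rw [← (hcon z hz y hy).eq]; simpa using hz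
    · intro hz
      have h1 := (hcon _ hz y hy).eq
      have : y * z * y⁻¹ = z := by
        have : z = y⁻¹ * (y * z * y⁻¹) * y := by group
        rw [mul_assoc, h1] at this
        calc y * z * y⁻¹ = y⁻¹ * (y * (y * z * y⁻¹)) := by group
          _ = z := this.symm
      rwa [this] at hz
  have hxz : Subgroup.zpowers x = Q := by
    have hle : Subgroup.zpowers x ≤ Q := by rwa [Subgroup.zpowers_le]
    by_contra hne
    exact hxy (hcent _ (lt_of_le_of_ne hle hne) x (Subgroup.mem_zpowers x) y0 hy0)
  have hx1 : x ≠ 1 := by rintro rfl; exact hxy (Commute.one_left _)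
  have hQz : IsPGroup q (Subgroup.zpowers x) := by rw [hxz]; exact Q.2
  refine ⟨p, q, P, x, hp.out, hq, hpq, P.2, le_top, trivial, ?_, ?_, hQz, ?_, ?_, y0, hy0, hxy⟩
  · rw [Subgroup.normalizer_eq_top_iff.mpr hPn]
  · rw [hxz]; exact htop
  · refine hcent (Subgroup.zpowers (x ^ q)) ?_ _ (Subgroup.mem_zpowers _)
    rw [← hxz]
    refine lt_of_le_of_ne (by rw [Subgroup.zpowers_le]; exact pow_mem (Subgroup.mem_zpowers x) q) ?_
    intro heq
    have h1 : Nat.card (Subgroup.zpowers (x ^ q)) = Nat.card (Subgroup.zpowers x) := by rw [heq]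
    rw [Nat.card_zpowers, Nat.card_zpowers, orderOf_pow] at h1
    obtain ⟨n, hn⟩ := (IsPGroup.iff_card).mp hQz
    rw [Nat.card_zpowers] at hn
    have hn0 : n ≠ 0 := by
      rintro rfl
      rw [pow_zero, orderOf_eq_one_iff] at hn
      exact hx1 hn
    have h2 : (orderOf x).gcd q = q := Nat.gcd_eq_right (by rw [hn]; exact dvd_pow_self q hn0)
    rw [h2] at h1
    have h3 : 0 < orderOf x := orderOf_pos x
    exact (Nat.div_lt_self h3 hq.one_lt).ne h1
  · intro R hR hxR y hy
    have hne : R ⊔ Q ≠ ⊤ := by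
      intro h1
      apply hR.ne
      refine le_antisymm hR.le fun y hy => ?_
      have hN : (Q : Subgroup G) ≤ Subgroup.normalizer (R : Set G) := by
        rw [← hxz, Subgroup.zpowers_le]
        exact Subgroup.mem_normalizer_fintype hxR
      have h2 : y ∈ ((Q ⊔ R : Subgroup G) : Set G) := by rw [sup_comm, h1]; trivial
      rw [Subgroup.coe_mul_of_left_le_normalizer_right _ _ hN] at h2
      obtain ⟨a, ha, b, hb, rfl⟩ := h2
      have ha' : a ∈ (P : Subgroup G) ⊓ Q := ⟨by
        have := (P : Subgroup G).mul_mem hy ((P : Subgroup G).inv_mem (hR.le hb))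
        rwa [mul_inv_cancel_right] at this, ha⟩
      rw [hdisj.eq_bot] at ha'
      have : a = 1 := ha'
      subst this
      simpa using hb
    exact (commute_of_isPGroup_of_isNilpotent hpq (P.2.to_le hR.le) Q.2 le_sup_left
      le_sup_right (h.2 _ hne) hy hxQ).symm

theorem exists_isSchmidt [Finite G] {M : Subgroup G} (h : MinimalNonNilpotent M) :
    ∃ (p q : ℕ) (P : Subgroup G) (x : G), IsSchmidt p q M P x := by
  obtain ⟨p, q, P, x, hs⟩ := exists_isSchmidt_top h
  have hinj : Function.Injective M.subtype := M.subtype_injective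
  have hx : (⟨x.1, x.2⟩ : M) = x := rfl
  have hcomm : ∀ {a b : M}, Commute a b ↔ Commute (a : G) b := fun {a b} =>
    ⟨fun h => congrArg Subtype.val h, fun h => Subtype.ext h⟩
  refine ⟨p, q, P.map M.subtype, x, hs.prime_p, hs.prime_q, hs.ne, hs.isPGroup.map _, ?_, x.2, ?_,
    ?_, ?_, ?_, ?_, ?_⟩
  · exact Subgroup.map_subtype_le P
  · have := hs.le_normalizer
    rw [Subgroup.le_normalizer_iff] at this ⊢
    rintro m hm _ ⟨k, hk, rfl⟩
    exact ⟨_, this ⟨m, hm⟩ trivial k hk, rfl⟩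
  · have := congrArg (Subgroup.map M.subtype) hs.sup_eq
    rw [Subgroup.map_sup, MonoidHom.map_zpowers] at this
    rwa [← MonoidHom.range_eq_map, Subgroup.range_subtype] at this
  · have := hs.isPGroup_zpowers.map M.subtype
    rw [MonoidHom.map_zpowers] at this
    exact this
  · rintro _ ⟨y, hy, rfl⟩
    exact hcomm.mp (hs.pow_commute y hy)
  · intro R hR hxR y hy
    have hRM : R ≤ M := hR.le.trans (Subgroup.map_subtype_le P)
    have h1 : R.subgroupOf M < P := by
      rw [← Subgroup.map_lt_map_iff_of_injective hinj, Subgroup.map_subgroupOf_eq_of_le hRM]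
      exact hR
    exact hcomm.mp (hs.commute_of_lt _ h1 (fun y hy => hxR y hy) ⟨y, hRM hy⟩ hy)
  · obtain ⟨y, hy, hxy⟩ := hs.not_commute
    exact ⟨y, ⟨y, hy, rfl⟩, fun h => hxy (hcomm.mpr h)⟩

end SchmidtStructure

section LocalStructure

variable {G : Type*} [Group G]

theorem IsSchmidt.exists_mul {p q : ℕ} {M P : Subgroup G} {x : G} (h : IsSchmidt p q M P x)
    {m : G} (hm : m ∈ M) : ∃ y ∈ P, ∃ z ∈ Subgroup.zpowers x, m = y * z := by
  have h1 : m ∈ ((P ⊔ Subgroup.zpowers x : Subgroup G) : Set G) := by rw [h.sup_eq]; exact hm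
  rw [Subgroup.coe_mul_of_right_le_normalizer_left] at h1
  · obtain ⟨y, hy, z, hz, rfl⟩ := h1
    exact ⟨y, hy, z, hz, rfl⟩
  · rw [Subgroup.zpowers_le]
    exact h.le_normalizer h.mem

theorem IsSchmidt.disjoint {p q : ℕ} {M P : Subgroup G} {x : G} (h : IsSchmidt p q M P x) :
    Disjoint P (Subgroup.zpowers x) := by
  have := Fact.mk h.prime_p
  have := Fact.mk h.prime_q
  exact IsPGroup.disjoint_of_ne p q h.ne _ _ h.isPGroup h.isPGroup_zpowers

theorem card_eq_mul_of_disjoint {M A B : Subgroup G} (hA : A ≤ M) (hB : B ≤ M)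
    (hd : Disjoint A B) (h : ∀ m ∈ M, ∃ y ∈ A, ∃ z ∈ B, m = y * z) :
    Nat.card M = Nat.card A * Nat.card B := by
  rw [← Nat.card_prod]
  refine (Nat.card_congr (Equiv.ofBijective (fun p : A × B =>
    (⟨p.1 * p.2, M.mul_mem (hA p.1.2) (hB p.2.2)⟩ : M)) ⟨?_, ?_⟩)).symm
  · rintro ⟨a, b⟩ ⟨a', b'⟩ heq
    exact Subgroup.mul_injective_of_disjoint hd (congrArg Subtype.val heq)
  · rintro ⟨m, hm⟩
    obtain ⟨y, hy, z, hz, rfl⟩ := h m hm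
    exact ⟨⟨⟨y, hy⟩, ⟨z, hz⟩⟩, rfl⟩

theorem IsSchmidt.card_eq {p q : ℕ} {M P : Subgroup G} {x : G} (h : IsSchmidt p q M P x) :
    Nat.card M = Nat.card P * orderOf x := by
  rw [← Nat.card_zpowers]
  exact card_eq_mul_of_disjoint h.le (by rw [Subgroup.zpowers_le]; exact h.mem) h.disjoint
    fun m hm => h.exists_mul hm

theorem IsSchmidt.ne_bot {p q : ℕ} {M P : Subgroup G} {x : G} (h : IsSchmidt p q M P x) :
    P ≠ ⊥ := by
  rintro rfl
  obtain ⟨y, hy, hxy⟩ := h.not_commute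
  rw [Subgroup.mem_bot] at hy
  subst hy
  exact hxy (Commute.one_right _)

theorem IsSchmidt.ne_one {p q : ℕ} {M P : Subgroup G} {x : G} (h : IsSchmidt p q M P x) :
    x ≠ 1 := by
  rintro rfl
  obtain ⟨y, -, hxy⟩ := h.not_commute
  exact hxy (Commute.one_left _)

theorem IsSchmidt.exists_orderOf_eq [Finite G] {p q : ℕ} {M P : Subgroup G} {x : G}
    (h : IsSchmidt p q M P x) : ∃ n, orderOf x = q ^ (n + 1) := by
  have := Fact.mk h.prime_q
  obtain ⟨n, hn⟩ := IsPGroup.iff_card.mp h.isPGroup_zpowers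
  rw [Nat.card_zpowers] at hn
  rcases n with _ | n
  · rw [pow_zero, orderOf_eq_one_iff] at hn
    exact (h.ne_one hn).elim
  · exact ⟨n, hn⟩

theorem IsSchmidt.le_of_isPGroup [Finite G] {p q : ℕ} {M P : Subgroup G} {x : G}
    (h : IsSchmidt p q M P x) {R : Subgroup G} (hRM : R ≤ M) (hR : IsPGroup p R) : R ≤ P := by
  have := Fact.mk h.prime_p
  obtain ⟨n, hn⟩ := h.exists_orderOf_eq
  have hidx : ¬ p ∣ (P.subgroupOf M).index := by
    have h1 := h.card_eq
    have h2 := (P.subgroupOf M).card_mul_index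
    rw [Nat.card_congr (Subgroup.subgroupOfEquivOfLe h.le).toEquiv, h1] at h2
    have h3 : (P.subgroupOf M).index = orderOf x := Nat.eq_of_mul_eq_mul_left Nat.card_pos h2
    rw [h3, hn]
    intro hd
    exact h.ne ((Nat.prime_dvd_prime_iff_eq h.prime_p h.prime_q).mp (h.prime_p.dvd_of_dvd_pow hd))
  have hPM : IsPGroup p (P.subgroupOf M) :=
    h.isPGroup.of_equiv (Subgroup.subgroupOfEquivOfLe h.le).symm
  have hN : (P.subgroupOf M).Normal :=
    (Subgroup.normal_subgroupOf_iff_le_normalizer h.le).mpr h.le_normalizer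
  obtain ⟨S, hS⟩ := (hR.of_equiv (Subgroup.subgroupOfEquivOfLe hRM).symm).exists_le_sylow
  have hN' : ((hPM.toSylow hidx : Sylow p M) : Subgroup M).Normal := by
    rw [IsPGroup.toSylow_coe]; exact hN
  have := Sylow.unique_of_normal (hPM.toSylow hidx) hN'
  rw [Subsingleton.elim S (hPM.toSylow hidx), IsPGroup.toSylow_coe] at hS
  intro r hr
  exact hS (show (⟨r, hRM hr⟩ : M) ∈ R.subgroupOf M from hr)

theorem coprime_of_isPGroup [Finite G] {p r : ℕ} (hp : p.Prime) (hr : r.Prime) (hpr : p ≠ r)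
    {P R : Subgroup G} (hP : IsPGroup p P) (hR : IsPGroup r R) :
    (Nat.card P).Coprime (Nat.card R) := by
  have := Fact.mk hp
  have := Fact.mk hr
  obtain ⟨a, ha⟩ := IsPGroup.iff_card.mp hP
  obtain ⟨b, hb⟩ := IsPGroup.iff_card.mp hR
  rw [ha, hb]
  exact Nat.Coprime.pow a b ((Nat.coprime_primes hp hr).mpr hpr)

theorem IsSchmidt.card_dvd [Finite G] {p q r : ℕ} {M P : Subgroup G} {x : G}
    (h : IsSchmidt p q M P x) (hr : r.Prime) (hrp : r ≠ p) {R : Subgroup G} (hRM : R ≤ M)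
    (hR : IsPGroup r R) : Nat.card R ∣ orderOf x := by
  have h1 := Subgroup.card_dvd_of_le hRM
  rw [h.card_eq] at h1
  exact (coprime_of_isPGroup hr h.prime_p hrp hR h.isPGroup).dvd_of_dvd_mul_left h1

theorem eq_of_isPGroup_of_le_of_normalizer [Finite G] {p : ℕ} [Fact p.Prime] {P Q M : Subgroup G}
    (hM : Subgroup.normalizer (P : Set G) ≤ M) (hQ : IsPGroup p Q) (hPQ : P ≤ Q)
    (h : ∀ R ≤ M, IsPGroup p R → R ≤ Q → P ≤ R → R = P) : P = Q := by
  by_contra hne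
  have h1 := lt_normalizer_inf_of_lt hQ.isNilpotent (lt_of_le_of_ne hPQ hne)
  exact h1.ne (h _ (inf_le_left.trans hM) (hQ.to_le inf_le_right) inf_le_right h1.le).symm

theorem IsSchmidt.normalizer_eq [Finite G] [IsSimpleGroup G] {p q : ℕ} {M P : Subgroup G} {x : G}
    (h : IsSchmidt p q M P x) (hM : IsCoatom M) : Subgroup.normalizer (P : Set G) = M :=
  (hM.le_iff.mp h.le_normalizer).resolve_left
    (normalizer_ne_top h.ne_bot (h.le.trans_lt hM.lt_top).ne)

theorem isSolvable_of_isPGroup_top [Finite G] {p : ℕ} [Fact p.Prime]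
    (h : IsPGroup p (⊤ : Subgroup G)) : Group.IsSolvable G := by
  have : Group.IsNilpotent G := isNilpotent_of_isNilpotent_top h.isNilpotent
  infer_instance

theorem IsSchmidt.orderOf_eq [Finite G] [IsSimpleGroup G] (hns : ¬ Group.IsSolvable G)
    {p q : ℕ} {M P : Subgroup G} {x : G}
    (h : IsSchmidt p q M P x) (hM : IsCoatom M) : orderOf x = q := by
  have := Fact.mk h.prime_q
  obtain ⟨n, hn⟩ := h.exists_orderOf_eq
  by_cases hxq : x ^ q = 1
  · have h1 := orderOf_dvd_of_pow_eq_one hxq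
    exact ((Nat.dvd_prime h.prime_q).mp h1).resolve_left
      (fun h2 => h.ne_one (orderOf_eq_one_iff.mp h2))
  exfalso
  set Y := Subgroup.zpowers (x ^ q) with hY
  have hYM : Y ≤ M := by rw [Subgroup.zpowers_le]; exact M.pow_mem h.mem q
  have hYb : Y ≠ ⊥ := by rwa [hY, Ne, Subgroup.zpowers_eq_bot]
  have hMY : M ≤ Subgroup.normalizer (Y : Set G) := by
    intro m hm
    obtain ⟨y, hy, z, hz, rfl⟩ := h.exists_mul hm
    have hc : Commute (y * z) (x ^ q) := by
      refine Commute.mul_left (h.pow_commute y hy).symm ?_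
      obtain ⟨k, rfl⟩ := Subgroup.mem_zpowers_iff.mp hz
      exact ((Commute.refl x).zpow_left k).pow_right q
    apply Subgroup.mem_normalizer_fintype
    intro w hw
    obtain ⟨k, rfl⟩ := Subgroup.mem_zpowers_iff.mp hw
    rw [(hc.zpow_right k).eq]
    rwa [mul_inv_cancel_right]
  have hNY : Subgroup.normalizer (Y : Set G) = M :=
    (hM.le_iff.mp hMY).resolve_left (normalizer_ne_top hYb (hYM.trans_lt hM.lt_top).ne)
  have hNx : Subgroup.normalizer (Subgroup.zpowers x : Set G) ≤ M := by
    rw [← hNY]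
    intro g hg
    apply Subgroup.mem_normalizer_fintype
    intro w hw
    obtain ⟨k, rfl⟩ := Subgroup.mem_zpowers_iff.mp hw
    have h1 := (Subgroup.mem_normalizer_iff.mp hg x).mp (Subgroup.mem_zpowers x)
    obtain ⟨j, hj⟩ := Subgroup.mem_zpowers_iff.mp h1
    refine Subgroup.mem_zpowers_iff.mpr ⟨j * k, ?_⟩
    rw [← conj_zpow, ← conj_pow, ← hj]
    simp only [← zpow_natCast, ← zpow_mul]
    congr 1
    ring
  obtain ⟨Q, hQ⟩ := h.isPGroup_zpowers.exists_le_sylow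
  have hQx : Subgroup.zpowers x = Q := by
    refine eq_of_isPGroup_of_le_of_normalizer hNx Q.2 hQ ?_
    intro R hRM hR _ hxR
    refine (Subgroup.eq_of_le_of_card_ge hxR ?_).symm
    rw [Nat.card_zpowers]
    exact Nat.le_of_dvd (orderOf_pos x) (h.card_dvd h.prime_q h.ne.symm hRM hR)
  have hcent : Subgroup.normalizer ((Q : Subgroup G) : Set G) ≤ Subgroup.centralizer
      (Q : Set G) := by
    intro g hg
    rw [← hQx] at hg
    obtain ⟨y, hy, z, hz, rfl⟩ := h.exists_mul (hNx hg)
    have hyN : y ∈ Subgroup.normalizer (Subgroup.zpowers x : Set G) := by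
      have := Subgroup.mul_mem _ hg (Subgroup.inv_mem _ (Subgroup.le_normalizer hz))
      simpa using this
    have h1 := (Subgroup.mem_normalizer_iff.mp hyN x).mp (Subgroup.mem_zpowers x)
    have h2 : y * x * y⁻¹ * x⁻¹ ∈ P ⊓ Subgroup.zpowers x := by
      refine ⟨?_, Subgroup.mul_mem _ h1 (Subgroup.inv_mem _ (Subgroup.mem_zpowers x))⟩
      have h3 := (Subgroup.mem_normalizer_iff.mp (h.le_normalizer h.mem) y⁻¹).mp (P.inv_mem hy)
      have h4 := P.mul_mem hy h3
      have h5 : y * x * y⁻¹ * x⁻¹ = y * (x * y⁻¹ * x⁻¹) := by group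
      rw [h5]
      exact h4
    rw [h.disjoint.eq_bot, Subgroup.mem_bot, mul_inv_eq_one, mul_inv_eq_iff_eq_mul] at h2
    have hyx : Commute y x := h2
    have hcx : Commute (y * z) x := by
      refine hyx.mul_left ?_
      obtain ⟨k, rfl⟩ := Subgroup.mem_zpowers_iff.mp hz
      exact (Commute.refl x).zpow_left k
    rw [Subgroup.mem_centralizer_iff]
    intro w hw
    have hw' : w ∈ (Q : Subgroup G) := hw
    rw [← hQx] at hw'
    obtain ⟨k, rfl⟩ := Subgroup.mem_zpowers_iff.mp hw'
    exact (hcx.zpow_right k).eq.symm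
  have hcompl := MonoidHom.ker_transferSylow_isComplement' Q hcent
  rcases IsSimpleGroup.eq_bot_or_eq_top_of_normal (MonoidHom.transferSylow Q hcent).ker
    inferInstance
    with h1 | h1
  · rw [h1, Subgroup.isComplement'_bot_left] at hcompl
    exact hns (isSolvable_of_isPGroup_top (p := q) (hcompl ▸ Q.2))
  · rw [h1, Subgroup.isComplement'_top_left] at hcompl
    rw [hcompl, Subgroup.zpowers_eq_bot] at hQx
    exact h.ne_one hQx

end LocalStructure

section TrivialIntersection

theorem not_isPGroup_top {G : Type*} [Group G] [Finite G] (hns : ¬ Group.IsSolvable G) (p : ℕ)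
    [Fact p.Prime] (P : Sylow p G) :
    (P : Subgroup G) ≠ ⊤ := fun h => hns (isSolvable_of_isPGroup_top (p := p) (h ▸ P.2))

variable {G : Type*} [Group G] [Finite G] [IsSimpleGroup G]

theorem exists_or_card_dvd_of_isCoatom (hns : ¬ Group.IsSolvable G)
    (hS : ∀ H : Subgroup G, H ≠ ⊤ → NilpotentOrMinimal H) {L : Subgroup G} (hL : IsCoatom L)
    (p : ℕ) [hp : Fact p.Prime] :
    (∃ T : Subgroup G, IsPGroup p T ∧ ∀ R ≤ L, IsPGroup p R → R ≤ T) ∨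
      ∃ s : ℕ, s.Prime ∧ ∀ R ≤ L, IsPGroup p R → Nat.card R ∣ s := by
  rcases hS L hL.1 with h | h
  · left
    obtain ⟨T⟩ : Nonempty (Sylow p L) := inferInstance
    have hT : (T : Subgroup L).Normal :=
      (Group.isNilpotent_of_finite_tfae (G := L)).out 0 3 rfl rfl |>.mp h p hp T
    have := Sylow.unique_of_normal T hT
    refine ⟨(T : Subgroup L).map L.subtype, T.2.map _, fun R hRL hR r hr => ?_⟩
    obtain ⟨S, hS⟩ := (hR.of_equiv (Subgroup.subgroupOfEquivOfLe hRL).symm).exists_le_sylow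
    rw [Subsingleton.elim S T] at hS
    exact ⟨⟨r, hRL hr⟩, hS (show (⟨r, hRL hr⟩ : L) ∈ R.subgroupOf L from hr), rfl⟩
  · obtain ⟨p', q, P, x, hs⟩ := exists_isSchmidt h
    by_cases hpp : p = p'
    · subst hpp
      exact Or.inl ⟨P, hs.isPGroup, fun R hRL hR => hs.le_of_isPGroup hRL hR⟩
    · refine Or.inr ⟨q, hs.prime_q, fun R hRL hR => ?_⟩
      rw [← hs.orderOf_eq hns hL]
      exact hs.card_dvd hp.out hpp hRL hR

theorem sylow_eq_of_inf_ne_bot (hns : ¬ Group.IsSolvable G)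
    (hS : ∀ H : Subgroup G, H ≠ ⊤ → NilpotentOrMinimal H)
    {p : ℕ} [Fact p.Prime] (P Q : Sylow p G) (h : (P ⊓ Q : Subgroup G) ≠ ⊥) : P = Q := by
  by_contra hne
  obtain ⟨⟨P₁, P₂⟩, ⟨h1, h2⟩, hmax⟩ := Set.exists_max_image
    {a : Sylow p G × Sylow p G | a.1 ≠ a.2 ∧ (a.1 ⊓ a.2 : Subgroup G) ≠ ⊥}
    (fun a => Nat.card (a.1 ⊓ a.2 : Subgroup G)) (Set.toFinite _) ⟨(P, Q), hne, h⟩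
  simp only at h1 h2
  set D : Subgroup G := (P₁ : Subgroup G) ⊓ P₂ with hD
  have hDP : D < P₁ := by
    refine lt_of_le_of_ne inf_le_left fun h3 => h1 ?_
    have h4 : (P₁ : Subgroup G) ≤ P₂ := by rw [← h3]; exact inf_le_right
    exact Sylow.ext (P₁.3 P₂.2 h4).symm
  have hDQ : D < P₂ := by
    refine lt_of_le_of_ne inf_le_right fun h3 => h1 ?_
    have h4 : (P₂ : Subgroup G) ≤ P₁ := by rw [← h3]; exact inf_le_left
    exact Sylow.ext (P₂.3 P₁.2 h4)
  have hDp : IsPGroup p D := P₁.2.to_le inf_le_left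
  have hN1 := lt_normalizer_inf_of_lt P₁.2.isNilpotent hDP
  have hN2 := lt_normalizer_inf_of_lt P₂.2.isNilpotent hDQ
  have hDtop : D ≠ ⊤ := (hDP.trans_le le_top).ne
  obtain ⟨L, hL, hle⟩ :=
    (eq_top_or_exists_le_coatom (Subgroup.normalizer (D : Set G))).resolve_left
      (normalizer_ne_top h2 hDtop)
  have key : ∀ (A B : Subgroup G), A < B → Nat.card A < Nat.card B := fun A B hAB =>
    Set.ncard_lt_ncard hAB (Set.toFinite _)
  rcases exists_or_card_dvd_of_isCoatom hns hS hL p with ⟨T, hT, hTL⟩ | ⟨s, hs, hsL⟩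
  · obtain ⟨T', hT'⟩ := hT.exists_le_sylow
    have aux : ∀ R : Sylow p G, D < Subgroup.normalizer (D : Set G) ⊓ R → R = T' := by
      intro R hR
      by_contra hRT
      have h3 : Subgroup.normalizer (D : Set G) ⊓ R ≤ (R : Subgroup G) ⊓ T' :=
        le_inf inf_le_right
          ((hTL _ (inf_le_left.trans hle) (R.2.to_le inf_le_right)).trans hT')
      have h4 := key _ _ (hR.trans_le h3)
      have h5 := hmax (R, T') ⟨hRT, fun h6 => h2 (le_bot_iff.mp (h6 ▸ (hR.le.trans h3)))⟩
      exact absurd h4 (not_lt.mpr h5)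
    exact h1 ((aux P₁ hN1).trans (aux P₂ hN2).symm)
  · have h3 := hsL D (Subgroup.le_normalizer.trans hle) hDp
    have h4 := hsL _ (inf_le_left.trans hle) (P₁.2.to_le inf_le_right)
    have h5 := key _ _ hN1
    have h6 : Nat.card D ≠ 1 := fun h7 => h2 (Subgroup.card_eq_one.mp h7)
    have h7 := ((Nat.dvd_prime hs).mp h3).resolve_left h6
    have h8 := Nat.le_of_dvd hs.pos h4
    omega

theorem mem_normalizer_of_conj_mem (hns : ¬ Group.IsSolvable G)
    (hS : ∀ H : Subgroup G, H ≠ ⊤ → NilpotentOrMinimal H)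
    {p : ℕ} [Fact p.Prime] (P : Sylow p G) {a g : G} (ha : a ∈ (P : Subgroup G)) (ha1 : a ≠ 1)
    (hg : g * a * g⁻¹ ∈ (P : Subgroup G)) : g ∈ Subgroup.normalizer (P : Set G) := by
  have h1 : g • P = P := by
    refine sylow_eq_of_inf_ne_bot hns hS _ _ fun h2 => ?_
    have h3 : g * a * g⁻¹ ∈ ((g • P : Sylow p G) ⊓ P : Subgroup G) :=
      ⟨by
        rw [Sylow.smul_def]
        exact ⟨a, ha, rfl⟩, hg⟩
    rw [h2, Subgroup.mem_bot, mul_inv_eq_one] at h3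
    exact ha1 (by simpa using h3)
  exact Sylow.smul_eq_iff_mem_normalizer.mp h1

end TrivialIntersection

section SylowNormalizer

open scoped commutatorElement

variable {G : Type*} [Group G] [Finite G] [IsSimpleGroup G]

theorem commutator_eq_top_of_isSimpleGroup {G : Type*} [Group G] [IsSimpleGroup G]
    (hns : ¬ Group.IsSolvable G) : commutator G = ⊤ := by
  rcases IsSimpleGroup.eq_bot_or_eq_top_of_normal (commutator G) inferInstance with h | h
  · exact (hns ⟨1, by rw [derivedSeries_one, h]⟩).elim
  · exact h

theorem not_isNilpotent_normalizer (hns : ¬ Group.IsSolvable G)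
    (hS : ∀ H : Subgroup G, H ≠ ⊤ → NilpotentOrMinimal H)
    {p : ℕ} [Fact p.Prime] (P : Sylow p G) (hP : (P : Subgroup G) ≠ ⊥) :
    ¬ Group.IsNilpotent (Subgroup.normalizer (P : Set G)) := by
  intro hN
  have h1 : (P : Subgroup G) ≤ ⁅(P : Subgroup G), Subgroup.normalizer (P : Set G)⁆ := by
    have h2 : (P : Subgroup G) = (P : Subgroup G).focalSubgroup := by
      rw [← Subgroup.commutator_inf_eq_focalSubgroup, commutator_eq_top_of_isSimpleGroup hns,
        top_inf_eq]
    conv_lhs => rw [h2]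
    rw [Subgroup.focalSubgroup_def, Subgroup.closure_le]
    rintro g ⟨hg, x, hx, u, rfl⟩
    by_cases hx1 : x = 1
    · subst hx1
      rw [commutatorElement_one_left]
      exact Subgroup.one_mem _
    · refine Subgroup.commutator_mem_commutator hx ?_
      refine mem_normalizer_of_conj_mem hns hS P (P.inv_mem hx) (inv_ne_one.mpr hx1) ?_
      have h3 := P.mul_mem (P.inv_mem hx) hg
      rw [commutatorElement_def] at h3
      convert h3 using 1
      group
  obtain ⟨n, hn⟩ := Subgroup.isNilpotent_iff_lowerCentralSeries _ |>.mp hN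
  have h2 : ∀ n, (P : Subgroup G) ≤ (Subgroup.normalizer (P : Set G)).lowerCentralSeries n := by
    intro n
    induction n with
    | zero => exact Subgroup.le_normalizer
    | succ n ih =>
      rw [Subgroup.lowerCentralSeries_succ]
      exact h1.trans (Subgroup.commutator_mono ih le_rfl)
  exact hP (le_bot_iff.mp (hn ▸ h2 n))

theorem exists_isSchmidt_normalizer (hns : ¬ Group.IsSolvable G)
    (hS : ∀ H : Subgroup G, H ≠ ⊤ → NilpotentOrMinimal H)
    {p : ℕ} [Fact p.Prime] (P : Sylow p G) (hP : (P : Subgroup G) ≠ ⊥) :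
    ∃ q x, IsSchmidt p q (Subgroup.normalizer (P : Set G)) P x ∧ orderOf x = q := by
  have hN := not_isNilpotent_normalizer hns hS P hP
  have htop := normalizer_ne_top hP (not_isPGroup_top hns p P)
  have hmin := (hS _ htop).resolve_left hN
  have hco : IsCoatom (Subgroup.normalizer (P : Set G)) := by
    refine ⟨htop, fun H hH => ?_⟩
    by_contra hHt
    exact hN ((hS H hHt).isNilpotent_of_lt hH)
  obtain ⟨p', q, P', x, hs⟩ := exists_isSchmidt hmin
  have hx := hs.orderOf_eq hns hco
  by_cases hpp : p = p'
  · subst hpp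
    have h1 := hs.le_of_isPGroup Subgroup.le_normalizer P.2
    have h2 : P' = P := P.3 hs.isPGroup h1
    rw [h2] at hs
    exact ⟨q, x, hs, hx⟩
  · exfalso
    have hpq : p = q := by
      have h1 := hs.card_dvd Fact.out hpp Subgroup.le_normalizer P.2
      rw [hx] at h1
      have h2 := ((Nat.dvd_prime hs.prime_q).mp h1).resolve_left
        (fun h => hP (Subgroup.card_eq_one.mp h))
      obtain ⟨n, hn⟩ := IsPGroup.iff_card.mp P.2
      have h3 : q ∣ p ^ n := by rw [← hn, h2]
      exact ((Nat.prime_dvd_prime_iff_eq hs.prime_q Fact.out).mp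
        (hs.prime_q.dvd_of_dvd_pow h3)).symm
    subst hpq
    have hxP : x ∈ (P : Subgroup G) := by
      have h1 := IsPGroup.inf_normalizer_sylow hs.isPGroup_zpowers P
      have h2 : x ∈ Subgroup.zpowers x ⊓ Subgroup.normalizer (P : Set G) :=
        ⟨Subgroup.mem_zpowers x, hs.mem⟩
      rw [h1] at h2
      exact h2.2
    have := Fact.mk hs.prime_p
    have hd : Disjoint P' (P : Subgroup G) :=
      IsPGroup.disjoint_of_ne p' p hs.ne _ _ hs.isPGroup P.2
    obtain ⟨y, hy, hxy⟩ := hs.not_commute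
    have h1 : x * y * x⁻¹ * y⁻¹ ∈ P' :=
      P'.mul_mem ((Subgroup.mem_normalizer_iff.mp (hs.le_normalizer hs.mem) y).mp hy)
        (P'.inv_mem hy)
    have h2 : x * (y * x⁻¹ * y⁻¹) ∈ (P : Subgroup G) :=
      P.mul_mem hxP ((Subgroup.mem_normalizer_iff.mp (hs.le hy) x⁻¹).mp (P.inv_mem hxP))
    have h3 : x * y * x⁻¹ * y⁻¹ = 1 := by
      have : x * y * x⁻¹ * y⁻¹ = x * (y * x⁻¹ * y⁻¹) := by group
      have h4 : x * y * x⁻¹ * y⁻¹ ∈ P' ⊓ (P : Subgroup G) := ⟨h1, this ▸ h2⟩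
      rwa [hd.eq_bot, Subgroup.mem_bot] at h4
    rw [mul_inv_eq_one, mul_inv_eq_iff_eq_mul] at h3
    exact hxy h3

end SylowNormalizer

section FixedPoints

variable {G : Type*} [Group G]

theorem card_mul_card_le_card_mul_card_conjSet [Finite G] (N : Subgroup G) (A : Set G)
    (h : ∀ g, ∀ a ∈ A, g * a * g⁻¹ ∈ A → g ∈ N) :
    Nat.card G * Nat.card A ≤ Nat.card N * Nat.card (conjSet A) := by
  rw [← Nat.card_prod, ← Nat.card_prod]
  choose r s hs hrs using fun c : conjSet A => c.2
  let c : G × A → conjSet A := fun x => ⟨x.1 * x.2 * x.1⁻¹, x.1, x.2, x.2.2, rfl⟩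
  have hc : ∀ x, x.1 * (x.2 : G) * x.1⁻¹ = r (c x) * s (c x) * (r (c x))⁻¹ := fun x => hrs (c x)
  have hN : ∀ x : G × A, x.1⁻¹ * r (c x) ∈ N := by
    intro x
    refine h _ (s (c x)) (hs _) ?_
    have : x.1⁻¹ * r (c x) * s (c x) * (x.1⁻¹ * r (c x))⁻¹ = x.2 := by
      calc _ = x.1⁻¹ * (r (c x) * s (c x) * (r (c x))⁻¹) * x.1 := by group
        _ = x.2 := by rw [← hc]; group
    rw [this]
    exact x.2.2
  refine Nat.card_le_card_of_injective (fun x => ((⟨x.1⁻¹ * r (c x), hN x⟩ : N), c x)) ?_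
  rintro ⟨g, a⟩ ⟨g', a'⟩ heq
  rw [Prod.mk.injEq] at heq
  obtain ⟨h1, h2⟩ := heq
  have h1' := congrArg Subtype.val h1
  simp only [h2, mul_left_inj, inv_inj] at h1'
  subst h1'
  have h3 := congrArg Subtype.val h2
  simp only [c, mul_left_inj, mul_right_inj] at h3
  rw [Prod.mk.injEq]
  exact ⟨rfl, Subtype.ext h3⟩

theorem mem_conjSet_diff_one {P : Subgroup G} {p : ℕ} [Fact p.Prime] (hP : IsPGroup p P) {c : G}
    (hc : c ∈ conjSet ((P : Set G) \ {1})) : c ≠ 1 ∧ ∃ n, orderOf c = p ^ n := by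
  obtain ⟨g, a, ⟨ha, ha1⟩, rfl⟩ := hc
  refine ⟨fun h => ha1 (by simpa using h), ?_⟩
  obtain ⟨n, hn⟩ := IsPGroup.iff_orderOf.mp hP ⟨a, ha⟩
  refine ⟨n, ?_⟩
  rw [← hn, Subgroup.orderOf_mk]
  exact orderOf_injective (MulAut.conj g).toMonoidHom (MulAut.conj g).injective a

theorem disjoint_conjSet {P Q : Subgroup G} {p q : ℕ} [Fact p.Prime] [Fact q.Prime] (hpq : p ≠ q)
    (hP : IsPGroup p P) (hQ : IsPGroup q Q) :
    Disjoint (conjSet ((P : Set G) \ {1})) (conjSet ((Q : Set G) \ {1})) := by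
  rw [Set.disjoint_left]
  intro c hc hc'
  obtain ⟨h1, n, hn⟩ := mem_conjSet_diff_one hP hc
  obtain ⟨-, m, hm⟩ := mem_conjSet_diff_one hQ hc'
  have h2 : (orderOf c).Coprime (orderOf c) := by
    conv_lhs => rw [hn]
    rw [hm]
    exact Nat.Coprime.pow n m ((Nat.coprime_primes Fact.out Fact.out).mpr hpq)
  rw [Nat.coprime_self, orderOf_eq_one_iff] at h2
  exact h1 h2

theorem card_diff_one [Finite G] (P : Subgroup G) :
    Nat.card ((P : Set G) \ {1} : Set G) = Nat.card P - 1 := by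
  have := Set.ncard_sdiff_singleton_of_mem (s := (P : Set G)) P.one_mem
  exact this

theorem counting_contradiction {p q P Q g a b c : ℕ} (hp : 2 ≤ p) (hq : 2 ≤ q) (hpq : p ≠ q)
    (hg : 0 < g) (hP : p ^ 2 ≤ P) (hQ : q ^ 2 ≤ Q)
    (ha : P * q * a = g * (P - 1)) (hb : Q * p * b = g * (Q - 1))
    (hc : g * ((q - 1) * (p - 1)) ≤ p * q * c) (habc : a + b + c ≤ g) : False := by
  have hP1 : 1 ≤ P := by nlinarith
  have hQ1 : 1 ≤ Q := by nlinarith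
  zify [hP1, hQ1, (by omega : 1 ≤ q), (by omega : 1 ≤ p)] at *
  have h1 : (P : ℤ) * (g - q * a) = g := by linarith
  have h2 : (Q : ℤ) * (g - p * b) = g := by linarith
  have h1' : (0 : ℤ) < g - q * a := by
    by_contra h; nlinarith
  have h2' : (0 : ℤ) < g - p * b := by
    by_contra h; nlinarith
  have h3 : (p : ℤ) ^ 2 * (g - q * a) ≤ g := by nlinarith
  have h4 : (q : ℤ) ^ 2 * (g - p * b) ≤ g := by nlinarith
  have h5 : (p : ℤ) * q * (a + b + c) ≤ p * q * g := by
    have : (0 : ℤ) ≤ p * q := by positivity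
    nlinarith
  have h6 : (g : ℤ) ≤ p * (g - q * a) + q * (g - p * b) := by nlinarith
  have h7 : (p : ℤ) * (p * (g - q * a)) ≤ g := by linarith [h3, sq (p : ℤ)]
  have h8 : (q : ℤ) * (q * (g - p * b)) ≤ g := by linarith [h4, sq (q : ℤ)]
  set u : ℤ := p * (g - q * a)
  set v : ℤ := q * (g - p * b)
  have hu : 0 ≤ u := by positivity
  have hv : 0 ≤ v := by positivity
  rcases lt_or_gt_of_ne hpq with h | h
  · have : (3 : ℤ) ≤ q := by omega
    nlinarith
  · have : (3 : ℤ) ≤ p := by omega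
    nlinarith

end FixedPoints

section FixedPointFree

variable {G : Type*} [Group G] [Finite G]

theorem IsSchmidt.sq_le_card {p q : ℕ} {M P : Subgroup G} {x : G} (h : IsSchmidt p q M P x)
    (hx : orderOf x = q) {z w : G} (hz : z ∈ P) (hzp : orderOf z = p) (hw : w ∈ M)
    (hwq : orderOf w = q) (hwz : Commute w z) : p ^ 2 ≤ Nat.card P := by
  have := Fact.mk h.prime_p
  obtain ⟨n, hn⟩ := IsPGroup.iff_card.mp h.isPGroup
  by_contra hlt
  rw [hn] at hlt
  have hn1 : n ≤ 1 := by
    by_contra h1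
    exact hlt (Nat.pow_le_pow_right h.prime_p.pos (by omega))
  have hPp : Nat.card P = p := by
    refine le_antisymm ?_ ?_
    · rw [hn]
      exact (Nat.pow_le_pow_right h.prime_p.pos hn1).trans (pow_one p).le
    · have := Subgroup.orderOf_dvd_natCard P hz
      rw [hzp] at this
      exact Nat.le_of_dvd Nat.card_pos this
  have hcard : Nat.card M = p * q := by rw [h.card_eq, hPp, hx]
  have h1 : p ∣ Nat.card (M ⊓ Subgroup.centralizer {z} : Subgroup G) := by
    rw [← hzp]
    exact Subgroup.orderOf_dvd_natCard _
      ⟨h.le hz, Subgroup.mem_centralizer_singleton_iff.mpr rfl⟩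
  have h2 : q ∣ Nat.card (M ⊓ Subgroup.centralizer {z} : Subgroup G) := by
    rw [← hwq]
    exact Subgroup.orderOf_dvd_natCard _
      ⟨hw, Subgroup.mem_centralizer_singleton_iff.mpr hwz.eq⟩
  have h3 := ((Nat.coprime_primes h.prime_p h.prime_q).mpr h.ne).mul_dvd_of_dvd_of_dvd h1 h2
  have h4 : M ⊓ Subgroup.centralizer {z} = M :=
    Subgroup.eq_of_le_of_card_ge inf_le_left (by
      rw [hcard]; exact Nat.le_of_dvd Nat.card_pos h3)
  have h5 : Subgroup.zpowers z = P := Subgroup.eq_of_le_of_card_ge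
    (by rw [Subgroup.zpowers_le]; exact hz) (by rw [Nat.card_zpowers, hzp, hPp])
  obtain ⟨y, hy, hxy⟩ := h.not_commute
  rw [← h5] at hy
  obtain ⟨k, rfl⟩ := Subgroup.mem_zpowers_iff.mp hy
  have h6 : x ∈ M ⊓ Subgroup.centralizer {z} := by rw [h4]; exact h.mem
  have h7 : Commute x z := Subgroup.mem_centralizer_singleton_iff.mp h6.2
  exact hxy (h7.zpow_right k)

theorem orderOf_of_mem_zpowers_prime {G : Type*} [Group G] {x u : G} {q : ℕ} (hq : q.Prime)
    (hx : orderOf x = q)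
    (hu : u ∈ Subgroup.zpowers x) (hu1 : u ≠ 1) : orderOf u = q := by
  have h1 : orderOf u ∣ q := by rw [← hx]; exact orderOf_dvd_of_mem_zpowers hu
  exact ((Nat.dvd_prime hq).mp h1).resolve_left fun h => hu1 (orderOf_eq_one_iff.mp h)

theorem commute_of_mem_zpowers {G : Type*} [Group G] {x z u v : G} (h : Commute x z)
    (hu : u ∈ Subgroup.zpowers x)
    (hv : v ∈ Subgroup.zpowers z) : Commute u v := by
  obtain ⟨k, rfl⟩ := Subgroup.mem_zpowers_iff.mp hu
  obtain ⟨l, rfl⟩ := Subgroup.mem_zpowers_iff.mp hv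
  exact (h.zpow_left k).zpow_right l

theorem not_commute_of_isSchmidt_normalizer [IsSimpleGroup G] (hns : ¬ Group.IsSolvable G)
    (hS : ∀ H : Subgroup G, H ≠ ⊤ → NilpotentOrMinimal H)
    {p q : ℕ} [Fact p.Prime] (P : Sylow p G) {x : G}
    (h : IsSchmidt p q (Subgroup.normalizer (P : Set G)) P x) (hx : orderOf x = q) {z : G}
    (hz : z ∈ (P : Subgroup G)) (hzp : orderOf z = p) : ¬ Commute x z := by
  intro hxz
  have hpp : p.Prime := Fact.out
  have := Fact.mk h.prime_q
  obtain ⟨Q, hQ⟩ := h.isPGroup_zpowers.exists_le_sylow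
  have hxQ : x ∈ (Q : Subgroup G) := hQ (Subgroup.mem_zpowers x)
  have hQb : (Q : Subgroup G) ≠ ⊥ := fun hb => h.ne_one (by rwa [hb, Subgroup.mem_bot] at hxQ)
  have hz1 : z ≠ 1 := fun h1 => hpp.one_lt.ne (by rw [← hzp, h1, orderOf_one])
  have hzN : z ∈ Subgroup.normalizer (Q : Set G) := by
    refine mem_normalizer_of_conj_mem hns hS Q hxQ h.ne_one ?_
    rw [← hxz.eq, mul_inv_cancel_right]
    exact hxQ
  obtain ⟨q', y, hs, hy⟩ := exists_isSchmidt_normalizer hns hS Q hQb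
  have hzpg : IsPGroup p (Subgroup.zpowers z) :=
    P.2.to_le (by rw [Subgroup.zpowers_le]; exact hz)
  have hq' : q' = p := by
    have h1 := hs.card_dvd hpp h.ne (by rw [Subgroup.zpowers_le]; exact hzN) hzpg
    rw [hy, Nat.card_zpowers, hzp] at h1
    exact ((Nat.prime_dvd_prime_iff_eq hpp hs.prime_q).mp h1).symm
  subst hq'
  have hP2 := h.sq_le_card hx hz hzp h.mem hx hxz
  have hQ2 := hs.sq_le_card hy hxQ hx hzN hzp hxz.symm
  set U : Set G := (Subgroup.zpowers x : Set G) \ {1}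
  set V : Set G := (Subgroup.zpowers z : Set G) \ {1}
  set A : Set G := (fun a : G × G => a.1 * a.2) '' (U ×ˢ V) with hA
  have hd : Disjoint (Subgroup.zpowers x) (Subgroup.zpowers z) :=
    IsPGroup.disjoint_of_ne q q' h.ne.symm _ _ h.isPGroup_zpowers hzpg
  have hAc : Nat.card A = (q - 1) * (q' - 1) := by
    have h1 : Set.InjOn (fun a : G × G => a.1 * a.2) (U ×ˢ V) := by
      rintro ⟨u, v⟩ ⟨hu, hv⟩ ⟨u', v'⟩ ⟨hu', hv'⟩ heq
      have := Subgroup.mul_injective_of_disjoint hd (a₁ := (⟨u, hu.1⟩, ⟨v, hv.1⟩))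
        (a₂ := (⟨u', hu'.1⟩, ⟨v', hv'.1⟩)) heq
      simpa using this
    rw [Nat.card_image_of_injOn h1, Nat.card_congr (Equiv.Set.prod U V), Nat.card_prod,
      card_diff_one, card_diff_one, Nat.card_zpowers, Nat.card_zpowers, hx, hzp]
  have hAe : ∀ a ∈ A, orderOf a = q * q' ∧ a ^ q' ∈ (Q : Subgroup G) ∧ a ^ q ∈ (P : Subgroup G) ∧
      a ^ q' ≠ 1 ∧ a ^ q ≠ 1 := by
    rintro _ ⟨⟨u, v⟩, ⟨⟨hu, hu1⟩, ⟨hv, hv1⟩⟩, rfl⟩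
    have huv := commute_of_mem_zpowers hxz hu hv
    have h1 := orderOf_of_mem_zpowers_prime h.prime_q hx hu hu1
    have h2 := orderOf_of_mem_zpowers_prime hpp hzp hv hv1
    have hcop : Nat.Coprime (orderOf u) (orderOf v) := by
      rw [h1, h2]; exact (Nat.coprime_primes h.prime_q hpp).mpr h.ne.symm
    simp only
    rw [huv.orderOf_mul_eq_mul_orderOf_of_coprime hcop, h1, h2]
    have h3 : (u * v) ^ q' = u ^ q' := by
      rw [huv.mul_pow, ← h2, pow_orderOf_eq_one, mul_one]
    have h4 : (u * v) ^ q = v ^ q := by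
      rw [huv.mul_pow, ← h1, pow_orderOf_eq_one, one_mul]
    rw [h3, h4]
    refine ⟨rfl, Subgroup.pow_mem _ (hQ hu) _, Subgroup.pow_mem _ ?_ _, ?_, ?_⟩
    · exact (Subgroup.zpowers_le.mpr hz : Subgroup.zpowers z ≤ P) hv
    · intro h5
      have := orderOf_dvd_of_pow_eq_one h5
      rw [h1] at this
      exact h.ne ((Nat.prime_dvd_prime_iff_eq h.prime_q hpp).mp this).symm
    · intro h5
      have := orderOf_dvd_of_pow_eq_one h5
      rw [h2] at this
      exact h.ne ((Nat.prime_dvd_prime_iff_eq hpp h.prime_q).mp this)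
  have hcA := card_mul_card_le_card_mul_card_conjSet
    (Subgroup.normalizer (P : Set G) ⊓ Subgroup.normalizer (Q : Set G)) A (by
      intro g a ha hga
      obtain ⟨-, h1, h2, h3, h4⟩ := hAe a ha
      obtain ⟨-, h1', h2', -, -⟩ := hAe _ hga
      rw [conj_pow] at h1' h2'
      exact ⟨mem_normalizer_of_conj_mem hns hS P h2 h4 h2',
        mem_normalizer_of_conj_mem hns hS Q h1 h3 h1'⟩)
  have hN0 : Nat.card (Subgroup.normalizer (P : Set G) ⊓ Subgroup.normalizer (Q : Set G) :
      Subgroup G) ≤ q' * q := by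
    have h1 := Subgroup.card_dvd_of_le
      (inf_le_left : Subgroup.normalizer (P : Set G) ⊓ Subgroup.normalizer (Q : Set G) ≤ _)
    have h2 := Subgroup.card_dvd_of_le
      (inf_le_right : Subgroup.normalizer (P : Set G) ⊓ Subgroup.normalizer (Q : Set G) ≤ _)
    rw [h.card_eq, hx] at h1
    rw [hs.card_eq, hy] at h2
    have hcop := coprime_of_isPGroup hpp h.prime_q h.ne P.2 Q.2
    have h3 : Nat.card (Subgroup.normalizer (P : Set G) ⊓ Subgroup.normalizer (Q : Set G) :
        Subgroup G) ∣ q' * q := by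
      have e1 : Nat.card (Subgroup.normalizer (P : Set G) ⊓ Subgroup.normalizer (Q : Set G) :
          Subgroup G) ∣ Nat.card P * (q' * q) := h1.trans ⟨q', by ring⟩
      have e2 : Nat.card (Subgroup.normalizer (P : Set G) ⊓ Subgroup.normalizer (Q : Set G) :
          Subgroup G) ∣ Nat.card Q * (q' * q) := h2.trans ⟨q, by ring⟩
      have e3 := Nat.dvd_gcd e1 e2
      rwa [Nat.gcd_mul_right, hcop.gcd_eq_one, one_mul] at e3
    exact Nat.le_of_dvd (Nat.mul_pos hpp.pos h.prime_q.pos) h3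
  have hconj : ∀ {r : ℕ} [Fact r.Prime] (R : Sylow r G),
      Nat.card (Subgroup.normalizer (R : Set G)) * Nat.card
        (conjSet (((R : Subgroup G) : Set G) \ {1})) =
      Nat.card G * (Nat.card R - 1) := by
    intro r _ R
    rw [card_mul_card_conjSet (Subgroup.normalizer (R : Set G))]
    · congr 1
      exact card_diff_one (R : Subgroup G)
    · rintro n hn a ⟨ha, ha1⟩
      exact ⟨(Subgroup.mem_normalizer_iff.mp hn a).mp ha, fun h1 => ha1 (by simpa using h1)⟩
    · rintro g a ⟨ha, ha1⟩ ⟨hb, -⟩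
      exact mem_normalizer_of_conj_mem hns hS R ha ha1 hb
  have hcP := hconj P
  have hcQ := hconj Q
  rw [h.card_eq, hx] at hcP
  rw [hs.card_eq, hy] at hcQ
  have hdPQ := disjoint_conjSet h.ne P.2 Q.2
  have hdA : Disjoint (conjSet (((P : Subgroup G) : Set G) \ {1}) ∪ conjSet
      (((Q : Subgroup G) : Set G) \ {1})) (conjSet A) := by
    rw [Set.disjoint_left]
    rintro c hc ⟨g, a, ha, rfl⟩
    have h1 : orderOf (g * a * g⁻¹) = q * q' := by
      rw [← (hAe a ha).1]
      exact orderOf_injective (MulAut.conj g).toMonoidHom (MulAut.conj g).injective a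
    rcases hc with hc | hc
    · obtain ⟨-, n, hn⟩ := mem_conjSet_diff_one P.2 hc
      rw [h1] at hn
      exact h.ne ((Nat.prime_dvd_prime_iff_eq h.prime_q hpp).mp
        (h.prime_q.dvd_of_dvd_pow (hn ▸ Dvd.intro _ rfl))).symm
    · obtain ⟨-, n, hn⟩ := mem_conjSet_diff_one Q.2 hc
      rw [h1] at hn
      exact h.ne ((Nat.prime_dvd_prime_iff_eq hpp h.prime_q).mp
        (hpp.dvd_of_dvd_pow (hn ▸ Dvd.intro_left _ rfl)))
  have hsum : Nat.card (conjSet (((P : Subgroup G) : Set G) \ {1})) + Nat.card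
      (conjSet (((Q : Subgroup G) : Set G) \ {1})) +
      Nat.card (conjSet A) ≤ Nat.card G := by
    have h1 := Set.ncard_union_eq hdPQ (Set.toFinite _) (Set.toFinite _)
    have h2 := Set.ncard_union_eq hdA (Set.toFinite _) (Set.toFinite _)
    have h3 := Set.ncard_le_card ((conjSet (((P : Subgroup G) : Set G) \ {1}) ∪ conjSet
        (((Q : Subgroup G) : Set G) \ {1})) ∪
      conjSet A)
    simp only [← Nat.card_coe_set_eq] at h1 h2 h3
    omega
  rw [hAc] at hcA
  exact counting_contradiction hpp.two_le h.prime_q.two_le h.ne Nat.card_pos hP2 hQ2 hcP hcQ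
    (hcA.trans (Nat.mul_le_mul_right _ hN0)) hsum

end FixedPointFree

section FrobeniusNormalizer

variable {G : Type*} [Group G]

/-- `P` is a Sylow `p`-subgroup that is a trivial intersection subgroup and whose normalizer is a
minimal non-nilpotent Frobenius group with kernel `P` and complement of prime order `q`
generated by `x`. -/
structure IsFrobeniusSylow (p q : ℕ) (P : Subgroup G) (x : G) : Prop where
  isSchmidt : IsSchmidt p q (Subgroup.normalizer (P : Set G)) P x
  orderOf_eq : orderOf x = q
  le_of_isPGroup : ∀ R : Subgroup G, IsPGroup p R → P ≤ R → R = P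
  eq_one_of_commute : ∀ z ∈ P, Commute x z → z = 1
  mem_normalizer : ∀ a ∈ P, a ≠ 1 → ∀ g, g * a * g⁻¹ ∈ P → g ∈ Subgroup.normalizer (P : Set G)

variable {p q : ℕ} {P : Subgroup G} {x : G}

theorem exists_isFrobeniusSylow [Finite G] [IsSimpleGroup G] (hns : ¬ Group.IsSolvable G)
    (hS : ∀ H : Subgroup G, H ≠ ⊤ → NilpotentOrMinimal H)
    {p : ℕ} [Fact p.Prime] (P : Sylow p G) (hP : (P : Subgroup G) ≠ ⊥) :
    ∃ q x, IsFrobeniusSylow p q (P : Subgroup G) x := by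
  obtain ⟨q, x, h, hx⟩ := exists_isSchmidt_normalizer hns hS P hP
  refine ⟨q, x, h, hx, fun R hR hPR => P.3 hR hPR, fun z hz hxz => ?_,
    fun a ha ha1 g hg => mem_normalizer_of_conj_mem hns hS P ha ha1 hg⟩
  by_contra hz1
  obtain ⟨n, hn⟩ := IsPGroup.iff_orderOf.mp P.2 ⟨z, hz⟩
  rw [Subgroup.orderOf_mk] at hn
  rcases n with _ | n
  · exact hz1 (orderOf_eq_one_iff.mp (by simpa using hn))
  · refine not_commute_of_isSchmidt_normalizer hns hS P h hx (z := z ^ p ^ n)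
      (Subgroup.pow_mem _ hz _) ?_ (hxz.pow_right _)
    have hp : p.Prime := Fact.out
    have hpn : 0 < p ^ n := pow_pos hp.pos n
    rw [orderOf_pow' z hpn.ne', hn, Nat.gcd_eq_right (pow_dvd_pow p n.le_succ), pow_succ,
      Nat.mul_div_cancel_left _ hpn]

namespace IsFrobeniusSylow

theorem prime_p (h : IsFrobeniusSylow p q P x) : p.Prime := h.isSchmidt.prime_p

theorem prime_q (h : IsFrobeniusSylow p q P x) : q.Prime := h.isSchmidt.prime_q

theorem conj_mem (h : IsFrobeniusSylow p q P x) {y : G} (hy : y ∈ P) : x * y * x⁻¹ ∈ P :=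
  (Subgroup.mem_normalizer_iff.mp h.isSchmidt.mem y).mp hy

theorem card_normalizer [Finite G] (h : IsFrobeniusSylow p q P x) :
    Nat.card (Subgroup.normalizer (P : Set G)) = Nat.card P * q := by
  rw [h.isSchmidt.card_eq, h.orderOf_eq]

theorem eq_of_invariant (h : IsFrobeniusSylow p q P x) {R : Subgroup G} (hR : R ≤ P)
    (hinv : ∀ y ∈ R, x * y * x⁻¹ ∈ R) : R = ⊥ ∨ R = P := by
  rcases hR.eq_or_lt with h1 | h1
  · exact Or.inr h1
  · left
    rw [Subgroup.eq_bot_iff_forall]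
    intro y hy
    exact h.eq_one_of_commute y (hR hy) (h.isSchmidt.commute_of_lt R h1 hinv y hy)

open scoped commutatorElement in
theorem commute [Finite G] (h : IsFrobeniusSylow p q P x) {a b : G} (ha : a ∈ P) (hb : b ∈ P) :
    Commute a b := by
  have := Fact.mk h.prime_p
  have hnil : Group.IsNilpotent P := h.isSchmidt.isPGroup.isNilpotent
  have hle : ⁅P, P⁆ ≤ P := by
    rw [Subgroup.commutator_le]
    intro a ha b hb
    exact P.mul_mem (P.mul_mem (P.mul_mem ha hb) (P.inv_mem ha)) (P.inv_mem hb)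
  have hbot : ⁅P, P⁆ = ⊥ := by
    refine (h.eq_of_invariant hle ?_).resolve_right ?_
    · intro y hy
      have h1 : (MulAut.conj x).toMonoidHom y ∈ ⁅P, P⁆.map (MulAut.conj x).toMonoidHom :=
          ⟨y, hy, rfl⟩
      rw [Subgroup.map_commutator] at h1
      have h2 : P.map (MulAut.conj x).toMonoidHom = P :=
        mem_normalizer_iff_map_conj.mp h.isSchmidt.mem
      rw [h2] at h1
      exact h1
    · intro h1
      have hnt : Nontrivial P := (Subgroup.nontrivial_iff_ne_bot P).mpr h.isSchmidt.ne_bot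
      have h2 := Group.IsSolvable.commutator_lt_top_of_nontrivial P
      refine h2.ne ?_
      have h3 := Subgroup.map_subtype_commutator P
      rw [h1] at h3
      refine Subgroup.map_injective P.subtype_injective ?_
      rw [h3, ← MonoidHom.range_eq_map, Subgroup.range_subtype]
  have h1 : ⁅a, b⁆ ∈ ⁅P, P⁆ := Subgroup.commutator_mem_commutator ha hb
  rw [hbot, Subgroup.mem_bot] at h1
  exact commutatorElement_eq_one_iff_commute.mp h1

theorem mem_of_commute [Finite G] (h : IsFrobeniusSylow p q P x) {a c : G} (ha : a ∈ P)
    (ha1 : a ≠ 1) (hc : Commute c a) : c ∈ P := by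
  have hcN : c ∈ Subgroup.normalizer (P : Set G) := by
    refine h.mem_normalizer a ha ha1 c ?_
    rwa [hc.eq, mul_inv_cancel_right]
  obtain ⟨y, hy, z, hz, rfl⟩ := h.isSchmidt.exists_mul hcN
  by_cases hz1 : z = 1
  · rw [hz1, mul_one]; exact hy
  exfalso
  have hza : Commute z a := by
    have h1 := ((h.commute hy ha).inv_left).mul_left hc
    rwa [inv_mul_cancel_left] at h1
  have hzo := orderOf_of_mem_zpowers_prime h.prime_q h.orderOf_eq hz hz1
  have hx : x ∈ Subgroup.zpowers z := by
    have h1 : Subgroup.zpowers z = Subgroup.zpowers x :=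
      Subgroup.eq_of_le_of_card_ge (Subgroup.zpowers_le.mpr hz)
        (by rw [Nat.card_zpowers, Nat.card_zpowers, hzo, h.orderOf_eq])
    rw [h1]
    exact Subgroup.mem_zpowers x
  exact ha1 (h.eq_one_of_commute a ha (commute_of_mem_zpowers hza hx (Subgroup.mem_zpowers a)))

theorem pow_eq_one [Finite G] (h : IsFrobeniusSylow p q P x) {y : G} (hy : y ∈ P) :
    y ^ p = 1 := by
  have := Fact.mk h.prime_p
  let R : Subgroup G :=
    { carrier := {y | y ∈ P ∧ y ^ p = 1}
      mul_mem' := fun {a b} ha hb => ⟨P.mul_mem ha.1 hb.1, by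
        rw [(h.commute ha.1 hb.1).mul_pow, ha.2, hb.2, one_mul]⟩
      one_mem' := ⟨P.one_mem, one_pow p⟩
      inv_mem' := fun {a} ha => ⟨P.inv_mem ha.1, by rw [inv_pow, ha.2, inv_one]⟩ }
  have hR : R = P := by
    refine (h.eq_of_invariant (R := R) (fun y hy => hy.1)
      (fun y hy => ⟨h.conj_mem hy.1, by rw [conj_pow, hy.2]; group⟩)).resolve_left fun hb => ?_
    have hdvd : p ∣ Nat.card P := by
      obtain ⟨n, hn⟩ := IsPGroup.iff_card.mp h.isSchmidt.isPGroup
      rcases n with _ | n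
      · exact (h.isSchmidt.ne_bot (Subgroup.card_eq_one.mp (by simpa using hn))).elim
      · rw [hn]; exact dvd_pow_self p n.succ_ne_zero
    obtain ⟨z, hz⟩ := exists_prime_orderOf_dvd_card' p hdvd
    have h1 : (z : G) ∈ R := ⟨z.2, by
      rw [← hz, ← Subgroup.coe_pow, pow_orderOf_eq_one, Subgroup.coe_one]⟩
    rw [hb, Subgroup.mem_bot, OneMemClass.coe_eq_one] at h1
    rw [h1, orderOf_one] at hz
    exact h.prime_p.one_lt.ne hz
  have h1 : y ∈ R := by rw [hR]; exact hy
  exact h1.2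

theorem conj_eq_inv [Finite G] (h : IsFrobeniusSylow p 2 P x) {y : G} (hy : y ∈ P) :
    x * y * x⁻¹ = y⁻¹ := by
  have hx2 : x * x = 1 := by
    have := pow_orderOf_eq_one x
    rwa [h.orderOf_eq, sq] at this
  have hxi : x⁻¹ = x := inv_eq_of_mul_eq_one_left hx2
  have h1 := h.conj_mem hy
  have h2 : Commute x (x * y * x⁻¹ * y) := by
    calc x * (x * y * x⁻¹ * y) = x * x * (y * x⁻¹ * y) := by group
      _ = y * (x * y * x⁻¹) * x := by
          rw [hx2, hxi]; simp only [one_mul, mul_assoc, hx2, mul_one]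
      _ = x * y * x⁻¹ * y * x := by rw [(h.commute h1 hy).eq]
  exact eq_inv_of_mul_eq_one_left (h.eq_one_of_commute _ (P.mul_mem h1 hy) h2)

theorem card_eq_of_two [Finite G] (h : IsFrobeniusSylow p 2 P x) : Nat.card P = p := by
  have := Fact.mk h.prime_p
  obtain ⟨y, hy1⟩ := Subgroup.ne_bot_iff_exists_ne_one.mp h.isSchmidt.ne_bot
  obtain ⟨y, hy⟩ := y
  have hy1 : y ≠ 1 := fun h1 => hy1 (Subtype.ext h1)
  have h1 : Subgroup.zpowers y = P := by
    refine (h.eq_of_invariant (Subgroup.zpowers_le.mpr hy) fun z hz => ?_).resolve_left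
      fun h1 => hy1 (Subgroup.zpowers_eq_bot.mp h1)
    rw [h.conj_eq_inv (Subgroup.zpowers_le.mpr hy hz)]
    exact Subgroup.inv_mem _ hz
  rw [← h1, Nat.card_zpowers]
  exact orderOf_eq_prime (h.pow_eq_one hy) hy1

end IsFrobeniusSylow

end FrobeniusNormalizer

section EvenOrder

variable {G : Type*} [Group G] [Finite G] {p q : ℕ} {P : Subgroup G} {x : G}

namespace IsFrobeniusSylow

theorem exists_ne_one {G : Type*} [Group G] {P : Subgroup G} {x : G}
    (h : IsFrobeniusSylow p q P x) : ∃ y ∈ P, y ≠ 1 := by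
  obtain ⟨⟨y, hy⟩, hy1⟩ := Subgroup.ne_bot_iff_exists_ne_one.mp h.isSchmidt.ne_bot
  exact ⟨y, hy, fun h1 => hy1 (Subtype.ext h1)⟩

theorem eq_one_of_mem_zpowers_of_commute (h : IsFrobeniusSylow p q P x) {y w : G} (hy : y ∈ P)
    (hy1 : y ≠ 1) (hw : w ∈ Subgroup.zpowers x) (hc : Commute w y) : w = 1 := by
  have h1 := h.mem_of_commute hy hy1 hc
  have h2 : w ∈ P ⊓ Subgroup.zpowers x := ⟨h1, hw⟩
  rwa [h.isSchmidt.disjoint.eq_bot, Subgroup.mem_bot] at h2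

theorem lt_card (h : IsFrobeniusSylow p q P x) : q < Nat.card P := by
  obtain ⟨y, hy, hy1⟩ := h.exists_ne_one
  have h1 : Nat.card (Subgroup.zpowers x) ≤ Nat.card ((P : Set G) \ {1} : Set G) := by
    refine Nat.card_le_card_of_injective (fun w => ⟨w * y * (w : G)⁻¹, ?_, ?_⟩) ?_
    · have hw : (w : G) ∈ Subgroup.normalizer (P : Set G) :=
        Subgroup.zpowers_le.mpr h.isSchmidt.mem w.2
      exact (Subgroup.mem_normalizer_iff.mp hw y).mp hy
    · intro h2
      exact hy1 (by simpa using h2)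
    · intro w w' heq
      have h2 : (w : G) * y * (w : G)⁻¹ = w' * y * (w' : G)⁻¹ := congrArg Subtype.val heq
      have h3 : Commute ((w' : G)⁻¹ * w) y := by
        have h4 : (w' : G)⁻¹ * w * y = y * ((w' : G)⁻¹ * w) := by
          calc (w' : G)⁻¹ * w * y = (w' : G)⁻¹ * (w * y * (w : G)⁻¹) * w := by group
            _ = y * ((w' : G)⁻¹ * w) := by rw [h2]; group
        exact h4
      have h4 := h.eq_one_of_mem_zpowers_of_commute hy hy1
        (Subgroup.mul_mem _ (Subgroup.inv_mem _ w'.2) w.2) h3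
      rw [inv_mul_eq_one] at h4
      exact Subtype.ext h4.symm
  rw [card_diff_one, Nat.card_zpowers, h.orderOf_eq] at h1
  have := Nat.card_pos (α := P)
  omega

theorem card_mul_card_conjSet (h : IsFrobeniusSylow p q P x) :
    Nat.card P * q * Nat.card (conjSet ((P : Set G) \ {1})) = Nat.card G * (Nat.card P - 1) := by
  rw [← h.card_normalizer, ← card_diff_one]
  refine _root_.card_mul_card_conjSet _ _ ?_ ?_
  · rintro n hn a ⟨ha, ha1⟩
    exact ⟨(Subgroup.mem_normalizer_iff.mp hn a).mp ha, fun h1 => ha1 (by simpa using h1)⟩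
  · rintro g a ⟨ha, ha1⟩ ⟨hb, -⟩
    exact h.mem_normalizer a ha ha1 g hb

/-- The Sylow subgroup underlying `IsFrobeniusSylow`. -/
def toSylow {G : Type*} [Group G] {P : Subgroup G} {x : G}
    (h : IsFrobeniusSylow p q P x) : Sylow p G :=
  ⟨P, h.isSchmidt.isPGroup, fun {R} hR hPR => h.le_of_isPGroup R hR hPR⟩

theorem mem_conjSet (h : IsFrobeniusSylow p q P x) {y : G} (hy : y ≠ 1) {n : ℕ}
    (hyp : y ^ p ^ n = 1) : y ∈ conjSet ((P : Set G) \ {1}) := by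
  have := Fact.mk h.prime_p
  have hpg : IsPGroup p (Subgroup.zpowers y) := by
    refine IsPGroup.iff_card.mpr ?_
    rw [Nat.card_zpowers]
    obtain ⟨k, -, hk⟩ := (Nat.dvd_prime_pow h.prime_p).mp (orderOf_dvd_of_pow_eq_one hyp)
    exact ⟨k, hk⟩
  obtain ⟨Q, hQ⟩ := hpg.exists_le_sylow
  obtain ⟨g, hg⟩ := MulAction.exists_smul_eq G h.toSylow Q
  have hy2 : y ∈ (Q : Subgroup G) := hQ (Subgroup.mem_zpowers y)
  rw [← hg, Sylow.smul_def] at hy2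
  obtain ⟨a, ha, hay⟩ := hy2
  refine ⟨g, a, ⟨ha, ?_⟩, hay.symm⟩
  rintro rfl
  exact hy (by rw [← hay]; simp)

theorem card_eq_and_eq {q' : ℕ} {P' : Subgroup G} {x' : G} (h : IsFrobeniusSylow p q P x)
    (h' : IsFrobeniusSylow p q' P' x') : Nat.card P = Nat.card P' ∧ q = q' := by
  have := Fact.mk h.prime_p
  have h1 : Nat.card P = Nat.card P' :=
    h.toSylow.card_eq_multiplicity.trans h'.toSylow.card_eq_multiplicity.symm
  have h2 := h.toSylow.card_eq_index_normalizer.symm.trans h'.toSylow.card_eq_index_normalizer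
  have h3 := (Subgroup.normalizer (P : Set G)).card_mul_index
  have h4 := (Subgroup.normalizer (P' : Set G)).card_mul_index
  change (Subgroup.normalizer (P : Set G)).index = (Subgroup.normalizer (P' : Set G)).index at h2
  rw [← h4, h2] at h3
  have h5 := Nat.eq_of_mul_eq_mul_right
    (Nat.pos_of_ne_zero Subgroup.index_ne_zero_of_finite) h3
  rw [h.card_normalizer, h'.card_normalizer, h1] at h5
  exact ⟨h1, Nat.eq_of_mul_eq_mul_left Nat.card_pos h5⟩

end IsFrobeniusSylow

theorem sum_primeFactors_sub_one_le {n : ℕ} (hn : n ≠ 0) :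
    ∑ r ∈ n.primeFactors, (r - 1) ≤ n - 1 ∧
      (∑ r ∈ n.primeFactors, (r - 1) = n - 1 → n = 1 ∨ n.Prime) := by
  induction n using Nat.strong_induction_on with
  | _ n ih =>
  by_cases h1 : n = 1
  · subst h1; simp
  by_cases hp : n.Prime
  · rw [hp.primeFactors]; simp [hp]
  obtain ⟨r, hr, m, rfl⟩ := Nat.exists_prime_and_dvd h1
  have hm0 : m ≠ 0 := by rintro rfl; simp at hn
  have hm1 : m ≠ 1 := by rintro rfl; simp [hr] at hp
  have hr2 := hr.two_le
  have hm := (ih m (by nlinarith [Nat.pos_of_ne_zero hm0]) hm0).1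
  have h2 : ∑ s ∈ (r * m).primeFactors, (s - 1) ≤ (r - 1) + (m - 1) := by
    rw [Nat.primeFactors_mul hr.ne_zero hm0, hr.primeFactors]
    calc _ ≤ ∑ s ∈ {r}, (s - 1) + ∑ s ∈ m.primeFactors, (s - 1) := by
          rw [← Finset.sum_union_inter]
          exact Nat.le_add_right _ _
      _ ≤ _ := by rw [Finset.sum_singleton]; omega
  have h3 : (r - 1) + (m - 1) < r * m - 1 := by
    obtain ⟨a, rfl⟩ := Nat.exists_eq_add_of_le hr2
    obtain ⟨b, rfl⟩ := Nat.exists_eq_add_of_le (show 2 ≤ m by omega)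
    have : (2 + a) * (2 + b) = 4 + 2 * a + 2 * b + a * b := by ring
    have : 0 ≤ a * b := Nat.zero_le _
    omega
  exact ⟨by omega, fun h => by omega⟩

end EvenOrder

section InvolutionCount

variable {G : Type*} [Group G] [Finite G] {p q : ℕ} {P : Subgroup G} {x : G}

/-- Every nontrivial Sylow subgroup is a trivial intersection subgroup with a Frobenius
normalizer. -/
def SylowFrobenius (G : Type*) [Group G] : Prop :=
  ∀ (p : ℕ) [Fact p.Prime] (P : Sylow p G), (P : Subgroup G) ≠ ⊥ →
    ∃ q x, IsFrobeniusSylow p q (P : Subgroup G) x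

theorem SylowFrobenius.exists_mem (hF : SylowFrobenius G) {y : G} (hy : y ≠ 1) :
    ∃ (p q : ℕ) (P : Subgroup G) (x : G), IsFrobeniusSylow p q P x ∧ y ∈ P := by
  have h1 : orderOf y ≠ 1 := fun h => hy (orderOf_eq_one_iff.mp h)
  obtain ⟨p, hp, m, hm⟩ := Nat.exists_prime_and_dvd h1
  have := Fact.mk hp
  have hm0 : m ≠ 0 := by rintro rfl; exact (orderOf_pos y).ne' hm
  have hz : orderOf (y ^ m) = p := by
    rw [orderOf_pow' y hm0, hm, Nat.gcd_eq_right (Dvd.intro_left p rfl),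
      Nat.mul_div_cancel _ (Nat.pos_of_ne_zero hm0)]
  have hpg : IsPGroup p (Subgroup.zpowers (y ^ m)) :=
    IsPGroup.iff_card.mpr ⟨1, by rw [Nat.card_zpowers, hz, pow_one]⟩
  obtain ⟨Q, hQ⟩ := hpg.exists_le_sylow
  have hzQ : y ^ m ∈ (Q : Subgroup G) := hQ (Subgroup.mem_zpowers _)
  have hz1 : y ^ m ≠ 1 := fun h => hp.one_lt.ne (by rw [← hz, h, orderOf_one])
  obtain ⟨q, x, h⟩ := hF p Q (fun hb => hz1 (by rwa [hb, Subgroup.mem_bot] at hzQ))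
  exact ⟨p, q, Q, x, h, h.mem_of_commute hzQ hz1 ((Commute.refl y).pow_right m)⟩

theorem IsFrobeniusSylow.orderOf_eq_of_mem (h : IsFrobeniusSylow p q P x) {y : G} (hy : y ∈ P)
    (hy1 : y ≠ 1) : orderOf y = p :=
  have := Fact.mk h.prime_p
  orderOf_eq_prime (h.pow_eq_one hy) hy1

theorem SylowFrobenius.exists_mem_of_orderOf (hF : SylowFrobenius G) {y : G} {p : ℕ}
    (hp : p.Prime) (hy : orderOf y = p) : ∃ (q : ℕ) (P : Subgroup G) (x : G),
      IsFrobeniusSylow p q P x ∧ y ∈ P := by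
  have hy1 : y ≠ 1 := fun h => hp.one_lt.ne (by rw [← hy, h, orderOf_one])
  obtain ⟨p', q, P, x, h, hyP⟩ := hF.exists_mem hy1
  obtain rfl : p' = p := by rw [← hy, h.orderOf_eq_of_mem hyP hy1]
  exact ⟨q, P, x, h, hyP⟩

theorem IsFrobeniusSylow.mul_card_orderOf [Fintype G] [DecidableEq G]
    (h : IsFrobeniusSylow p q P x) :
    Nat.card P * q * (Finset.univ.filter fun y : G => orderOf y = p).card =
      Nat.card G * (Nat.card P - 1) := by
  rw [← h.card_mul_card_conjSet, ← Set.ncard_coe_finset]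
  congr 2
  ext y
  rw [Finset.coe_filter_univ, Set.mem_ofPred_eq]
  constructor
  · intro hy
    refine h.mem_conjSet (n := 1) ?_ ?_
    · rintro rfl
      exact h.prime_p.one_lt.ne (by rw [← hy, orderOf_one])
    · rw [pow_one, ← hy, pow_orderOf_eq_one]
  · rintro ⟨g, a, ⟨ha, ha1⟩, rfl⟩
    rw [← h.orderOf_eq_of_mem ha ha1]
    exact orderOf_injective (MulAut.conj g).toMonoidHom (MulAut.conj g).injective a

theorem mul_self_eq_one_of_orderOf {G : Type*} [Group G] {s : G} (hs : orderOf s = 2) :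
    s * s = 1 := by
  rw [← sq, ← hs, pow_orderOf_eq_one]

theorem conj_eq_inv_of_orderOf {G : Type*} [Group G] {s y : G} (hs : orderOf s = 2)
    (hsy : orderOf (s * y) = 2) :
    s * y * s⁻¹ = y⁻¹ := by
  have h1 := mul_self_eq_one_of_orderOf hs
  have h2 := mul_self_eq_one_of_orderOf hsy
  have h3 : s⁻¹ = s := inv_eq_of_mul_eq_one_left h1
  rw [h3, eq_inv_iff_mul_eq_one, ← h2]
  group

/-- The number of ways to write `y` as a product of two involutions is small. -/
theorem SylowFrobenius.card_involution_pairs [Fintype G] [DecidableEq G] (hF : SylowFrobenius G)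
    (h : IsFrobeniusSylow 2 q P x) {y : G} (hy : y ≠ 1) :
    (orderOf y = 2 →
      (Finset.univ.filter fun s : G => orderOf s = 2 ∧ orderOf (s * y) = 2).card + 2 ≤
        Nat.card P) ∧
    (orderOf y ≠ 2 → ∀ s : G, orderOf s = 2 → orderOf (s * y) = 2 →
      (∃ (R : Subgroup G) (z : G), IsFrobeniusSylow (orderOf y) 2 R z) ∧
      (Finset.univ.filter fun s : G => orderOf s = 2 ∧ orderOf (s * y) = 2).card ≤ orderOf y) := by
  classical
  constructor
  · intro hy2
    obtain ⟨q', Q, x', hQ, hyQ⟩ := hF.exists_mem_of_orderOf Nat.prime_two hy2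
    rw [(h.card_eq_and_eq hQ).1]
    have h1 : (Finset.univ.filter fun s : G => orderOf s = 2 ∧ orderOf (s * y) = 2) ⊆
        ((Finset.univ.filter fun s : G => s ∈ Q).erase 1).erase y := by
      intro s hs
      simp only [Finset.mem_filter, Finset.mem_univ, true_and] at hs
      simp only [Finset.mem_erase, Finset.mem_filter, Finset.mem_univ, true_and]
      refine ⟨?_, ?_, ?_⟩
      · rintro rfl
        rw [mul_self_eq_one_of_orderOf hy2, orderOf_one] at hs
        omega
      · rintro rfl
        rw [orderOf_one] at hs
        omega
      · refine hQ.mem_of_commute hyQ hy ?_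
        have h2 := conj_eq_inv_of_orderOf hs.1 hs.2
        rw [inv_eq_of_mul_eq_one_left (mul_self_eq_one_of_orderOf hy2),
          mul_inv_eq_iff_eq_mul] at h2
        exact h2
    have h2 := Finset.card_le_card h1
    have h3 : (Finset.univ.filter fun s : G => s ∈ Q).card = Nat.card Q := by
      rw [← Set.ncard_coe_finset, Finset.coe_filter_univ]
      rfl
    have h4 : (((Finset.univ.filter fun s : G => s ∈ Q).erase 1).erase y).card + 1 + 1 =
        Nat.card Q := by
      rw [Finset.card_erase_add_one, Finset.card_erase_add_one, h3]
      · simp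
      · simp [hyQ, hy]
    omega
  · intro hy2 s hs hsy
    obtain ⟨r, f, R, z, hR, hyR⟩ := hF.exists_mem hy
    have := Fact.mk hR.prime_p
    have hyr := hR.orderOf_eq_of_mem hyR hy
    rw [hyr] at hy2 ⊢
    have hinv := conj_eq_inv_of_orderOf hs hsy
    have hsN : s ∈ Subgroup.normalizer (R : Set G) := by
      refine hR.mem_normalizer y hyR hy s ?_
      rw [hinv]
      exact R.inv_mem hyR
    have h2 := Subgroup.orderOf_dvd_natCard _ hsN
    rw [hs, hR.card_normalizer] at h2
    have hf : f = 2 := by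
      rcases (Nat.Prime.dvd_mul Nat.prime_two).mp h2 with h3 | h3
      · obtain ⟨n, hn⟩ := IsPGroup.iff_card.mp hR.isSchmidt.isPGroup
        rw [hn] at h3
        exact (hy2 ((Nat.prime_dvd_prime_iff_eq Nat.prime_two hR.prime_p).mp
          (Nat.prime_two.dvd_of_dvd_pow h3)).symm).elim
      · exact ((Nat.prime_dvd_prime_iff_eq Nat.prime_two hR.prime_q).mp h3).symm
    subst hf
    refine ⟨⟨R, z, hR⟩, ?_⟩
    rw [← hR.card_eq_of_two, ← Set.ncard_coe_finset]
    refine Nat.card_le_card_of_injective (β := R) (fun t => ⟨s⁻¹ * t, ?_⟩) ?_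
    · have ht := (Finset.mem_filter.mp (Finset.mem_coe.mp t.2)).2
      refine hR.mem_of_commute hyR hy ?_
      have h3 := conj_eq_inv_of_orderOf ht.1 ht.2
      rw [← hinv] at h3
      calc s⁻¹ * t * y = s⁻¹ * (t * y * (t : G)⁻¹) * t := by group
        _ = y * (s⁻¹ * t) := by rw [h3]; group
    · intro t t' heq
      have h3 : s⁻¹ * (t : G) = s⁻¹ * t' := congrArg Subtype.val heq
      exact Subtype.ext (mul_left_cancel h3)

end InvolutionCount

section EvenOrderCount

variable {G : Type*} [Group G] [Finite G] {p q : ℕ} {P : Subgroup G} {x : G}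

theorem card_sq_eq_sum {G : Type*} [Group G] [Fintype G] [DecidableEq G] (I : Finset G)
    (hI : ∀ s ∈ I, s * s = 1) :
    I.card * I.card = ∑ y : G, (I.filter fun s => s * y ∈ I).card := by
  simp only [Finset.card_filter]
  rw [Finset.sum_comm, ← smul_eq_mul, ← Finset.sum_const]
  refine Finset.sum_congr rfl fun s hs => ?_
  rw [← Finset.card_filter]
  refine Finset.card_bij (fun t _ => s * t) ?_ ?_ ?_
  · intro t ht
    simp only [Finset.mem_filter, Finset.mem_univ, true_and]
    rwa [← mul_assoc, hI s hs, one_mul]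
  · intro a _ b _ hab
    exact mul_left_cancel hab
  · intro y hy
    simp only [Finset.mem_filter, Finset.mem_univ, true_and] at hy
    exact ⟨s * y, hy, by rw [← mul_assoc, hI s hs, one_mul]⟩

open Classical in
/-- The primes whose Sylow subgroups have a normalizer with complement of order two. -/
noncomputable def dihedralPrimes (G : Type*) [Group G] : Finset ℕ :=
  (Nat.card G).primeFactors.filter fun r =>
    ∃ (R : Subgroup G) (z : G), IsFrobeniusSylow r 2 R z

theorem mem_dihedralPrimes {r : ℕ} :
    r ∈ dihedralPrimes G ↔ ∃ (R : Subgroup G) (z : G), IsFrobeniusSylow r 2 R z := by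
  classical
  unfold dihedralPrimes
  rw [Finset.mem_filter, and_iff_right_iff_imp]
  rintro ⟨R, z, h⟩
  refine Nat.mem_primeFactors.mpr ⟨h.prime_p, ?_, Nat.card_pos.ne'⟩
  rw [← h.card_eq_of_two]
  exact Subgroup.card_subgroup_dvd_card R

theorem SylowFrobenius.card_involutions_le (hF : SylowFrobenius G)
    (h : IsFrobeniusSylow 2 q P x) {I : ℕ}
    (hI : Nat.card P * q * I = Nat.card G * (Nat.card P - 1)) :
    2 * (I * I) ≤ 2 * (I * (Nat.card P - 1)) +
      Nat.card G * ∑ r ∈ dihedralPrimes G, (r - 1) := by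
  classical
  have := Fintype.ofFinite G
  set J : Finset G := Finset.univ.filter fun y : G => orderOf y = 2 with hJ
  have hJI : J.card = I := by
    have h1 := h.mul_card_orderOf
    rw [← hI] at h1
    exact Nat.eq_of_mul_eq_mul_left (Nat.mul_pos Nat.card_pos h.prime_q.pos) h1
  have hv : 2 ≤ Nat.card P := h.prime_q.two_le.trans h.lt_card.le
  have hJm : ∀ s, s ∈ J ↔ orderOf s = 2 := fun s => by simp [hJ]
  have hbound : ∀ y : G, (J.filter fun s => s * y ∈ J).card ≤
      (if y = 1 then I else 0) + (if y ∈ J then Nat.card P - 2 else 0) +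
        (if orderOf y ∈ dihedralPrimes G then orderOf y else 0) := by
    intro y
    by_cases hy : y = 1
    · subst hy
      rw [if_pos rfl, add_assoc]
      refine le_trans ?_ (Nat.le_add_right _ _)
      rw [← hJI]
      exact Finset.card_filter_le _ _
    obtain ⟨h1, h2⟩ := hF.card_involution_pairs h hy
    have heq : (J.filter fun s => s * y ∈ J) =
        Finset.univ.filter fun s : G => orderOf s = 2 ∧ orderOf (s * y) = 2 := by
      ext s; simp [hJ]
    rw [heq, if_neg hy, zero_add]
    by_cases hy2 : orderOf y = 2
    · rw [if_pos ((hJm y).mpr hy2)]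
      have := h1 hy2
      omega
    · rcases Finset.eq_empty_or_nonempty
        (Finset.univ.filter fun s : G => orderOf s = 2 ∧ orderOf (s * y) = 2) with h3 | ⟨s, hs⟩
      · rw [h3, Finset.card_empty]
        exact Nat.zero_le _
      · simp only [Finset.mem_filter, Finset.mem_univ, true_and] at hs
        obtain ⟨h3, h4⟩ := h2 hy2 s hs.1 hs.2
        rw [if_pos (mem_dihedralPrimes.mpr h3)]
        exact h4.trans (Nat.le_add_left _ _)
  have hsum := card_sq_eq_sum J fun s hs => mul_self_eq_one_of_orderOf ((hJm s).mp hs)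
  have hle := hsum.le.trans (Finset.sum_le_sum fun y _ => hbound y)
  rw [Finset.sum_add_distrib, Finset.sum_add_distrib, Finset.sum_ite_eq' Finset.univ 1 fun _ => I,
    if_pos (Finset.mem_univ _), ← Finset.sum_filter, ← Finset.sum_filter, Finset.filter_univ_mem,
    Finset.sum_const, hJI, smul_eq_mul] at hle
  have hlast : 2 * ∑ y ∈ Finset.univ.filter (fun y : G => orderOf y ∈ dihedralPrimes G), orderOf y =
      Nat.card G * ∑ r ∈ dihedralPrimes G, (r - 1) := by
    rw [← Finset.sum_fiberwise_of_maps_to (g := fun y : G => orderOf y) (t := dihedralPrimes G)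
      (fun y hy => (Finset.mem_filter.mp hy).2), Finset.mul_sum, Finset.mul_sum]
    refine Finset.sum_congr rfl fun r hr => ?_
    obtain ⟨R, z, hR⟩ := mem_dihedralPrimes.mp hr
    have h1 := hR.mul_card_orderOf
    rw [hR.card_eq_of_two] at h1
    have h2 : (Finset.univ.filter (fun y : G => orderOf y ∈ dihedralPrimes G)).filter
        (fun y => orderOf y = r) = Finset.univ.filter fun y : G => orderOf y = r := by
      ext y
      simp only [Finset.mem_filter, Finset.mem_univ, true_and, and_iff_right_iff_imp]
      rintro rfl
      exact hr
    rw [h2, Finset.sum_congr rfl (g := fun _ => r) (fun y hy => (Finset.mem_filter.mp hy).2),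
      Finset.sum_const, smul_eq_mul, ← h1]
    ring
  have e : I * (Nat.card P - 1) = I + I * (Nat.card P - 2) := by
    obtain ⟨k, hk⟩ := Nat.exists_eq_add_of_le hv
    rw [hk]
    have : 2 + k - 1 = 1 + k := by omega
    rw [this, Nat.add_sub_cancel_left]
    ring
  rw [e]
  omega

theorem IsFrobeniusSylow.card_lt_card_sylow [IsSimpleGroup G] [Fact p.Prime]
    (h : IsFrobeniusSylow p q P x) (hP : P ≠ ⊤) :
    Nat.card P < Nat.card (Sylow p G) := by
  have hne : ∃ Q : Sylow p G, Q ≠ h.toSylow := by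
    by_contra h1
    push Not at h1
    have : Subsingleton (Sylow p G) := ⟨fun a b => (h1 a).trans (h1 b).symm⟩
    have h2 : P.Normal := Sylow.normal_of_subsingleton h.toSylow
    exact (IsSimpleGroup.eq_bot_or_eq_top_of_normal P h2).elim h.isSchmidt.ne_bot hP
  obtain ⟨Q, hQ⟩ := hne
  have h1 : Nat.card P ≤ Nat.card ({h.toSylow}ᶜ : Set (Sylow p G)) := by
    refine Nat.card_le_card_of_injective (fun u => ⟨(u : G) • Q, ?_⟩) ?_
    · intro h2
      refine hQ ?_
      have h3 : (u : G) • Q = h.toSylow := h2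
      have h4 : (u : G) • h.toSylow = h.toSylow :=
        Sylow.smul_eq_iff_mem_normalizer.mpr (Subgroup.le_normalizer u.2)
      exact smul_left_cancel (u : G) (h3.trans h4.symm)
    · intro u u' heq
      have h2 : (u : G) • Q = (u' : G) • Q := congrArg Subtype.val heq
      have h3 : ((u' : G)⁻¹ * u) • Q = Q := by rw [mul_smul, h2, inv_smul_smul]
      have h4 := Sylow.smul_eq_iff_mem_normalizer.mp h3
      have hw : (u' : G)⁻¹ * u ∈ P := P.mul_mem (P.inv_mem u'.2) u.2
      have h5 : (u' : G)⁻¹ * u ∈ (Q : Subgroup G) := by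
        have h6 := IsPGroup.inf_normalizer_sylow h.isSchmidt.isPGroup Q
        have h7 : (u' : G)⁻¹ * u ∈ P ⊓ Subgroup.normalizer (Q : Set G) := ⟨hw, h4⟩
        rw [h6] at h7
        exact h7.2
      by_contra hne
      have h8 : (u' : G)⁻¹ * u ≠ 1 := fun h9 => hne (Subtype.ext (inv_mul_eq_one.mp h9).symm)
      obtain ⟨g, hg⟩ := MulAction.exists_smul_eq G h.toSylow Q
      rw [← hg, Sylow.smul_def] at h5
      obtain ⟨a, ha, hga'⟩ := h5
      have hga : g * a * g⁻¹ = (u' : G)⁻¹ * u := hga'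
      have ha1 : a ≠ 1 := by
        intro h9
        exact h8 (by rw [← hga, h9, mul_one, mul_inv_cancel])
      have h9 := h.mem_normalizer a ha ha1 g (by rw [hga]; exact hw)
      exact hQ (hg.symm.trans (Sylow.smul_eq_iff_mem_normalizer.mpr h9))
  have h2 := Set.ncard_compl ({h.toSylow} : Set (Sylow p G))
  rw [Set.ncard_singleton] at h2
  change Nat.card P ≤ ({h.toSylow}ᶜ : Set (Sylow p G)).ncard at h1
  have : 0 < Nat.card (Sylow p G) := Nat.card_pos
  omega

theorem arith_even {v q n s : ℕ} (hq : 2 ≤ q) (hqv : q < v) (hv : 4 ≤ v) (hnv : v < n)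
    (hs : s ≤ n - 1 + (q - 1)) (h : 2 * ((n - 1) * (v - 1) ^ 2) ≤ v * q * s) :
    n = v + 1 ∧ q = v - 1 ∧ s = n - 1 + (q - 1) := by
  obtain ⟨a, rfl⟩ := Nat.exists_eq_add_of_lt hqv
  obtain ⟨b, rfl⟩ := Nat.exists_eq_add_of_lt hnv
  obtain ⟨q, rfl⟩ := Nat.exists_eq_add_of_le hq
  obtain ⟨d, hd⟩ := Nat.exists_eq_add_of_le hs
  have e1 : 2 + q + a + 1 + b + 1 - 1 = q + a + b + 3 := by omega
  have e2 : 2 + q + a + 1 - 1 = q + a + 2 := by omega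
  have e3 : 2 + q - 1 = q + 1 := by omega
  rw [e1, e3] at hd
  rw [e1, e2] at h
  have key : s + d = 2 * q + a + b + 4 := by omega
  have h2 : 2 * ((q + a + b + 3) * (q + a + 2) ^ 2) + (q + 2) * (q + a + 3) * d ≤
      (q + 2) * (q + a + 3) * (2 * q + a + b + 4) := by
    rw [← key]; nlinarith
  have hb : b = 0 := by
    nlinarith [Nat.zero_le (a*b), Nat.zero_le (q*a), Nat.zero_le (q*b), Nat.zero_le (q*q*b),
      Nat.zero_le (q*a*b), Nat.zero_le (q*q*a), Nat.zero_le (a*a*q), Nat.zero_le (a*a*b),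
      Nat.zero_le (a*a*a), Nat.zero_le ((q + 2) * (q + a + 3) * d)]
  subst hb
  have ha : a = 0 := by
    nlinarith [Nat.zero_le (q*a), Nat.zero_le (q*q*a), Nat.zero_le (a*a*q), Nat.zero_le (a*a*a),
      Nat.zero_le ((q + 2) * (q + a + 3) * d)]
  subst ha
  have hd0 : d = 0 := by nlinarith [Nat.zero_le (q*d), Nat.zero_le (q*q*d)]
  omega

end EvenOrderCount

section AlternatingFive

theorem nonempty_mulEquiv_alternatingGroup {G α : Type*} [Group G] [Finite G] [IsSimpleGroup G]
    [MulAction G α] (hG : Nat.card G = 60) (hα : Nat.card α = 5)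
    (hact : ∃ (g : G) (a : α), g • a ≠ a) : Nonempty (G ≃* alternatingGroup (Fin 5)) := by
  have hfin : Finite α := Nat.finite_of_card_ne_zero (by omega)
  let e : α ≃ Fin 5 := Finite.equivFinOfCardEq hα
  let f : G →* Equiv.Perm (Fin 5) := (e.permCongrHom.toMonoidHom).comp (MulAction.toPermHom G α)
  have hf : Function.Injective f := by
    rw [← MonoidHom.ker_eq_bot_iff]
    refine (IsSimpleGroup.eq_bot_or_eq_top_of_normal f.ker inferInstance).resolve_right ?_
    intro h
    obtain ⟨g, a, hga⟩ := hact
    have h1 : g ∈ f.ker := h ▸ Subgroup.mem_top g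
    have h2 : MulAction.toPermHom G α g = 1 := by
      have h3 : e.permCongrHom (MulAction.toPermHom G α g) = 1 := h1
      exact (MulEquiv.map_eq_one_iff _).mp h3
    exact hga (by simpa using congrArg (fun σ : Equiv.Perm α => σ a) h2)
  have hc : Nat.card f.range = 60 := by
    rw [← hG]
    exact Nat.card_congr (MonoidHom.ofInjective hf).toEquiv.symm
  have h5 : Nat.card (Equiv.Perm (Fin 5)) = 120 := by
    rw [Nat.card_eq_fintype_card, Fintype.card_perm]; rfl
  have hi : f.range.index = 2 := by
    have := f.range.card_mul_index
    rw [hc, h5] at this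
    omega
  have h6 := Equiv.Perm.eq_alternatingGroup_of_index_eq_two hi
  exact ⟨(MonoidHom.ofInjective hf).trans (MulEquiv.subgroupCongr h6)⟩

theorem SylowFrobenius.nonempty_mulEquiv_alternatingGroup {G : Type*} [Group G] [Finite G]
    [IsSimpleGroup G] (hF : SylowFrobenius G) (h2 : 2 ∣ Nat.card G) :
    Nonempty (G ≃* alternatingGroup (Fin 5)) := by
  have : Fact (Nat.Prime 2) := ⟨Nat.prime_two⟩
  obtain ⟨P⟩ : Nonempty (Sylow 2 G) := inferInstance
  have hPb : (P : Subgroup G) ≠ ⊥ := P.ne_bot_of_dvd_card h2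
  obtain ⟨q, x, h⟩ := hF 2 P hPb
  have hq2 : q ≠ 2 := fun h1 => h.isSchmidt.ne h1.symm
  have hq : q.Prime := h.prime_q
  have hqv := h.lt_card
  have hv := h.card_normalizer
  have hPt : (P : Subgroup G) ≠ ⊤ := by
    intro h1
    have h3 := Subgroup.card_le_card_group (Subgroup.normalizer ((P : Subgroup G) : Set G))
    rw [hv, h1, Subgroup.card_top] at h3
    have : 0 < Nat.card G := Nat.card_pos
    nlinarith [hq.two_le]
  have hnv := h.card_lt_card_sylow hPt
  have hg : Nat.card (Sylow 2 G) * (Nat.card P * q) = Nat.card G := by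
    rw [P.card_eq_index_normalizer, ← h.card_normalizer, mul_comm]
    exact Subgroup.card_mul_index _
  obtain ⟨a, ha⟩ := IsPGroup.iff_card.mp P.2
  have hn : Nat.card (Sylow 2 G) ≠ 0 := Nat.card_pos.ne'
  have hle := hF.card_involutions_le h (I := Nat.card (Sylow 2 G) * (Nat.card P - 1)) (by
    rw [← hg]; ring)
  obtain ⟨hsn, hsn'⟩ := sum_primeFactors_sub_one_le hn
  have hsub : dihedralPrimes G ⊆ (Nat.card (Sylow 2 G)).primeFactors ∪ {q} := by
    intro r hr
    obtain ⟨R, z, hR⟩ := mem_dihedralPrimes.mp hr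
    have hr2 : r ≠ 2 := hR.isSchmidt.ne
    have hrp := hR.prime_p
    have h1 : r ∣ Nat.card G := by
      rw [← hR.card_eq_of_two]
      exact Subgroup.card_subgroup_dvd_card R
    rw [← hg, hrp.dvd_mul, hrp.dvd_mul] at h1
    rw [Finset.mem_union, Finset.mem_singleton]
    rcases h1 with h1 | h1 | h1
    · exact Or.inl (Nat.mem_primeFactors.mpr ⟨hrp, h1, hn⟩)
    · rw [ha] at h1
      exact (hr2 ((Nat.prime_dvd_prime_iff_eq hrp Nat.prime_two).mp (hrp.dvd_of_dvd_pow h1))).elim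
    · exact Or.inr ((Nat.prime_dvd_prime_iff_eq hrp hq).mp h1)
  have hs : ∑ r ∈ dihedralPrimes G, (r - 1) ≤
      ∑ r ∈ (Nat.card (Sylow 2 G)).primeFactors, (r - 1) + (q - 1) := by
    refine (Finset.sum_le_sum_of_subset hsub).trans ?_
    refine (Nat.le_add_right _ _).trans (Finset.sum_union_inter (f := fun r => r - 1)).le |>.trans
      ?_
    rw [Finset.sum_singleton]
  have key : 2 * ((Nat.card (Sylow 2 G) - 1) * (Nat.card P - 1) ^ 2) ≤
      Nat.card P * q * ∑ r ∈ dihedralPrimes G, (r - 1) := by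
    rw [← hg] at hle
    refine Nat.le_of_mul_le_mul_left ?_ (Nat.pos_of_ne_zero hn)
    obtain ⟨m, hm⟩ := Nat.exists_eq_add_one_of_ne_zero hn
    rw [hm] at hle ⊢
    rw [Nat.add_sub_cancel]
    nlinarith
  have hv4 : 4 ≤ Nat.card P := by
    have := hq.two_le
    omega
  obtain ⟨h3, h4, h5⟩ := arith_even hq.two_le hqv hv4 hnv (hs.trans (by omega)) key
  have hnp : (Nat.card (Sylow 2 G)).Prime := (hsn' (by omega)).resolve_left (by omega)
  have hP4 : Nat.card P = 4 := by
    have h7 : ¬ 3 ∣ Nat.card P := by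
      rw [ha]
      intro h8
      have := (Nat.prime_dvd_prime_iff_eq Nat.prime_three Nat.prime_two).mp
        (Nat.prime_three.dvd_of_dvd_pow h8)
      omega
    rcases (by omega : 3 ∣ q ∨ 3 ∣ Nat.card (Sylow 2 G)) with h8 | h8
    · have := (Nat.prime_dvd_prime_iff_eq Nat.prime_three hq).mp h8
      omega
    · have := (Nat.prime_dvd_prime_iff_eq Nat.prime_three hnp).mp h8
      omega
  refine _root_.nonempty_mulEquiv_alternatingGroup (α := Sylow 2 G) ?_ (by omega) ?_
  · rw [← hg, h3, h4, hP4]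
  · by_contra hcon
    push Not at hcon
    have : Subsingleton (Sylow 2 G) := ⟨fun A B => by
      obtain ⟨g, hgA⟩ := MulAction.exists_smul_eq G A B
      rw [← hgA, hcon]⟩
    have := Finite.card_le_one_iff_subsingleton.mpr this
    omega

end AlternatingFive

section MatrixCharacters

theorem Matrix.trace_mulLeftRight_pi {n : ℕ} {d : Fin n → ℕ}
    (X Y : ∀ i, Matrix (Fin (d i)) (Fin (d i)) ℂ) :
    LinearMap.trace ℂ _ (LinearMap.mulLeftRight ℂ (X, Y)) =
      ∑ i, (X i).trace * (Y i).trace := by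
  rw [LinearMap.trace_eq_matrix_trace ℂ
    (Pi.basis fun i => Matrix.stdBasis ℂ (Fin (d i)) (Fin (d i)))]
  simp only [Matrix.trace, Matrix.diag_apply, LinearMap.toMatrix_apply, Pi.basis_apply,
    Pi.basis_repr, LinearMap.mulLeftRight_apply]
  rw [Fintype.sum_sigma]
  refine Finset.sum_congr rfl fun i _ => ?_
  rw [Fintype.sum_prod_type, Finset.sum_mul_sum]
  refine Finset.sum_congr rfl fun a _ => Finset.sum_congr rfl fun b _ => ?_
  rw [Matrix.stdBasis_eq_single]
  simp [Pi.mul_apply, Matrix.stdBasis, Matrix.mul_apply, Matrix.single_apply, ite_and]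

theorem MonoidAlgebra.trace_mulLeftRight_single {G : Type*} [Group G] [Fintype G] [DecidableEq G]
    (x y : G) :
    LinearMap.trace ℂ (MonoidAlgebra ℂ G)
        (LinearMap.mulLeftRight ℂ (MonoidAlgebra.single x 1, MonoidAlgebra.single y 1)) =
      ((Finset.univ.filter fun g : G => x * g * y = g).card : ℂ) := by
  rw [LinearMap.trace_eq_matrix_trace ℂ (MonoidAlgebra.basis G ℂ)]
  simp only [Matrix.trace, Matrix.diag_apply, LinearMap.toMatrix_apply,
    LinearMap.mulLeftRight_apply]
  simp [MonoidAlgebra.basis, MonoidAlgebra.single_mul_single, Finsupp.single_apply]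

theorem Matrix.exists_natCast_eq_trace_of_isIdempotentElem {n : ℕ} {X : Matrix (Fin n) (Fin n) ℂ}
    (hX : IsIdempotentElem X) : ∃ m : ℕ, X.trace = m := by
  have h1 : IsIdempotentElem (Matrix.toLin' X) := by
    rw [IsIdempotentElem, Module.End.mul_eq_comp, ← Matrix.toLin'_mul, hX.eq]
  exact ⟨_, by rw [← Matrix.trace_toLin'_eq, (LinearMap.IsIdempotentElem.isProj_range _ h1).trace]⟩

/-- The traces of the components of the group algebra in a decomposition as a product of matrix
algebras: the irreducible complex characters of `G`. -/
structure IsCharacterTable (G : Type*) [Group G] [Fintype G] [DecidableEq G] {n : ℕ}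
    (χ : Fin n → G → ℂ) : Prop where
  conj : ∀ i x g, χ i (g * x * g⁻¹) = χ i x
  sum_mul : ∀ x y, ∑ i, χ i x * χ i y = ((Finset.univ.filter fun g : G => x * g * y = g).card : ℂ)
  sum_mul_inv : ∀ i, ∑ x, χ i x * χ i x⁻¹ = (Fintype.card G : ℂ)
  exists_degree : ∀ i, ∃ d : ℕ, 0 < d ∧ χ i 1 = d
  exists_mul_sum : ∀ i (A : Subgroup G) (l : A →* ℂˣ), ∃ m : ℕ,
    ∑ᶠ a : A, ((l a)⁻¹ : ℂˣ) * χ i a = (Nat.card A : ℂ) * m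

theorem exists_isCharacterTable (G : Type*) [Group G] [Fintype G] [DecidableEq G] :
    ∃ (n : ℕ) (χ : Fin n → G → ℂ), IsCharacterTable G χ := by
  classical
  obtain ⟨n, d, hd, ⟨φ⟩⟩ :=
    IsSemisimpleRing.exists_algEquiv_pi_matrix_of_isAlgClosed ℂ (MonoidAlgebra ℂ G)
  let E : G → MonoidAlgebra ℂ G := fun x => MonoidAlgebra.single x 1
  have hE : ∀ x y, E (x * y) = E x * E y := fun x y => by
    simp [E, MonoidAlgebra.single_mul_single]
  have hE1 : E 1 = 1 := rfl
  have hcard : (Fintype.card G : ℂ) ≠ 0 := Nat.cast_ne_zero.mpr Fintype.card_ne_zero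
  have hsum : ∀ x y, ∑ i, (φ (E x) i).trace * (φ (E y) i).trace =
      ((Finset.univ.filter fun g : G => x * g * y = g).card : ℂ) := by
    intro x y
    rw [← MonoidAlgebra.trace_mulLeftRight_single, ← Matrix.trace_mulLeftRight_pi,
      ← LinearMap.trace_conj' _ φ.toLinearEquiv]
    congr 1
    refine LinearMap.ext fun z => ?_
    simp [LinearEquiv.conj_apply, E]
  have hd1 : ∀ i, (φ (E 1) i).trace = d i := fun i => by
    rw [hE1, map_one, Pi.one_apply, Matrix.trace_one, Fintype.card_fin]
  refine ⟨n, fun i x => (φ (E x) i).trace, ?_, hsum, ?_, ?_, ?_⟩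
  · intro i x g
    simp only [hE, map_mul, Pi.mul_apply]
    rw [Matrix.trace_mul_comm, ← mul_assoc, ← Pi.mul_apply, ← map_mul, ← hE, inv_mul_cancel, hE1,
      map_one, Pi.one_apply, one_mul]
  · intro i
    let p : MonoidAlgebra ℂ G := φ.symm (Pi.single i 1)
    have hexp : ∀ a : MonoidAlgebra ℂ G, a = ∑ x, a.coeff x • E x := by
      intro a
      have h1 := (MonoidAlgebra.basis G ℂ).sum_repr a
      simpa [MonoidAlgebra.basis, E] using h1.symm
    have hlin : ∀ (a : MonoidAlgebra ℂ G) j,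
        (φ a j).trace = ∑ x, a.coeff x * (φ (E x) j).trace := by
      intro a j
      conv_lhs => rw [hexp a]
      simp [Finset.sum_apply, Matrix.trace_sum]
    have hcol : ∀ a : MonoidAlgebra ℂ G,
        ∑ j, (φ a j).trace * d j = Fintype.card G * a.coeff 1 := by
      intro a
      simp_rw [hlin a, Finset.sum_mul]
      rw [Finset.sum_comm]
      simp_rw [mul_assoc, ← Finset.mul_sum, ← hd1, hsum, mul_one]
      rw [Finset.sum_eq_single 1]
      · simp [mul_comm]
      · intro b _ hb
        simp [hb]
      · simp
    have hpc : ∀ x, Fintype.card G * p.coeff x = d i * (φ (E x⁻¹) i).trace := by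
      intro x
      have h1 := hcol (p * E x⁻¹)
      have h2 : (p * E x⁻¹).coeff 1 = p.coeff x := by
        simp [E]
      have h3 : ∀ j, j ≠ i → (φ (p * E x⁻¹) j).trace = 0 := by
        intro j hj
        rw [map_mul, AlgEquiv.apply_symm_apply, Pi.mul_apply, Pi.single_eq_of_ne hj, zero_mul,
          Matrix.trace_zero]
      rw [h2, Finset.sum_eq_single i (fun j _ hj => by rw [h3 j hj, zero_mul]) (by simp), map_mul,
        AlgEquiv.apply_symm_apply, Pi.mul_apply, Pi.single_eq_same, one_mul] at h1
      rw [← h1, mul_comm]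
    have h2 : ∑ x, p.coeff x * (φ (E x) i).trace = d i := by
      rw [← hlin, AlgEquiv.apply_symm_apply, Pi.single_eq_same, Matrix.trace_one, Fintype.card_fin]
    have h3 : (d i : ℂ) * ∑ x, (φ (E x) i).trace * (φ (E x⁻¹) i).trace =
        d i * Fintype.card G := by
      conv_rhs => rw [← h2]
      rw [Finset.mul_sum, Finset.sum_mul]
      refine Finset.sum_congr rfl fun x _ => ?_
      linear_combination (-(φ (E x) i).trace) * hpc x
    exact mul_left_cancel₀ (Nat.cast_ne_zero.mpr (hd i).out) h3
  · intro i
    exact ⟨d i, Nat.pos_of_ne_zero (hd i).out, hd1 i⟩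
  · intro i A l
    have : Fintype A := Fintype.ofFinite A
    have hA : (Nat.card A : ℂ) ≠ 0 := Nat.cast_ne_zero.mpr Nat.card_pos.ne'
    let s : MonoidAlgebra ℂ G := ∑ a : A, (((l a)⁻¹ : ℂˣ) : ℂ) • E a
    have hs : s * s = (Nat.card A : ℂ) • s := by
      have h1 : ∀ a : A, ((((l a)⁻¹ : ℂˣ) : ℂ) • E a) * s = s := by
        intro a
        simp only [s, Finset.mul_sum]
        refine Fintype.sum_equiv (Equiv.mulLeft a) _ _ fun b => ?_
        rw [Equiv.coe_mulLeft, map_mul, mul_inv, Subgroup.coe_mul, hE, smul_mul_smul_comm,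
          Units.val_mul]
      conv_lhs => rw [show s * s = ∑ a : A, ((((l a)⁻¹ : ℂˣ) : ℂ) • E a) * s from
        Finset.sum_mul _ _ _]
      rw [Finset.sum_congr rfl fun a _ => h1 a, Finset.sum_const, Finset.card_univ,
        Nat.card_eq_fintype_card, Nat.cast_smul_eq_nsmul]
    have hp : IsIdempotentElem (φ ((Nat.card A : ℂ)⁻¹ • s) i) := by
      rw [IsIdempotentElem, ← Pi.mul_apply, ← map_mul, smul_mul_smul_comm, hs, smul_smul, mul_assoc,
        inv_mul_cancel₀ hA, mul_one]
    obtain ⟨m, hm⟩ := Matrix.exists_natCast_eq_trace_of_isIdempotentElem hp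
    refine ⟨m, ?_⟩
    rw [finsum_eq_sum_of_fintype, ← hm]
    simp only [s, map_smul, map_sum, Pi.smul_apply, Finset.sum_apply, Matrix.trace_smul,
      Matrix.trace_sum, smul_eq_mul]
    rw [mul_inv_cancel_left₀ hA]

end MatrixCharacters

section CharacterSums

/-- The inner product of the restriction of `χ i` with a linear character of a subgroup, multiplied
by the order of the subgroup. -/
noncomputable def charSum {G : Type*} [Group G] {n : ℕ} (χ : Fin n → G → ℂ) (A : Subgroup G)
    (l : A →* ℂˣ) (i : Fin n) : ℂ :=
  ∑ᶠ a : A, ((l a)⁻¹ : ℂˣ) * χ i a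

variable {G : Type*} [Group G] [Fintype G] [DecidableEq G] {n : ℕ} {χ : Fin n → G → ℂ}

open Classical in
theorem IsCharacterTable.sum_charSum_mul (hχ : IsCharacterTable G χ) (A B : Subgroup G)
    (l : A →* ℂˣ) (m : B →* ℂˣ) :
    ∑ i, charSum χ A l i * charSum χ B m i =
      ∑ g : G, ∑ b : B, ∑ a : A, if (a : G) = g * b * g⁻¹ then
        (((l a)⁻¹ * m b : ℂˣ) : ℂ) else 0 := by
  have hB : ∀ i, charSum χ B m i = ∑ b : B, (m b : ℂ) * χ i (b : G)⁻¹ := by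
    intro i
    rw [charSum, finsum_eq_sum_of_fintype]
    refine Fintype.sum_equiv (Equiv.inv B) _ _ fun b => ?_
    simp
  have hA : ∀ i, charSum χ A l i = ∑ a : A, ((l a)⁻¹ : ℂˣ) * χ i a := fun i =>
    finsum_eq_sum_of_fintype _
  simp only [hA, hB, Finset.sum_mul_sum]
  rw [Finset.sum_comm]
  have h1 : ∀ a : A, ∑ i, ∑ b : B, (((l a)⁻¹ : ℂˣ) : ℂ) * χ i a * (m b * χ i (b : G)⁻¹) =
      ∑ g : G, ∑ b : B, if (a : G) = g * b * g⁻¹ then (((l a)⁻¹ * m b : ℂˣ) : ℂ) else 0 := by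
    intro a
    rw [Finset.sum_comm, Finset.sum_comm (γ := G)]
    refine Finset.sum_congr rfl fun b _ => ?_
    have h2 : ∀ i, (((l a)⁻¹ : ℂˣ) : ℂ) * χ i a * (m b * χ i (b : G)⁻¹) =
        (((l a)⁻¹ * m b : ℂˣ) : ℂ) * (χ i a * χ i (b : G)⁻¹) := by
      intro i
      push_cast
      ring
    simp_rw [h2]
    rw [← Finset.mul_sum, hχ.sum_mul, ← Finset.sum_filter, Finset.sum_const, nsmul_eq_mul,
      mul_comm]
    congr 3
    ext g
    simp only [Finset.mem_filter, Finset.mem_univ, true_and]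
    rw [eq_mul_inv_iff_mul_eq, mul_inv_eq_iff_eq_mul]
  rw [Finset.sum_congr rfl fun a _ => h1 a, Finset.sum_comm]
  refine Finset.sum_congr rfl fun g _ => ?_
  rw [Finset.sum_comm]

theorem IsCharacterTable.sum_charSum_mul_of_disjoint (hχ : IsCharacterTable G χ) (A B : Subgroup G)
    (hAB : ∀ g, ∀ b ∈ B, g * b * g⁻¹ ∈ A → b = 1) (l : A →* ℂˣ) (m : B →* ℂˣ) :
    ∑ i, charSum χ A l i * charSum χ B m i = Fintype.card G := by
  classical
  rw [hχ.sum_charSum_mul, ← Finset.card_univ, Finset.cast_card]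
  refine Finset.sum_congr rfl fun g _ => ?_
  rw [Finset.sum_eq_single 1, Finset.sum_eq_single 1]
  · simp
  · intro a _ ha
    simp [ha]
  · simp
  · intro b _ hb
    refine Finset.sum_eq_zero fun a _ => if_neg fun h => hb ?_
    exact Subtype.ext (hAB g b b.2 (h ▸ a.2))
  · simp

/-- The elements of the normalizer of `P` conjugating the linear character `m` to `l`. -/
def charTransporter (P : Subgroup G) (l m : P →* ℂˣ) : Set G :=
  {g | g ∈ Subgroup.normalizer (P : Set G) ∧ ∀ b c : P, (c : G) = g * b * g⁻¹ → l c = m b}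

theorem IsCharacterTable.sum_charSum_mul_self (hχ : IsCharacterTable G χ) (P : Subgroup G)
    (hP : ∀ a ∈ P, a ≠ 1 → ∀ g, g * a * g⁻¹ ∈ P → g ∈ Subgroup.normalizer (P : Set G))
    (l m : P →* ℂˣ) :
    ∑ i, charSum χ P l i * charSum χ P m i =
      Nat.card P * (charTransporter P l m).ncard +
        ((Fintype.card G : ℂ) - Nat.card (Subgroup.normalizer (P : Set G))) := by
  classical
  rw [hχ.sum_charSum_mul]
  have key : ∀ g : G, (∑ b : P, ∑ a : P,
      if (a : G) = g * b * g⁻¹ then (((l a)⁻¹ * m b : ℂˣ) : ℂ) else 0) =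
      (if g ∈ charTransporter P l m then (Nat.card P : ℂ) else 0) +
        (1 - if g ∈ Subgroup.normalizer (P : Set G) then 1 else 0) := by
    intro g
    by_cases hg : g ∈ Subgroup.normalizer (P : Set G)
    · rw [if_pos hg, sub_self, add_zero]
      have hmem : ∀ b : P, g * b * g⁻¹ ∈ P := fun b =>
        (Subgroup.mem_normalizer_iff.mp hg b).mp b.2
      let f : P →* ℂˣ :=
        { toFun := fun b => (l ⟨g * b * g⁻¹, hmem b⟩)⁻¹ * m b
          map_one' := by
            have : (⟨g * (1 : P) * g⁻¹, hmem 1⟩ : P) = 1 := Subtype.ext (by simp)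
            rw [this, map_one, map_one, inv_one, one_mul]
          map_mul' := fun a b => by
            have : (⟨g * (a * b : P) * g⁻¹, hmem (a * b)⟩ : P) =
                ⟨g * a * g⁻¹, hmem a⟩ * ⟨g * b * g⁻¹, hmem b⟩ :=
              Subtype.ext (by simp [mul_assoc])
            rw [this, map_mul, map_mul, mul_inv]
            exact mul_mul_mul_comm _ _ _ _ }
      have h1 : ∀ b : P, (∑ a : P,
          if (a : G) = g * b * g⁻¹ then (((l a)⁻¹ * m b : ℂˣ) : ℂ) else 0) =
          ((Units.coeHom ℂ).comp f) b := by
        intro b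
        rw [Finset.sum_eq_single ⟨g * b * g⁻¹, hmem b⟩]
        · rw [if_pos rfl]
          rfl
        · intro a _ ha
          exact if_neg fun h => ha (Subtype.ext h)
        · simp
      rw [Finset.sum_congr rfl fun b _ => h1 b, sum_hom_units, Nat.card_eq_fintype_card,
        Nat.cast_ite, Nat.cast_zero]
      refine if_congr ?_ rfl rfl
      constructor
      · intro h
        refine ⟨hg, fun b c hc => ?_⟩
        have h2 : (f b : ℂ) = 1 := DFunLike.congr_fun h b
        have h3 : f b = 1 := Units.ext h2
        have h4 : (l ⟨g * b * g⁻¹, hmem b⟩)⁻¹ * m b = 1 := h3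
        have h5 : c = ⟨g * b * g⁻¹, hmem b⟩ := Subtype.ext hc
        rw [h5]
        exact inv_mul_eq_one.mp h4
      · rintro ⟨-, h⟩
        ext b
        have h4 : (l ⟨g * b * g⁻¹, hmem b⟩)⁻¹ * m b = 1 := inv_mul_eq_one.mpr (h b _ rfl)
        have h5 : f b = 1 := h4
        simp [h5]
    · have h0 : g ∉ charTransporter P l m := fun h => hg h.1
      rw [if_neg hg, if_neg h0, Finset.sum_eq_single 1, Finset.sum_eq_single 1]
      · simp
      · intro a _ ha
        simp [ha]
      · simp
      · intro b _ hb
        refine Finset.sum_eq_zero fun a _ => if_neg fun h => hg ?_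
        exact hP b b.2 (fun h1 => hb (Subtype.ext h1)) g (h ▸ a.2)
      · simp
  rw [Finset.sum_congr rfl fun g _ => key g, Finset.sum_add_distrib, Finset.sum_sub_distrib,
    ← Finset.sum_filter, ← Finset.sum_filter, Finset.sum_const, Finset.sum_const, Finset.sum_const,
    Finset.card_univ]
  have h1 : (Finset.univ.filter fun g => g ∈ charTransporter P l m).card =
      (charTransporter P l m).ncard := by
    rw [← Set.ncard_coe_finset]
    congr 1
    ext g
    simp
  have h2 : (Finset.univ.filter fun g => g ∈ Subgroup.normalizer (P : Set G)).card =
      Nat.card (Subgroup.normalizer (P : Set G)) := by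
    rw [Nat.card_eq_fintype_card, Fintype.card_subtype]
  rw [h1, h2]
  simp [mul_comm]

end CharacterSums

section DualGroup

variable {G : Type*} [Group G] [Finite G]

theorem card_monoidHom_units (A : Subgroup G) (hA : ∀ a ∈ A, ∀ b ∈ A, Commute a b) :
    Nat.card (A →* ℂˣ) = Nat.card A := by
  let _ : CommGroup A := { (inferInstance : Group A) with
    mul_comm := fun a b => Subtype.ext (hA a a.2 b b.2) }
  exact CommGroup.card_monoidHom_of_hasEnoughRootsOfUnity A ℂ

theorem finite_monoidHom_units (A : Subgroup G) (hA : ∀ a ∈ A, ∀ b ∈ A, Commute a b) :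
    Finite (A →* ℂˣ) :=
  Nat.finite_of_card_ne_zero (by rw [card_monoidHom_units A hA]; exact Nat.card_pos.ne')

theorem sum_monoidHom_units_apply (A : Subgroup G) (hA : ∀ a ∈ A, ∀ b ∈ A, Commute a b)
    [Fintype (A →* ℂˣ)] {a : A} (ha : a ≠ 1) : ∑ l : A →* ℂˣ, (l a : ℂ) = 0 := by
  let _ : CommGroup A := { (inferInstance : Group A) with
    mul_comm := fun a b => Subtype.ext (hA a a.2 b b.2) }
  obtain ⟨m, hm⟩ := CommGroup.exists_apply_ne_one_of_hasEnoughRootsOfUnity A ℂ ha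
  have h1 : (m a : ℂ) * ∑ l : A →* ℂˣ, (l a : ℂ) = ∑ l : A →* ℂˣ, (l a : ℂ) := by
    rw [Finset.mul_sum]
    exact Fintype.sum_equiv (Equiv.mulLeft m) _ _ fun l => by simp
  have h2 : ((m a : ℂ) - 1) * ∑ l : A →* ℂˣ, (l a : ℂ) = 0 := by
    rw [sub_mul, h1, one_mul, sub_self]
  refine (mul_eq_zero.mp h2).resolve_left fun h3 => hm (Units.ext ?_)
  rw [sub_eq_zero.mp h3, Units.val_one]

theorem charTransporter_eq_image {G : Type*} [Group G] {P : Subgroup G} {l m : P →* ℂˣ} {g : G}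
    (hg : g ∈ charTransporter P l m) :
    charTransporter P l m = (fun k => g * k) '' charTransporter P m m := by
  have hgm : ∀ b : P, g * b * g⁻¹ ∈ P := fun b =>
    (Subgroup.mem_normalizer_iff.mp hg.1 b).mp b.2
  ext k
  constructor
  · rintro ⟨hk, hkl⟩
    refine ⟨g⁻¹ * k, ⟨Subgroup.mul_mem _ (Subgroup.inv_mem _ hg.1) hk, fun b c hc => ?_⟩,
      by simp⟩
    rw [← hg.2 c ⟨g * c * g⁻¹, hgm c⟩ rfl]
    exact hkl b ⟨g * c * g⁻¹, hgm c⟩ (by simp only [hc]; group)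
  · rintro ⟨k, ⟨hk, hkm⟩, rfl⟩
    refine ⟨Subgroup.mul_mem _ hg.1 hk, fun b c hc => ?_⟩
    have hkb : k * b * k⁻¹ ∈ P := (Subgroup.mem_normalizer_iff.mp hk b).mp b.2
    rw [← hkm b ⟨k * b * k⁻¹, hkb⟩ rfl]
    exact hg.2 _ c (by simp only [hc]; group)

theorem ncard_charTransporter_of_mem {G : Type*} [Group G] {P : Subgroup G} {l m : P →* ℂˣ} {g : G}
    (hg : g ∈ charTransporter P l m) :
    (charTransporter P l m).ncard = (charTransporter P m m).ncard := by
  rw [charTransporter_eq_image hg]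
  exact Set.ncard_image_of_injective _ (mul_right_injective g)

theorem charTransporter_one_one {G : Type*} [Group G] (P : Subgroup G) :
    charTransporter P 1 1 = (Subgroup.normalizer (P : Set G) : Set G) := by
  ext g
  exact ⟨fun h => h.1, fun h => ⟨h, fun _ _ _ => rfl⟩⟩

theorem eq_one_of_mem_charTransporter_one {G : Type*}
    [Group G] {P : Subgroup G} {m : P →* ℂˣ} {g : G}
    (hg : g ∈ charTransporter P 1 m) : m = 1 := by
  ext b
  have h1 := hg.2 b ⟨g * b * g⁻¹, (Subgroup.mem_normalizer_iff.mp hg.1 b).mp b.2⟩ rfl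
  rw [← h1]
  rfl

theorem eq_of_mem_charTransporter {G : Type*} [Group G] {P : Subgroup G} {l m m' : P →* ℂˣ} {g : G}
    (hg : g ∈ charTransporter P l m) (hg' : g ∈ charTransporter P l m') : m = m' := by
  ext b
  have h0 := (Subgroup.mem_normalizer_iff.mp hg.1 b).mp b.2
  rw [← hg.2 b ⟨g * b * g⁻¹, h0⟩ rfl, ← hg'.2 b ⟨g * b * g⁻¹, h0⟩ rfl]

theorem exists_mem_charTransporter {G : Type*} [Group G] {P : Subgroup G} (l : P →* ℂˣ) {g : G}
    (hg : g ∈ Subgroup.normalizer (P : Set G)) : ∃ m, g ∈ charTransporter P l m := by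
  have hmem : ∀ b : P, g * b * g⁻¹ ∈ P := fun b =>
    (Subgroup.mem_normalizer_iff.mp hg b).mp b.2
  refine ⟨
    { toFun := fun b => l ⟨g * b * g⁻¹, hmem b⟩
      map_one' := by
        have : (⟨g * (1 : P) * g⁻¹, hmem 1⟩ : P) = 1 := Subtype.ext (by simp)
        rw [this, map_one]
      map_mul' := fun a b => by
        have : (⟨g * (a * b : P) * g⁻¹, hmem (a * b)⟩ : P) =
            ⟨g * a * g⁻¹, hmem a⟩ * ⟨g * b * g⁻¹, hmem b⟩ :=
          Subtype.ext (by simp [mul_assoc])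
        rw [this, map_mul] }, hg, fun b c hc => ?_⟩
  have : c = ⟨g * b * g⁻¹, hmem b⟩ := Subtype.ext hc
  rw [this]
  rfl

theorem sum_ncard_charTransporter (P : Subgroup G) [Fintype (P →* ℂˣ)] (l : P →* ℂˣ) :
    ∑ m : P →* ℂˣ, (charTransporter P l m).ncard =
      Nat.card (Subgroup.normalizer (P : Set G)) := by
  classical
  have := Fintype.ofFinite G
  have h1 : ∀ m, (charTransporter P l m).ncard =
      (Finset.univ.filter fun g => g ∈ charTransporter P l m).card := by
    intro m
    rw [← Set.ncard_coe_finset]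
    congr 1
    ext g
    simp
  simp_rw [h1]
  rw [← Finset.card_biUnion]
  · have h2 : Nat.card (Subgroup.normalizer (P : Set G)) =
        ((Subgroup.normalizer (P : Set G) : Subgroup G) : Set G).ncard :=
      Nat.card_coe_set_eq _
    rw [h2, ← Set.ncard_coe_finset]
    congr 1
    ext g
    simp only [Finset.coe_biUnion, Set.mem_iUnion, Finset.mem_filter,
      Finset.mem_univ, true_and, SetLike.mem_coe]
    exact ⟨fun ⟨m, _, hm⟩ => hm.1, fun hg => (exists_mem_charTransporter l hg).imp fun m hm =>
      ⟨trivial, hm⟩⟩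
  · intro m _ m' _ hne
    rw [Function.onFun, Finset.disjoint_left]
    intro g hg hg'
    simp only [Finset.mem_filter, Finset.mem_univ, true_and] at hg hg'
    exact hne (eq_of_mem_charTransporter hg hg')

variable {p q : ℕ} {P : Subgroup G} {x : G}

theorem IsFrobeniusSylow.charTransporter_self (h : IsFrobeniusSylow p q P x) {l : P →* ℂˣ}
    (hl : l ≠ 1) : charTransporter P l l = P := by
  ext g
  constructor
  · rintro ⟨hg, hgl⟩
    obtain ⟨y, hy, z, hz, rfl⟩ := h.isSchmidt.exists_mul hg
    have hzN : z ∈ Subgroup.normalizer (P : Set G) :=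
      Subgroup.zpowers_le.mpr h.isSchmidt.mem hz
    have hzP : ∀ b : P, z * b * z⁻¹ ∈ P := fun b =>
      (Subgroup.mem_normalizer_iff.mp hzN b).mp b.2
    suffices hz1 : z = 1 by
      rw [hz1, mul_one]
      exact hy
    by_contra hz1
    refine hl ?_
    let f : P → P := fun b => ⟨z * b * z⁻¹, hzP b⟩ * b⁻¹
    have hf : Function.Injective f := by
      intro a b hab
      have h1 : z * a * z⁻¹ * (a : G)⁻¹ = z * b * z⁻¹ * (b : G)⁻¹ := congrArg Subtype.val hab
      have h2 : Commute z ((b : G)⁻¹ * a) := by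
        have h3 : z * ((b : G)⁻¹ * a) * z⁻¹ = (b : G)⁻¹ * a := by
          have hc : Commute (z * (a : G) * z⁻¹) (a : G)⁻¹ := (h.commute (hzP a) a.2).inv_right
          calc z * ((b : G)⁻¹ * a) * z⁻¹ = (z * b * z⁻¹)⁻¹ * (z * a * z⁻¹ * (a : G)⁻¹) * a := by
                group
            _ = (b : G)⁻¹ * a := by rw [h1]; group
        exact mul_inv_eq_iff_eq_mul.mp h3
      by_contra hne
      have h4 : (b : G)⁻¹ * a ≠ 1 := fun h5 => hne (Subtype.ext (inv_mul_eq_one.mp h5).symm)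
      exact hz1 (h.eq_one_of_mem_zpowers_of_commute
        (P.mul_mem (P.inv_mem b.2) a.2) h4 hz h2)
    ext b
    obtain ⟨a, rfl⟩ := (Finite.injective_iff_surjective.mp hf) b
    have h5 : l ⟨z * a * z⁻¹, hzP a⟩ = l a := by
      refine hgl a _ ?_
      have hc := h.commute hy (hzP a)
      calc z * (a : G) * z⁻¹ = (z * a * z⁻¹) * y * y⁻¹ := by group
        _ = y * z * a * (y * z)⁻¹ := by rw [← hc.eq]; group
    simp [f, h5]
  · intro hg
    refine ⟨Subgroup.le_normalizer hg, fun b c hc => ?_⟩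
    have hc2 : c = b := Subtype.ext (by rw [hc, (h.commute hg b.2).eq, mul_inv_cancel_right])
    rw [hc2]

theorem IsFrobeniusSylow.ncard_charTransporter_self (h : IsFrobeniusSylow p q P x) {l : P →* ℂˣ}
    (hl : l ≠ 1) : (charTransporter P l l).ncard = Nat.card P := by
  rw [h.charTransporter_self hl, ← Nat.card_coe_set_eq]
  rfl

end DualGroup

section LinearCharacterSums

variable {G : Type*} [Group G] [Finite G] {n : ℕ} (χ : Fin n → G → ℂ)

open Classical in
theorem sum_inv_monoidHom_units_apply (A : Subgroup G) (hA : ∀ a ∈ A, ∀ b ∈ A, Commute a b)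
    [Fintype (A →* ℂˣ)] (a : A) :
    ∑ l : A →* ℂˣ, (((l a)⁻¹ : ℂˣ) : ℂ) = if a = 1 then (Nat.card A : ℂ) else 0 := by
  split_ifs with ha
  · rw [ha, ← card_monoidHom_units A hA]
    simp
  · simp_rw [← map_inv]
    exact sum_monoidHom_units_apply A hA (inv_ne_one.mpr ha)

theorem sum_charSum_eq (A : Subgroup G) (hA : ∀ a ∈ A, ∀ b ∈ A, Commute a b)
    [Fintype (A →* ℂˣ)] (i : Fin n) : ∑ l, charSum χ A l i = Nat.card A * χ i 1 := by
  classical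
  have := Fintype.ofFinite A
  simp only [charSum, finsum_eq_sum_of_fintype]
  rw [Finset.sum_comm]
  simp_rw [← Finset.sum_mul, sum_inv_monoidHom_units_apply A hA]
  simp

theorem sum_charSum_sq_eq (A : Subgroup G) (hA : ∀ a ∈ A, ∀ b ∈ A, Commute a b)
    [Fintype (A →* ℂˣ)] [Fintype A] (i : Fin n) :
    ∑ l, charSum χ A l i ^ 2 = Nat.card A * ∑ a : A, χ i a * χ i (a : G)⁻¹ := by
  classical
  simp only [charSum, finsum_eq_sum_of_fintype, pow_two, Finset.sum_mul_sum]
  rw [Finset.sum_comm, Finset.mul_sum]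
  refine Finset.sum_congr rfl fun a _ => ?_
  rw [Finset.sum_comm]
  have h1 : ∀ b : A, ∑ l : A →* ℂˣ, (((l a)⁻¹ : ℂˣ) : ℂ) * χ i a * (((l b)⁻¹ : ℂˣ) * χ i b) =
      (if a * b = 1 then (Nat.card A : ℂ) else 0) * (χ i a * χ i b) := by
    intro b
    rw [← sum_inv_monoidHom_units_apply A hA, Finset.sum_mul]
    refine Finset.sum_congr rfl fun l _ => ?_
    rw [map_mul, mul_inv, Units.val_mul]
    ring
  simp_rw [h1]
  rw [Finset.sum_eq_single a⁻¹]
  · simp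
  · intro b _ hb
    rw [if_neg fun h => hb (eq_inv_of_mul_eq_one_right h), zero_mul]
  · simp

open Classical in
theorem charSum_of_eq_one (A : Subgroup G) (l : A →* ℂˣ) {i : Fin n} (hi : ∀ g, χ i g = 1) :
    charSum χ A l i = if l = 1 then (Nat.card A : ℂ) else 0 := by
  have := Fintype.ofFinite A
  have h1 : charSum χ A l i = ∑ a : A, ((Units.coeHom ℂ).comp l⁻¹) a := by
    rw [charSum, finsum_eq_sum_of_fintype]
    refine Finset.sum_congr rfl fun a _ => ?_
    rw [hi, mul_one]
    rfl
  have h2 : (Units.coeHom ℂ).comp l⁻¹ = 1 ↔ l = 1 := by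
    constructor
    · intro h
      ext a
      have h2 : (((l a)⁻¹ : ℂˣ) : ℂ) = 1 := DFunLike.congr_fun h a
      have h3 : (l a)⁻¹ = 1 := Units.ext h2
      rw [inv_eq_one.mp h3]
      rfl
    · rintro rfl
      ext a
      simp
  rw [h1, sum_hom_units, Nat.card_eq_fintype_card]
  by_cases hl : l = 1
  · rw [if_pos (h2.mpr hl), if_pos hl]
  · rw [if_neg fun h => hl (h2.mp h), if_neg hl, Nat.cast_zero]

end LinearCharacterSums

section CharacterFamily

/-- The multiplicities `τ` of the trivial character of `P`, and the set `V` of the vectors of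
multiplicities of the nontrivial linear characters of `P`, in the irreducible characters. -/
structure IsCharacterFamily {G : Type*} [Group G] [Fintype G] {n : ℕ} (χ : Fin n → G → ℂ)
    (P : Subgroup G) (q : ℕ) (τ : Fin n → ℤ) (V : Finset (Fin n → ℤ)) : Prop where
  exists_left : ∃ l : P →* ℂˣ, ∀ i, charSum χ P l i = Nat.card P * τ i
  exists_mem : ∀ v ∈ V, ∃ l : P →* ℂˣ, ∀ i, charSum χ P l i = Nat.card P * v i
  card_mul : V.card * q + 1 = Nat.card P
  sum_sub_sq : ∀ v ∈ V, ∀ w ∈ V, v ≠ w → ∑ i, (v i - w i) ^ 2 = 2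
  sum_left_sub_sq : ∀ v ∈ V, ∑ i, (τ i - v i) ^ 2 = q + 1
  sum_mul_inv : ∀ i, ∑ᶠ a : P, χ i a * χ i (a : G)⁻¹ =
    Nat.card P * ((τ i : ℂ) ^ 2 + q * ∑ v ∈ V, (v i : ℂ) ^ 2)
  degree : ∀ i, χ i 1 = τ i + q * ∑ v ∈ V, (v i : ℂ)
  left_of_eq_one : ∀ i, (∀ g, χ i g = 1) → τ i = 1
  mem_of_eq_one : ∀ i, (∀ g, χ i g = 1) → ∀ v ∈ V, v i = 0

variable {G : Type*} [Group G] [Fintype G] [DecidableEq G] {n : ℕ} {χ : Fin n → G → ℂ}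
  {p q : ℕ} {P : Subgroup G} {x : G}

theorem IsFrobeniusSylow.exists_isCharacterFamily (h : IsFrobeniusSylow p q P x)
    (hχ : IsCharacterTable G χ) : ∃ τ V, IsCharacterFamily χ P q τ V := by
  classical
  have hA : ∀ a ∈ P, ∀ b ∈ P, Commute a b := fun a ha b hb => h.commute ha hb
  have := finite_monoidHom_units P hA
  have := Fintype.ofFinite (P →* ℂˣ)
  have hcard := card_monoidHom_units P hA
  have hP0 : (Nat.card P : ℤ) ≠ 0 := by exact_mod_cast Nat.card_pos.ne'
  have hP0' : (Nat.card P : ℂ) ≠ 0 := by exact_mod_cast Nat.card_pos.ne'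
  choose v0 hv0 using fun (l : P →* ℂˣ) (i : Fin n) => hχ.exists_mul_sum i P l
  let v : (P →* ℂˣ) → Fin n → ℤ := fun l i => v0 l i
  have hv : ∀ l i, charSum χ P l i = Nat.card P * v l i := by
    intro l i
    rw [charSum, hv0]
    simp [v]
  let t : (P →* ℂˣ) → (P →* ℂˣ) → ℕ := fun l m => (charTransporter P l m).ncard
  have hin : ∀ l m, (Nat.card P : ℤ) ^ 2 * ∑ i, v l i * v m i =
      Nat.card P * t l m + ((Fintype.card G : ℤ) - Nat.card P * q) := by
    intro l m
    have h1 := hχ.sum_charSum_mul_self P h.mem_normalizer l m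
    simp_rw [hv] at h1
    rw [h.card_normalizer] at h1
    have h2 : ((Nat.card P : ℂ)) ^ 2 * ∑ i, (v l i : ℂ) * v m i =
        ∑ i, (Nat.card P : ℂ) * v l i * (Nat.card P * v m i) := by
      rw [Finset.mul_sum]
      exact Finset.sum_congr rfl fun i _ => by ring
    rw [← h2] at h1
    push_cast at h1
    exact_mod_cast h1
  have hsymm : ∀ l m, t l m = t m l := by
    intro l m
    have h1 := hin l m
    have h2 := hin m l
    have h3 : ∑ i, v l i * v m i = ∑ i, v m i * v l i :=
      Finset.sum_congr rfl fun i _ => mul_comm _ _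
    rw [h3, h2] at h1
    have h4 : (Nat.card P : ℤ) * t m l = Nat.card P * t l m := by linarith
    exact_mod_cast (mul_left_cancel₀ hP0 h4).symm
  have hdist : ∀ l m, (Nat.card P : ℤ) * ∑ i, (v l i - v m i) ^ 2 =
      t l l + t m m - 2 * t l m := by
    intro l m
    have h3 : ∑ i, (v l i - v m i) ^ 2 =
        ∑ i, v l i * v l i + ∑ i, v m i * v m i - 2 * ∑ i, v l i * v m i := by
      rw [Finset.mul_sum, ← Finset.sum_add_distrib, ← Finset.sum_sub_distrib]
      exact Finset.sum_congr rfl fun i _ => by ring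
    refine mul_left_cancel₀ hP0 ?_
    rw [h3]
    linear_combination hin l l + hin m m - 2 * hin l m
  have ht1 : ∀ m, m ≠ 1 → t 1 m = 0 := by
    intro m hm
    simp only [t]
    rw [Set.ncard_eq_zero, Set.eq_empty_iff_forall_notMem]
    exact fun g hg => hm (eq_one_of_mem_charTransporter_one hg)
  have ht11 : t 1 1 = Nat.card P * q := by
    simp only [t]
    rw [charTransporter_one_one, ← h.card_normalizer, ← Nat.card_coe_set_eq]
    rfl
  have hself : ∀ l, l ≠ 1 → t l l = Nat.card P := fun l hl => h.ncard_charTransporter_self hl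
  have hor : ∀ l m, m ≠ 1 → t l m = 0 ∨ t l m = Nat.card P := by
    intro l m hm
    rcases (charTransporter P l m).eq_empty_or_nonempty with h0 | ⟨g, hg⟩
    · left
      simp only [t]
      rw [h0, Set.ncard_empty]
    · right
      rw [← hself m hm]
      exact ncard_charTransporter_of_mem hg
  have heq : ∀ l m, l ≠ 1 → m ≠ 1 → v m = v l → t l m = Nat.card P := by
    intro l m hl hm hlm
    refine (hor l m hm).resolve_left fun h0 => ?_
    have h1 := hdist l m
    rw [hlm, hself l hl, hself m hm, h0] at h1
    have h2 : (Nat.card P : ℤ) = 0 := by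
      simp only [sub_self, ne_eq, OfNat.ofNat_ne_zero, not_false_eq_true, zero_pow,
        Finset.sum_const_zero, mul_zero, Nat.cast_zero, sub_zero] at h1
      linarith
    exact hP0 h2
  have hne : ∀ l m, l ≠ 1 → m ≠ 1 → v m ≠ v l →
      t l m = 0 ∧ ∑ i, (v l i - v m i) ^ 2 = 2 := by
    intro l m hl hm hlm
    have h1 := hdist l m
    rw [hself l hl, hself m hm] at h1
    have h0 : t l m = 0 := by
      refine (hor l m hm).resolve_right fun h0 => hlm ?_
      rw [h0] at h1
      have h2 : ∑ i, (v l i - v m i) ^ 2 = 0 := by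
        refine mul_left_cancel₀ hP0 ?_
        rw [h1]
        ring
      rw [Finset.sum_eq_zero_iff_of_nonneg fun i _ => sq_nonneg _] at h2
      funext i
      have := pow_eq_zero_iff (two_ne_zero) |>.mp (h2 i (Finset.mem_univ _))
      linarith
    refine ⟨h0, mul_left_cancel₀ hP0 ?_⟩
    rw [h1, h0]
    push_cast
    ring
  let S : Finset (P →* ℂˣ) := Finset.univ.erase 1
  have hS : ∀ l, l ∈ S ↔ l ≠ 1 := fun l => by simp [S]
  have hfib : ∀ l ∈ S, (S.filter fun m => v m = v l).card = q := by
    intro l hl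
    have hl1 := (hS l).mp hl
    have h1 := sum_ncard_charTransporter P l
    rw [h.card_normalizer, ← Finset.add_sum_erase _ _ (Finset.mem_univ 1)] at h1
    have h2 : (charTransporter P l 1).ncard = 0 := (hsymm l 1).trans (ht1 l hl1)
    rw [h2, zero_add] at h1
    have h3 : ∑ m ∈ S, t l m = ∑ m ∈ S, if v m = v l then Nat.card P else 0 := by
      refine Finset.sum_congr rfl fun m hm => ?_
      split_ifs with hml
      · exact heq l m hl1 ((hS m).mp hm) hml
      · exact (hne l m hl1 ((hS m).mp hm) hml).1
    have h4 : ∑ m ∈ S, t l m = Nat.card P * q := h1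
    rw [h3, ← Finset.sum_filter, Finset.sum_const, smul_eq_mul, mul_comm] at h4
    exact Nat.eq_of_mul_eq_mul_left Nat.card_pos h4
  let V : Finset (Fin n → ℤ) := S.image v
  have hsumF : ∀ F : (Fin n → ℤ) → ℂ, ∑ l, F (v l) = F (v 1) + q * ∑ w ∈ V, F w := by
    intro F
    rw [← Finset.add_sum_erase _ _ (Finset.mem_univ 1)]
    congr 1
    rw [Finset.mul_sum, ← Finset.sum_fiberwise_of_maps_to
      (fun l hl => Finset.mem_image_of_mem v hl : ∀ l ∈ S, v l ∈ V)]
    refine Finset.sum_congr rfl fun w hw => ?_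
    obtain ⟨l, hl, rfl⟩ := Finset.mem_image.mp hw
    rw [Finset.sum_congr rfl fun m hm => by rw [(Finset.mem_filter.mp hm).2], Finset.sum_const,
      hfib l hl, nsmul_eq_mul]
  refine ⟨v 1, V, ⟨1, hv 1⟩, ?_, ?_, ?_, ?_, ?_, ?_, ?_, ?_⟩
  · intro w hw
    obtain ⟨l, hl, rfl⟩ := Finset.mem_image.mp hw
    exact ⟨l, hv l⟩
  · have h1 := hsumF fun _ => 1
    rw [Finset.sum_const, Finset.sum_const, Finset.card_univ, ← Nat.card_eq_fintype_card,
      hcard] at h1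
    simp only [nsmul_eq_mul, mul_one] at h1
    have h2 : (Nat.card P : ℂ) = ((V.card * q + 1 : ℕ) : ℂ) := by
      rw [h1]
      push_cast
      ring
    exact_mod_cast h2.symm
  · intro w hw w' hw' hww
    obtain ⟨l, hl, rfl⟩ := Finset.mem_image.mp hw
    obtain ⟨m, hm, rfl⟩ := Finset.mem_image.mp hw'
    exact (hne l m ((hS l).mp hl) ((hS m).mp hm) fun h0 => hww h0.symm).2
  · intro w hw
    obtain ⟨m, hm, rfl⟩ := Finset.mem_image.mp hw
    refine mul_left_cancel₀ hP0 ?_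
    rw [hdist, ht11, ht1 m ((hS m).mp hm), hself m ((hS m).mp hm)]
    push_cast
    ring
  · intro i
    rw [finsum_eq_sum_of_fintype]
    have h1 := sum_charSum_sq_eq χ P hA i
    simp_rw [hv, mul_pow] at h1
    rw [← Finset.mul_sum, hsumF fun w => (w i : ℂ) ^ 2] at h1
    refine mul_left_cancel₀ hP0' ?_
    rw [← h1]
    ring
  · intro i
    have h1 := sum_charSum_eq χ P hA i
    simp_rw [hv] at h1
    rw [← Finset.mul_sum, hsumF fun w => (w i : ℂ)] at h1
    exact (mul_left_cancel₀ hP0' h1).symm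
  · intro i hi
    have h1 := charSum_of_eq_one χ P 1 hi
    rw [hv, if_pos rfl] at h1
    have h2 : (v 1 i : ℂ) = 1 := mul_left_cancel₀ hP0' (by rw [h1, mul_one])
    exact_mod_cast h2
  · intro i hi w hw
    obtain ⟨m, hm, rfl⟩ := Finset.mem_image.mp hw
    have h1 := charSum_of_eq_one χ P m hi
    rw [hv, if_neg ((hS m).mp hm)] at h1
    have h2 : (v m i : ℂ) = 0 := (mul_eq_zero.mp h1).resolve_left hP0'
    exact_mod_cast h2

end CharacterFamily

section UnitVectors

variable {ι : Type*} [Fintype ι] [DecidableEq ι]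

theorem exists_eq_single_sub_single {z d : ι → ℤ} (hz : ∑ i, z i ^ 2 = 2) (hd : ∀ i, 0 < d i)
    (hzd : ∑ i, z i * d i = 0) :
    ∃ a b, a ≠ b ∧ z = Pi.single a (1 : ℤ) - Pi.single b (1 : ℤ) := by
  have hne : ∃ i, z i ≠ 0 := by
    by_contra! h
    simp [h] at hz
  have hpos : ∃ a, 0 < z a := by
    by_contra! h
    obtain ⟨i, hi⟩ := hne
    have h1 : ∑ i, z i * d i < ∑ _i : ι, (0 : ℤ) :=
      Finset.sum_lt_sum (fun j _ => mul_nonpos_of_nonpos_of_nonneg (h j) (hd j).le)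
        ⟨i, Finset.mem_univ _, mul_neg_of_neg_of_pos (lt_of_le_of_ne (h i) hi) (hd i)⟩
    simp [hzd] at h1
  have hneg : ∃ b, z b < 0 := by
    by_contra! h
    obtain ⟨i, hi⟩ := hne
    have h1 : ∑ _i : ι, (0 : ℤ) < ∑ i, z i * d i :=
      Finset.sum_lt_sum (fun j _ => mul_nonneg (h j) (hd j).le)
        ⟨i, Finset.mem_univ _, mul_pos (lt_of_le_of_ne (h i) hi.symm) (hd i)⟩
    simp [hzd] at h1
  obtain ⟨a, ha⟩ := hpos
  obtain ⟨b, hb⟩ := hneg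
  have hab : a ≠ b := fun h => by
    rw [h] at ha
    exact lt_asymm ha hb
  rw [← Finset.add_sum_erase _ _ (Finset.mem_univ a),
    ← Finset.add_sum_erase _ _ (Finset.mem_erase.mpr ⟨hab.symm, Finset.mem_univ b⟩)] at hz
  have h0 : 0 ≤ ∑ i ∈ (Finset.univ.erase a).erase b, z i ^ 2 :=
    Finset.sum_nonneg fun _ _ => sq_nonneg _
  have hza : z a = 1 := by nlinarith
  have hzb : z b = -1 := by nlinarith
  have h1 : ∑ i ∈ (Finset.univ.erase a).erase b, z i ^ 2 = 0 := by
    rw [hza, hzb] at hz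
    linarith
  rw [Finset.sum_eq_zero_iff_of_nonneg fun _ _ => sq_nonneg _] at h1
  refine ⟨a, b, hab, funext fun i => ?_⟩
  by_cases hia : i = a
  · subst hia
    simp [hza, hab]
  by_cases hib : i = b
  · subst hib
    simp [hzb, hia]
  · have h2 := h1 i (by simp [hia, hib])
    simp [hia, hib, pow_eq_zero_iff (two_ne_zero) |>.mp h2]

theorem exists_eq_add_single {V : Finset (ι → ℤ)} (hV : V.Nonempty)
    {d : ι → ℤ} (hd : ∀ i, 0 < d i)
    (hsq : ∀ v ∈ V, ∀ w ∈ V, v ≠ w → ∑ i, (v i - w i) ^ 2 = 2)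
    (horth : ∀ v ∈ V, ∀ w ∈ V, ∑ i, (v i - w i) * d i = 0) [Nonempty ι] :
    ∃ (u : ι → ℤ) (ε : ℤ) (s : (ι → ℤ) → ι), (ε = 1 ∨ ε = -1) ∧
      ∀ v ∈ V, v = u + Pi.single (s v) ε := by
  obtain ⟨x, hx⟩ := hV
  have h1 : ∀ v ∈ V.erase x, ∃ a b, a ≠ b ∧ x - v = Pi.single a (1 : ℤ) - Pi.single b (1 : ℤ) := by
    intro v hv
    rw [Finset.mem_erase] at hv
    exact exists_eq_single_sub_single (z := x - v) (hsq x hx v hv.2 hv.1.symm) hd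
      (horth x hx v hv.2)
  choose! a b hab hvab using h1
  have hpair : ∀ v ∈ V.erase x, ∀ w ∈ V.erase x, v ≠ w → a v ≠ a w → b v = b w := by
    intro v hv w hw hvw ha
    by_contra hb
    have hv' := Finset.mem_erase.mp hv
    have hw' := Finset.mem_erase.mp hw
    have h2 := hsq v hv'.2 w hw'.2 hvw
    have h3 : ∀ i, v i - w i = ((Pi.single (a w) (1 : ℤ) : ι → ℤ) i -
        (Pi.single (b w) (1 : ℤ) : ι → ℤ) i) -
        ((Pi.single (a v) (1 : ℤ) : ι → ℤ) i - (Pi.single (b v) (1 : ℤ) : ι → ℤ) i) := by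
      intro i
      have h4 := congrFun (hvab v hv) i
      have h5 := congrFun (hvab w hw) i
      simp only [Pi.sub_apply] at h4 h5
      linarith
    have h4 : ∀ i, (v i - w i) ^ 2 = ((Pi.single (a w) (1 : ℤ) : ι → ℤ) i -
        (Pi.single (b w) (1 : ℤ) : ι → ℤ) i) ^ 2 +
        ((Pi.single (a v) (1 : ℤ) : ι → ℤ) i - (Pi.single (b v) (1 : ℤ) : ι → ℤ) i) ^ 2 -
        2 * ((Pi.single (a w) (1 : ℤ) : ι → ℤ) i * (Pi.single (a v) (1 : ℤ) : ι → ℤ) i) -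
        2 * ((Pi.single (b w) (1 : ℤ) : ι → ℤ) i * (Pi.single (b v) (1 : ℤ) : ι → ℤ) i) +
        2 * ((Pi.single (a w) (1 : ℤ) : ι → ℤ) i * (Pi.single (b v) (1 : ℤ) : ι → ℤ) i) +
        2 * ((Pi.single (b w) (1 : ℤ) : ι → ℤ) i * (Pi.single (a v) (1 : ℤ) : ι → ℤ) i) := by
      intro i
      rw [h3]
      ring
    have h5 : ∀ p ∈ V.erase x, ∑ i, ((Pi.single (a p) (1 : ℤ) : ι → ℤ) i -
        (Pi.single (b p) (1 : ℤ) : ι → ℤ) i) ^ 2 =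
        2 := by
      intro p hp
      have hp' := Finset.mem_erase.mp hp
      rw [← hsq x hx p hp'.2 hp'.1.symm]
      refine Finset.sum_congr rfl fun i _ => ?_
      have := congrFun (hvab p hp) i
      simp only [Pi.sub_apply] at this
      rw [this]
    have h6 : ∀ s t : ι, ∑ i, (Pi.single s (1 : ℤ) : ι → ℤ) i * (Pi.single t (1 : ℤ) : ι → ℤ) i =
        if s = t then 1 else 0 := by
      intro s t
      simp [Pi.single_apply, eq_comm]
    simp_rw [h4] at h2
    simp only [Finset.sum_add_distrib, Finset.sum_sub_distrib, ← Finset.mul_sum, h6] at h2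
    rw [h5 v hv, h5 w hw, if_neg (Ne.symm ha), if_neg (Ne.symm hb)] at h2
    split_ifs at h2 <;> simp at h2
  by_cases hall : ∃ v ∈ V.erase x, ∃ w ∈ V.erase x, a v ≠ a w
  · obtain ⟨v, hv, w, hw, hvw⟩ := hall
    have hb : ∀ z ∈ V.erase x, b z = b v := by
      intro z hz
      by_cases hav : a z = a v
      · have haw : a z ≠ a w := by rwa [hav]
        rw [hpair z hz w hw (fun h => haw (by rw [h])) haw,
          hpair v hv w hw (fun h => hvw (by rw [h])) hvw]
      · exact hpair z hz v hv (fun h => hav (by rw [h])) hav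
    refine ⟨x + Pi.single (b v) 1, -1, fun z => if z = x then b v else a z, Or.inr rfl, ?_⟩
    intro z hz
    dsimp only
    split_ifs with hzx
    · rw [hzx, add_assoc, ← Pi.single_add]
      simp
    · have hz' := Finset.mem_erase.mpr ⟨hzx, hz⟩
      have h2 := hvab z hz'
      rw [hb z hz'] at h2
      rw [Pi.single_neg, ← sub_eq_add_neg, eq_sub_iff_add_eq,
        ← sub_eq_sub_iff_add_eq_add.mp h2.symm]
      abel
  · push Not at hall
    by_cases hne : (V.erase x).Nonempty
    · obtain ⟨v, hv⟩ := hne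
      refine ⟨x - Pi.single (a v) 1, 1, fun z => if z = x then a v else b z, Or.inl rfl, ?_⟩
      intro z hz
      dsimp only
      split_ifs with hzx
      · simp [hzx]
      · have hz' := Finset.mem_erase.mpr ⟨hzx, hz⟩
        have h2 := hvab z hz'
        rw [hall z hz' v hv] at h2
        rw [sub_add_eq_add_sub, eq_sub_iff_add_eq]
        rw [sub_eq_sub_iff_add_eq_add] at h2
        rw [h2, add_comm]
    · rw [Finset.not_nonempty_iff_eq_empty] at hne
      refine ⟨x - Pi.single (Classical.arbitrary ι) 1, 1, fun _ => Classical.arbitrary ι,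
        Or.inl rfl, ?_⟩
      intro z hz
      have hzx : z = x := by
        by_contra h
        have := Finset.mem_erase.mpr ⟨h, hz⟩
        simp [hne] at this
      simp [hzx]

end UnitVectors

section FinalEstimate

variable {κ : Type*} [Fintype κ] [DecidableEq κ] {w h e : κ → ℕ} {g : ℕ} {c : κ → κ → ℤ}

theorem one_sub_inv_le_of_le (hh : ∀ k, w k * e k + 1 = h k) (hw : ∀ k, 2 ≤ w k)
    (hsum : ∑ k, (w k / h k : ℚ) = 1 - 1 / g)
    (hc : ∀ i j, i ≠ j → c i j ≠ 0 ∨ c j i ≠ 0)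
    (hrow : ∀ i, ∑ k ∈ Finset.univ.erase i, (c i k : ℚ) ^ 2 * (w k / h k) ≤ e i / h i)
    (hnorm : ∀ k, ∑ j ∈ Finset.univ.erase k, (w j : ℤ) * c j k ^ 2 ≤ e k - 1)
    (i : κ) {m : ℕ} (hm0 : 0 < m) (hm : ∀ j, j ≠ i → m ≤ e j) :
    (1 - 1 / g : ℚ) ≤ w i / h i + e i / h i + (e i - 1) / (2 * m) := by
  have hpos : ∀ k, (0 : ℚ) ≤ w k / h k := fun k => by positivity
  have hsq : ∀ z : ℤ, z ≠ 0 → 1 ≤ z ^ 2 := fun z hz => by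
    have : 0 < z ^ 2 := by positivity
    omega
  have hub : ∀ j, j ≠ i → (w j / h j : ℚ) ≤ 1 / m := by
    intro j hj
    have h0 : 0 < h j := by have := hh j; omega
    rw [div_le_div_iff₀ (by exact_mod_cast h0) (by exact_mod_cast hm0), one_mul]
    have h1 : w j * m ≤ h j := by
      rw [← hh j]
      exact (Nat.mul_le_mul_left _ (hm j hj)).trans (Nat.le_succ _)
    exact_mod_cast h1
  let J := (Finset.univ.erase i).filter fun j => c j i ≠ 0
  have hJ : 2 * (J.card : ℤ) ≤ e i - 1 := by
    refine le_trans ?_ (hnorm i)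
    calc 2 * (J.card : ℤ) = ∑ j ∈ J, (2 : ℤ) := by
          rw [Finset.sum_const, nsmul_eq_mul, mul_comm]
      _ ≤ ∑ j ∈ J, (w j : ℤ) * c j i ^ 2 := by
          refine Finset.sum_le_sum fun j hj => ?_
          have h1 := hsq _ (Finset.mem_filter.mp hj).2
          have h2 : (2 : ℤ) ≤ w j := by exact_mod_cast hw j
          nlinarith
      _ ≤ _ := Finset.sum_le_sum_of_subset_of_nonneg (Finset.filter_subset _ _)
          fun j _ _ => by positivity
  have hJq : (J.card : ℚ) ≤ (e i - 1) / 2 := by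
    rw [le_div_iff₀ (by norm_num), mul_comm]
    exact_mod_cast hJ
  rw [← hsum, ← Finset.add_sum_erase _ _ (Finset.mem_univ i), add_assoc]
  refine add_le_add le_rfl ?_
  rw [← Finset.sum_filter_add_sum_filter_not _ (fun j => c j i ≠ 0), add_comm]
  refine add_le_add ?_ ?_
  · refine le_trans ?_ (hrow i)
    calc _ ≤ ∑ j ∈ (Finset.univ.erase i).filter (fun j => ¬ c j i ≠ 0),
          (c i j : ℚ) ^ 2 * (w j / h j) := by
          refine Finset.sum_le_sum fun j hj => ?_
          rw [Finset.mem_filter, Finset.mem_erase] at hj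
          have h1 := hsq _ ((hc i j hj.1.1.symm).resolve_right hj.2)
          have h2 : (1 : ℚ) ≤ (c i j : ℚ) ^ 2 := by exact_mod_cast h1
          exact le_mul_of_one_le_left (hpos j) h2
      _ ≤ _ := Finset.sum_le_sum_of_subset_of_nonneg (Finset.filter_subset _ _)
          fun j _ _ => mul_nonneg (sq_nonneg _) (hpos j)
  · calc ∑ j ∈ J, (w j / h j : ℚ) ≤ ∑ j ∈ J, (1 / m : ℚ) :=
          Finset.sum_le_sum fun j hj => hub j (Finset.mem_erase.mp (Finset.mem_filter.mp hj).1).1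
      _ = J.card * (1 / m) := by rw [Finset.sum_const, nsmul_eq_mul]
      _ ≤ (e i - 1) / 2 * (1 / m) := mul_le_mul_of_nonneg_right hJq (by positivity)
      _ = (e i - 1) / (2 * m) := by rw [div_mul_div_comm, mul_one]

theorem false_of_multiplicities [Nonempty κ] (hh : ∀ k, w k * e k + 1 = h k)
    (he : ∀ k, 3 ≤ e k) (hodd : ∀ k, Odd (e k)) (hw : ∀ k, 2 ≤ w k) (heven : ∀ k, Even (w k))
    (hinj : Function.Injective h) (hg : ∀ k, e k * h k ≤ g)
    (hsum : ∑ k, (w k / h k : ℚ) = 1 - 1 / g)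
    (hc : ∀ i j, i ≠ j → c i j ≠ 0 ∨ c j i ≠ 0)
    (hrow : ∀ i, ∑ k ∈ Finset.univ.erase i, (c i k : ℚ) ^ 2 * (w k / h k) ≤ e i / h i)
    (hnorm : ∀ k, ∑ j ∈ Finset.univ.erase k, (w j : ℤ) * c j k ^ 2 ≤ e k - 1) : False := by
  obtain ⟨i, hi⟩ := Finite.exists_min e
  have hmain := fun j (m : ℕ) => one_sub_inv_le_of_le (m := m) hh hw hsum hc hrow hnorm j
  have hgq : ∀ k, (1 / g : ℚ) ≤ 1 / (e k * h k) := by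
    intro k
    have h0 : 0 < h k := by have := hh k; omega
    have h1 : 0 < e k * h k := Nat.mul_pos (by have := he k; omega) h0
    refine one_div_le_one_div_of_le (by exact_mod_cast h1) (by exact_mod_cast hg k)
  have hhq : ∀ k, (h k : ℚ) = w k * e k + 1 := fun k => by rw [← hh k]; push_cast; ring
  have heq : ∀ k, (3 : ℚ) ≤ e k := fun k => by exact_mod_cast he k
  by_cases hbig : ∃ j, e j = e i ∧ 4 ≤ w j
  · obtain ⟨j, hj, hwj⟩ := hbig
    have h1 := hmain j (e j) (by have := he j; omega) fun k _ => by rw [hj]; exact hi k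
    have h2 := hgq j
    rw [hhq j] at h1 h2
    have hE := heq j
    have hW : (4 : ℚ) ≤ w j := by exact_mod_cast hwj
    generalize (e j : ℚ) = E at *
    generalize (w j : ℚ) = W at *
    have h3 : 1 / (E * (W * E + 1)) ≤ 1 / 39 :=
      one_div_le_one_div_of_le (by norm_num) (by
        have h0 : 12 ≤ W * E := by nlinarith
        nlinarith)
    have h4 : W / (W * E + 1) ≤ 1 / E := by
      rw [div_le_div_iff₀ (by nlinarith) (by linarith)]
      nlinarith
    have h5 : E / (W * E + 1) ≤ 1 / 4 := by
      rw [div_le_div_iff₀ (by nlinarith) (by linarith)]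
      nlinarith
    have h6 : (E - 1) / (2 * E) = 1 / 2 - (1 / E) / 2 := by
      have : E ≠ 0 := by linarith
      field_simp
    have h7 : 1 / E ≤ 1 / 3 := one_div_le_one_div_of_le (by norm_num) hE
    linarith
  · push Not at hbig
    have hw2 : ∀ j, e j = e i → w j = 2 := by
      intro j hj
      obtain ⟨r, hr⟩ := heven j
      have := hbig j hj
      have := hw j
      omega
    have hm : ∀ j, j ≠ i → e i + 2 ≤ e j := by
      intro j hj
      have h1 : e j ≠ e i := fun h => hj (hinj (by rw [← hh, ← hh, hw2 j h, hw2 i rfl, h]))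
      have h2 := hi j
      obtain ⟨r, hr⟩ := hodd j
      obtain ⟨s, hs⟩ := hodd i
      omega
    have h1 := hmain i (e i + 2) (by omega) hm
    have h2 := hgq i
    rw [hhq i, hw2 i rfl] at h1 h2
    have hE := heq i
    push_cast at h1 h2
    generalize (e i : ℚ) = E at *
    have h3 : 1 - 1 / (E * (2 * E + 1)) ≤
        2 / (2 * E + 1) + E / (2 * E + 1) + (E - 1) / (2 * (E + 2)) := by linarith
    have h4 : 2 / (2 * E + 1) + E / (2 * E + 1) + (E - 1) / (2 * (E + 2)) -
        (1 - 1 / (E * (2 * E + 1))) =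
        (2 * E + 4 - 3 * E * (E - 1)) / (2 * E * (E + 2) * (2 * E + 1)) := by
      have : E ≠ 0 := by linarith
      have : 2 * E + 1 ≠ 0 := by linarith
      have : E + 2 ≠ 0 := by linarith
      field_simp
      ring
    have h5 : (2 * E + 4 - 3 * E * (E - 1)) / (2 * E * (E + 2) * (2 * E + 1)) < 0 :=
      div_neg_of_neg_of_pos (by nlinarith) (by positivity)
    linarith

end FinalEstimate

section CoherentFamilies

variable {ι κ : Type*} [Fintype ι] [DecidableEq ι] [Fintype κ] {i₀ : ι}
  {d : ι → ℤ} {h e : κ → ℕ} {τ : κ → ι → ℤ} {V : κ → Finset (ι → ℤ)} {g : ℕ}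

theorem sum_mul_single_eq (F : ι → ℤ) (a : ι) (ε : ℤ) :
    ∑ i, F i * (Pi.single a ε : ι → ℤ) i = F a * ε := by
  simp [Pi.single_apply]

/-- The families of vectors `V k` are unit vectors, up to a sign `ε k` and a translation `u k`,
with pairwise disjoint supports `S k` which together cover all indices but `i₀`. -/
structure IsCoherent (i₀ : ι) (V : κ → Finset (ι → ℤ)) (u : κ → ι → ℤ) (ε : κ → ℤ)
    (S : κ → Finset ι) : Prop where
  sign : ∀ k, ε k = 1 ∨ ε k = -1
  exists_eq : ∀ k, ∀ v ∈ V k, ∃ a ∈ S k, v = u k + Pi.single a (ε k)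
  mem : ∀ k, ∀ a ∈ S k, u k + Pi.single a (ε k) ∈ V k
  card : ∀ k, (S k).card = (V k).card
  apply_eq_zero : ∀ k, u k i₀ = 0
  notMem : ∀ k j a, k ≠ j → a ∈ S k → a ∉ S j
  sum_eq : ∀ F : ι → ℤ, ∑ i, F i = F i₀ + ∑ k, ∑ a ∈ S k, F a

theorem exists_isCoherent [Nonempty ι] (hd : ∀ i, 0 < d i) (hcard : ∀ k, 2 ≤ (V k).card)
    (hsq : ∀ k, ∀ v ∈ V k, ∀ w ∈ V k, v ≠ w → ∑ i, (v i - w i) ^ 2 = 2)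
    (horth : ∀ k, ∀ v ∈ V k, ∀ w ∈ V k, ∑ i, (v i - w i) * d i = 0)
    (hcross : ∀ k j, k ≠ j → ∀ v ∈ V k, ∀ w ∈ V k, ∀ v' ∈ V j, ∀ w' ∈ V j,
      ∑ i, (v i - w i) * (v' i - w' i) = 0)
    (hzero : ∀ k, ∀ v ∈ V k, v i₀ = 0)
    (hι : Fintype.card ι = 1 + ∑ k, (V k).card) :
    ∃ u ε S, IsCoherent i₀ V u ε S := by
  classical
  have hex := fun k => exists_eq_add_single (Finset.card_pos.mp
    (lt_of_lt_of_le two_pos (hcard k))) hd (hsq k) (horth k)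
  choose u ε s hε hs using hex
  have hε0 : ∀ k, ε k ≠ 0 := fun k => by rcases hε k with h | h <;> simp [h]
  have hinj : ∀ k, Set.InjOn (s k) (V k) := by
    intro k v hv w hw hvw
    rw [hs k v hv, hs k w hw, hvw]
  have hother : ∀ k, ∀ v ∈ V k, ∃ w ∈ V k, s k w ≠ s k v := by
    intro k v hv
    obtain ⟨w, hw, hne⟩ := Finset.exists_mem_ne (hcard k) v
    exact ⟨w, hw, fun h => hne (hinj k hw hv h)⟩
  have hu0 : ∀ k, ∀ v ∈ V k, s k v ≠ i₀ := by
    intro k v hv hv0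
    obtain ⟨w, hw, hne⟩ := hother k v hv
    have h1 := hzero k v hv
    have h2 := hzero k w hw
    rw [hs k v hv, hv0] at h1
    rw [hs k w hw] at h2
    simp only [Pi.add_apply, Pi.single_eq_same] at h1 h2
    rw [Pi.single_eq_of_ne (by rw [← hv0]; exact hne.symm)] at h2
    exact hε0 k (by linarith)
  have hdisj : ∀ k j, k ≠ j → ∀ v ∈ V k, ∀ v' ∈ V j, s k v ≠ s j v' := by
    intro k j hkj v hv v' hv' heq
    obtain ⟨w, hw, hne⟩ := hother k v hv
    obtain ⟨w', hw', hne'⟩ := hother j v' hv'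
    have h1 := hcross k j hkj v hv w hw v' hv' w' hw'
    have h2 : ∀ i, (v i - w i) * (v' i - w' i) =
        (v i - w i) * (Pi.single (s j v') (ε j) : ι → ℤ) i -
          (v i - w i) * (Pi.single (s j w') (ε j) : ι → ℤ) i := by
      intro i
      rw [congrFun (hs j v' hv') i, congrFun (hs j w' hw') i]
      simp only [Pi.add_apply]
      ring
    simp_rw [h2] at h1
    rw [Finset.sum_sub_distrib, sum_mul_single_eq, sum_mul_single_eq, ← sub_mul] at h1
    have h3 := (mul_eq_zero.mp h1).resolve_right (hε0 j)
    rw [congrFun (hs k v hv), congrFun (hs k w hw), congrFun (hs k v hv), congrFun (hs k w hw),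
      heq] at h3
    rw [heq] at hne
    simp only [Pi.add_apply, Pi.single_eq_same] at h3
    rw [Pi.single_eq_of_ne hne.symm, Pi.single_eq_of_ne hne'] at h3
    by_cases h4 : s k w = s j w'
    · rw [h4, Pi.single_eq_same] at h3
      exact hε0 k (by linarith)
    · rw [Pi.single_eq_of_ne (Ne.symm h4)] at h3
      exact hε0 k (by linarith)
  let S : κ → Finset ι := fun k => (V k).image (s k)
  have hS : ∀ k a, a ∈ S k ↔ ∃ v ∈ V k, s k v = a := fun k a => Finset.mem_image
  have hScard : ∀ k, (S k).card = (V k).card := fun k => Finset.card_image_of_injOn (hinj k)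
  have hnot : ∀ k j a, k ≠ j → a ∈ S k → a ∉ S j := by
    intro k j a hkj ha ha'
    obtain ⟨v, hv, rfl⟩ := (hS k a).mp ha
    obtain ⟨v', hv', h1⟩ := (hS j _).mp ha'
    exact hdisj k j hkj v hv v' hv' h1.symm
  have hpd : Set.PairwiseDisjoint (Finset.univ : Finset κ) S := by
    intro k _ j _ hkj
    exact Finset.disjoint_left.mpr fun a ha => hnot k j a hkj ha
  have hi0 : i₀ ∉ Finset.univ.biUnion S := by
    rw [Finset.mem_biUnion]
    rintro ⟨k, _, hk⟩
    obtain ⟨v, hv, h1⟩ := (hS k _).mp hk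
    exact hu0 k v hv h1
  have huniv : insert i₀ (Finset.univ.biUnion S) = Finset.univ := by
    rw [← Finset.card_eq_iff_eq_univ, Finset.card_insert_of_notMem hi0,
      Finset.card_biUnion fun k _ j _ hkj => hpd (Finset.mem_coe.mpr (Finset.mem_univ k))
        (Finset.mem_coe.mpr (Finset.mem_univ j)) hkj, hι, add_comm]
    simp_rw [hScard]
  refine ⟨u, ε, S, hε, ?_, ?_, hScard, ?_, hnot, ?_⟩
  · exact fun k v hv => ⟨s k v, (hS k _).mpr ⟨v, hv, rfl⟩, hs k v hv⟩
  · intro k a ha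
    obtain ⟨v, hv, rfl⟩ := (hS k a).mp ha
    rw [← hs k v hv]
    exact hv
  · intro k
    obtain ⟨v, hv⟩ := Finset.card_pos.mp (lt_of_lt_of_le two_pos (hcard k))
    have h1 := hzero k v hv
    rw [hs k v hv] at h1
    simpa [Pi.single_eq_of_ne (hu0 k v hv).symm] using h1
  · intro F
    rw [← huniv, Finset.sum_insert hi0, Finset.sum_biUnion hpd]

variable {u : κ → ι → ℤ} {ε : κ → ℤ} {S : κ → Finset ι}

theorem IsCoherent.row_term (hS : IsCoherent i₀ V u ε S) (hcard : ∀ k, (V k).card * e k + 1 = h k)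
    (he : ∀ k, 0 < e k) {k : κ} {a : ι} (ha : a ∉ S k) :
    ((h k : ℚ) * ((τ k a : ℚ) ^ 2 + e k * ∑ v ∈ V k, (v a : ℚ) ^ 2) -
      ((τ k a : ℚ) + e k * ∑ v ∈ V k, (v a : ℚ)) ^ 2) / (h k * e k) =
    ((τ k a - u k a : ℤ) : ℚ) ^ 2 * ((V k).card / h k) := by
  have h1 : ∀ v ∈ V k, v a = u k a := by
    intro v hv
    obtain ⟨b, hb, rfl⟩ := hS.exists_eq k v hv
    have : a ≠ b := fun h => ha (h ▸ hb)
    simp [Pi.single_eq_of_ne this]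
  have hs1 : ∑ v ∈ V k, (v a : ℚ) ^ 2 = (V k).card * (u k a : ℚ) ^ 2 := by
    rw [Finset.sum_congr rfl fun v hv => by rw [h1 v hv], Finset.sum_const, nsmul_eq_mul]
  have hs2 : ∑ v ∈ V k, (v a : ℚ) = (V k).card * (u k a : ℚ) := by
    rw [Finset.sum_congr rfl fun v hv => by rw [h1 v hv], Finset.sum_const, nsmul_eq_mul]
  rw [hs1, hs2]
  have h2 : (h k : ℚ) = (V k).card * e k + 1 := by rw [← hcard k]; push_cast; ring
  have h3 : (e k : ℚ) ≠ 0 := by exact_mod_cast (he k).ne'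
  have h4 : ((V k).card * e k + 1 : ℚ) ≠ 0 := by positivity
  rw [h2]
  push_cast
  field_simp
  ring

theorem IsCoherent.row_term_self (hS : IsCoherent i₀ V u ε S)
    (hcard : ∀ k, (V k).card * e k + 1 = h k)
    (he : ∀ k, 0 < e k) {k : κ} {a : ι} (ha : a ∈ S k) :
    ((h k : ℚ) * ((τ k a : ℚ) ^ 2 + e k * ∑ v ∈ V k, (v a : ℚ) ^ 2) -
      ((τ k a : ℚ) + e k * ∑ v ∈ V k, (v a : ℚ)) ^ 2) / (h k * e k) =
    1 + ((V k).card * ((τ k a - u k a : ℤ) : ℚ) ^ 2 - e k - 2 * ε k * (τ k a - u k a : ℤ)) /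
      h k := by
  have hmem := hS.mem k a ha
  have h1 : ∀ v ∈ (V k).erase (u k + Pi.single a (ε k)), v a = u k a := by
    intro v hv
    rw [Finset.mem_erase] at hv
    obtain ⟨b, hb, rfl⟩ := hS.exists_eq k v hv.2
    have : a ≠ b := fun h => hv.1 (by rw [h])
    simp [Pi.single_eq_of_ne this]
  have hε : (ε k : ℚ) ^ 2 = 1 := by rcases hS.sign k with h | h <;> simp [h]
  have hs1 : ∑ v ∈ (V k).erase (u k + Pi.single a (ε k)), (v a : ℚ) ^ 2 =
      ((V k).card - 1 : ℕ) * (u k a : ℚ) ^ 2 := by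
    rw [Finset.sum_congr rfl fun v hv => by rw [h1 v hv], Finset.sum_const, nsmul_eq_mul,
      Finset.card_erase_of_mem hmem]
  have hs2 : ∑ v ∈ (V k).erase (u k + Pi.single a (ε k)), (v a : ℚ) =
      ((V k).card - 1 : ℕ) * (u k a : ℚ) := by
    rw [Finset.sum_congr rfl fun v hv => by rw [h1 v hv], Finset.sum_const, nsmul_eq_mul,
      Finset.card_erase_of_mem hmem]
  rw [← Finset.add_sum_erase _ _ hmem, ← Finset.add_sum_erase _ _ hmem, hs1, hs2]
  have h5 : 1 ≤ (V k).card := Finset.card_pos.mpr ⟨_, hmem⟩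
  have h2 : (h k : ℚ) = (V k).card * e k + 1 := by rw [← hcard k]; push_cast; ring
  have h3 : (e k : ℚ) ≠ 0 := by exact_mod_cast (he k).ne'
  have h4 : ((V k).card * e k + 1 : ℚ) ≠ 0 := by positivity
  rw [h2]
  push_cast [Nat.cast_sub h5, Pi.add_apply, Pi.single_eq_same]
  field_simp
  have h6 : (ε k : ℚ) ^ 2 = 1 := hε
  generalize (ε k : ℚ) = E at *
  generalize ((V k).card : ℚ) = W at *
  generalize (e k : ℚ) = q at *
  generalize (u k a : ℚ) = U at *
  generalize (τ k a : ℚ) = T at *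
  linear_combination (q * (W * q + 1) - q ^ 2) * h6

end CoherentFamilies

section LatticeContradiction

variable {ι κ : Type*} [Fintype ι] [DecidableEq ι] [Fintype κ] {i₀ : ι}
  {d : ι → ℤ} {h e : κ → ℕ} {τ : κ → ι → ℤ} {V : κ → Finset (ι → ℤ)} {g : ℕ}
  {u : κ → ι → ℤ} {ε : κ → ℤ} {S : κ → Finset ι}

theorem IsCoherent.apply_eq_of_ne (hS : IsCoherent i₀ V u ε S)
    (hcross : ∀ k j, k ≠ j → ∀ v ∈ V k, ∀ v' ∈ V j, ∀ w' ∈ V j,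
      ∑ i, (τ k i - v i) * (v' i - w' i) = 0) {k j : κ} (hkj : k ≠ j) (hV : (V k).Nonempty)
    {a b : ι} (ha : a ∈ S j) (hb : b ∈ S j) : τ k a - u k a = τ k b - u k b := by
  obtain ⟨v, hv⟩ := hV
  have hε : ε j ≠ 0 := by rcases hS.sign j with h | h <;> simp [h]
  have h1 := hcross k j hkj v hv _ (hS.mem j a ha) _ (hS.mem j b hb)
  have h2 : ∀ i, (τ k i - v i) * ((u j + Pi.single a (ε j) : ι → ℤ) i -
      (u j + Pi.single b (ε j) : ι → ℤ) i) =
      (τ k i - v i) * (Pi.single a (ε j) : ι → ℤ) i -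
        (τ k i - v i) * (Pi.single b (ε j) : ι → ℤ) i := by
    intro i
    simp only [Pi.add_apply]
    ring
  simp_rw [h2] at h1
  rw [Finset.sum_sub_distrib, sum_mul_single_eq (fun i => τ k i - v i),
    sum_mul_single_eq (fun i => τ k i - v i), ← sub_mul] at h1
  have h3 := (mul_eq_zero.mp h1).resolve_right hε
  obtain ⟨t, ht, rfl⟩ := hS.exists_eq k v hv
  have hat : a ≠ t := fun h => hS.notMem k j t hkj ht (h ▸ ha)
  have hbt : b ≠ t := fun h => hS.notMem k j t hkj ht (h ▸ hb)
  simp only [Pi.add_apply, Pi.single_eq_of_ne hat, Pi.single_eq_of_ne hbt, add_zero] at h3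
  linarith

theorem IsCoherent.sum_sq_eq (hS : IsCoherent i₀ V u ε S)
    (hleft : ∀ k, ∀ v ∈ V k, ∑ i, (τ k i - v i) ^ 2 = e k + 1) {k : κ} {a : ι} (ha : a ∈ S k) :
    ∑ i, (τ k i - u k i) ^ 2 = e k + 2 * ε k * (τ k a - u k a) := by
  have h1 := hleft k _ (hS.mem k a ha)
  have h2 : ∀ i, (τ k i - (u k + Pi.single a (ε k) : ι → ℤ) i) ^ 2 = (τ k i - u k i) ^ 2 -
      2 * ((τ k i - u k i) * (Pi.single a (ε k) : ι → ℤ) i) +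
        (Pi.single a (ε k) : ι → ℤ) i * (Pi.single a (ε k) : ι → ℤ) i := by
    intro i
    simp only [Pi.add_apply]
    ring
  simp_rw [h2] at h1
  rw [Finset.sum_add_distrib, Finset.sum_sub_distrib, ← Finset.mul_sum,
    sum_mul_single_eq (fun i => τ k i - u k i), sum_mul_single_eq, Pi.single_eq_same] at h1
  have h3 : ε k * ε k = 1 := by rcases hS.sign k with h | h <;> simp [h]
  rw [h3] at h1
  linear_combination h1

theorem IsCoherent.sum_mul_eq (hS : IsCoherent i₀ V u ε S)
    (hcross : ∀ k j, k ≠ j → ∀ v ∈ V k, ∀ v' ∈ V j,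
      ∑ i, (τ k i - v i) * (τ j i - v' i) = 0) {k j : κ} (hkj : k ≠ j)
    {a b : ι} (ha : a ∈ S k) (hb : b ∈ S j) :
    ∑ i, (τ k i - u k i) * (τ j i - u j i) =
      (τ k b - u k b) * ε j + (τ j a - u j a) * ε k := by
  have h1 := hcross k j hkj _ (hS.mem k a ha) _ (hS.mem j b hb)
  have hab : a ≠ b := fun h => hS.notMem k j a hkj ha (h ▸ hb)
  have h2 : ∀ i, (τ k i - (u k + Pi.single a (ε k) : ι → ℤ) i) *
      (τ j i - (u j + Pi.single b (ε j) : ι → ℤ) i) =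
      (τ k i - u k i) * (τ j i - u j i) - (τ k i - u k i) * (Pi.single b (ε j) : ι → ℤ) i -
      (τ j i - u j i) * (Pi.single a (ε k) : ι → ℤ) i +
        (Pi.single a (ε k) : ι → ℤ) i * (Pi.single b (ε j) : ι → ℤ) i := by
    intro i
    simp only [Pi.add_apply]
    ring
  simp_rw [h2] at h1
  rw [Finset.sum_add_distrib, Finset.sum_sub_distrib, Finset.sum_sub_distrib,
    sum_mul_single_eq (fun i => τ k i - u k i), sum_mul_single_eq (fun i => τ j i - u j i),
    sum_mul_single_eq, Pi.single_eq_of_ne hab.symm] at h1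
  linear_combination h1

theorem false_of_characterFamilies [Nonempty κ] (hd : ∀ i, 0 < d i)
    (hcard : ∀ k, (V k).card * e k + 1 = h k)
    (hsq : ∀ k, ∀ v ∈ V k, ∀ w ∈ V k, v ≠ w → ∑ i, (v i - w i) ^ 2 = 2)
    (hleft : ∀ k, ∀ v ∈ V k, ∑ i, (τ k i - v i) ^ 2 = e k + 1)
    (horth : ∀ k, ∀ v ∈ V k, ∀ w ∈ V k, ∑ i, (v i - w i) * d i = 0)
    (hcross : ∀ k j, k ≠ j → ∀ v v' w w' : ι → ℤ, v ∈ insert (τ k) (V k : Set (ι → ℤ)) →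
      v' ∈ insert (τ k) (V k : Set (ι → ℤ)) → w ∈ insert (τ j) (V j : Set (ι → ℤ)) →
      w' ∈ insert (τ j) (V j : Set (ι → ℤ)) → ∑ i, (v i - v' i) * (w i - w' i) = 0)
    (hone : ∀ k, τ k i₀ = 1) (hzero : ∀ k, ∀ v ∈ V k, v i₀ = 0)
    (hι : Fintype.card ι = 1 + ∑ k, (V k).card)
    (hrow : ∀ i, ∑ k, ((h k : ℚ) * ((τ k i : ℚ) ^ 2 + e k * ∑ v ∈ V k, (v i : ℚ) ^ 2) -
      ((τ k i : ℚ) + e k * ∑ v ∈ V k, (v i : ℚ)) ^ 2) / (h k * e k) ≤ 1)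
    (he : ∀ k, 3 ≤ e k) (hodd : ∀ k, Odd (e k)) (hw : ∀ k, 2 ≤ (V k).card)
    (heven : ∀ k, Even (V k).card) (hinj : Function.Injective h) (hg : ∀ k, e k * h k ≤ g)
    (hsum : ∑ k, ((V k).card / h k : ℚ) = 1 - 1 / g) : False := by
  classical
  have hV : ∀ k, (V k).Nonempty := fun k => Finset.card_pos.mp (lt_of_lt_of_le two_pos (hw k))
  have : Nonempty ι := ⟨i₀⟩
  obtain ⟨u, ε, S, hS⟩ := exists_isCoherent hd hw hsq horth
    (fun k j hkj v hv w hw v' hv' w' hw' => hcross k j hkj v w v' w' (Or.inr hv) (Or.inr hw)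
      (Or.inr hv') (Or.inr hw')) hzero hι
  have hne : ∀ k, (S k).Nonempty := fun k => Finset.card_pos.mp
    (by rw [hS.card]; exact lt_of_lt_of_le two_pos (hw k))
  choose r hr using hne
  let c : κ → κ → ℤ := fun j k => τ k (r j) - u k (r j)
  have hε0 : ∀ k, ε k ≠ 0 := fun k => by rcases hS.sign k with h | h <;> simp [h]
  have hc : ∀ j k, ∀ a ∈ S j, τ k a - u k a = c j k := by
    intro j k a ha
    rcases eq_or_ne k j with rfl | hkj
    · have h1 := hS.sum_sq_eq hleft ha
      rw [hS.sum_sq_eq hleft (hr k)] at h1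
      exact mul_left_cancel₀ (mul_ne_zero two_ne_zero (hε0 k)) (add_left_cancel h1.symm)
    · exact hS.apply_eq_of_ne (fun k j hkj v hv v' hv' w' hw' => hcross k j hkj _ _ _ _
        (Or.inl rfl) (Or.inr hv) (Or.inr hv') (Or.inr hw')) hkj (hV k) ha (hr j)
  have hβ0 : ∀ k, τ k i₀ - u k i₀ = 1 := fun k => by rw [hone, hS.apply_eq_zero, sub_zero]
  have hsqc : ∀ k, 1 + ∑ j, ((V j).card : ℤ) * c j k ^ 2 = e k + 2 * ε k * c k k := by
    intro k
    rw [← hS.sum_sq_eq hleft (hr k), hS.sum_eq fun i => (τ k i - u k i) ^ 2, hβ0, one_pow]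
    congr 1
    refine Finset.sum_congr rfl fun j _ => ?_
    rw [Finset.sum_congr rfl fun a ha => by rw [hc j k a ha], Finset.sum_const, hS.card,
      nsmul_eq_mul]
  have hdiag : ∀ k, 0 ≤ ((V k).card : ℤ) * c k k ^ 2 - 2 * ε k * c k k := by
    intro k
    have h2 : (2 : ℤ) ≤ (V k).card := by exact_mod_cast hw k
    have h3 : 0 ≤ c k k ^ 2 - ε k * c k k := by
      rcases hS.sign k with h | h <;> rw [h]
      · rcases le_or_gt (c k k) 0 with h4 | h4 <;> nlinarith
      · rcases le_or_gt 0 (c k k) with h4 | h4 <;> nlinarith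
    nlinarith [sq_nonneg (c k k)]
  refine false_of_multiplicities (w := fun k => (V k).card) (c := c) hcard he hodd hw heven hinj hg
    hsum ?_ ?_ ?_
  · intro k j hkj
    by_contra! h0
    have h1 := hS.sum_mul_eq (fun k j hkj v hv v' hv' => hcross k j hkj _ _ _ _
        (Or.inl rfl) (Or.inr hv) (Or.inl rfl) (Or.inr hv')) hkj (hr k) (hr j)
    have h2 : τ k (r j) - u k (r j) = 0 := h0.2
    have h3 : τ j (r k) - u j (r k) = 0 := h0.1
    rw [h2, h3, hS.sum_eq fun i => (τ k i - u k i) * (τ j i - u j i), hβ0, hβ0] at h1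
    have h4 : Even (∑ l, ∑ a ∈ S l, (τ k a - u k a) * (τ j a - u j a)) := by
      refine Finset.even_sum _ fun l _ => ?_
      rw [Finset.sum_congr rfl fun a ha => by rw [hc l k a ha, hc l j a ha], Finset.sum_const,
        hS.card, nsmul_eq_mul]
      exact ((Int.even_coe_nat _).mpr (heven l)).mul_right _
    obtain ⟨m, hm⟩ := h4
    omega
  · intro j
    have h1 := hrow (r j)
    have he0 : ∀ k, 0 < e k := fun k => lt_of_lt_of_le three_pos (he k)
    rw [← Finset.add_sum_erase _ _ (Finset.mem_univ j), hS.row_term_self hcard he0 (hr j),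
      Finset.sum_congr rfl fun k hk => hS.row_term hcard he0
        (hS.notMem j k _ (Finset.mem_erase.mp hk).1.symm (hr j))] at h1
    have h2 : (0 : ℚ) ≤ (V j).card * (c j j : ℚ) ^ 2 - 2 * ε j * c j j := by
      exact_mod_cast hdiag j
    have h3 : -(e j / h j : ℚ) ≤ ((V j).card * (c j j : ℚ) ^ 2 - e j - 2 * ε j * c j j) / h j := by
      rw [← neg_div]
      exact div_le_div_of_nonneg_right (by linarith) (Nat.cast_nonneg _)
    linarith
  · intro k
    have h1 := hsqc k
    have h2 := hdiag k
    rw [← Finset.add_sum_erase _ _ (Finset.mem_univ k)] at h1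
    linarith

end LatticeContradiction

section ClassFunctionSums

variable {G : Type*} [Group G] [Fintype G] [DecidableEq G] {p q : ℕ} {P : Subgroup G} {x : G}

theorem IsFrobeniusSylow.card_conj_mem {G : Type*} [Group G] [Finite G] {p q : ℕ}
    {P : Subgroup G} {x : G} (h : IsFrobeniusSylow p q P x) {y : G}
    (hy : orderOf y = p) : Nat.card {g : G // g⁻¹ * y * g ∈ P} = Nat.card P * q := by
  have hy1 : y ≠ 1 := fun h1 => h.prime_p.one_lt.ne (by rw [← hy, h1, orderOf_one])
  obtain ⟨g₀, a, ⟨ha, ha1⟩, rfl⟩ := h.mem_conjSet (n := 1) hy1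
    (by rw [pow_one, ← hy, pow_orderOf_eq_one])
  rw [← h.card_normalizer]
  refine Nat.card_congr (Equiv.subtypeEquiv (Equiv.mulLeft g₀⁻¹) fun g => ?_)
  rw [Equiv.coe_mulLeft]
  have e : g⁻¹ * (g₀ * a * g₀⁻¹) * g = (g₀⁻¹ * g)⁻¹ * a * (g₀⁻¹ * g)⁻¹⁻¹ := by group
  rw [e]
  constructor
  · intro h1
    exact (Subgroup.inv_mem_iff _).mp (h.mem_normalizer a ha ha1 _ h1)
  · intro h1
    exact (Subgroup.mem_normalizer_iff.mp (inv_mem h1) a).mp ha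

theorem IsFrobeniusSylow.sum_orderOf (h : IsFrobeniusSylow p q P x) {f : G → ℂ}
    (hf : ∀ y g, f (g * y * g⁻¹) = f y) :
    (Nat.card P * q : ℂ) * ∑ y : G with orderOf y = p, f y =
      Nat.card G * (∑ᶠ a : P, f a - f 1) := by
  classical
  have h1 : ∑ᶠ a : P, f a - f 1 = ∑ y : G with y ∈ P ∧ y ≠ 1, f y := by
    have e : (Finset.univ.filter fun y : G => y ∈ P ∧ y ≠ 1) =
        (Finset.univ.filter fun y : G => y ∈ P).erase 1 := by
      ext y; simp [and_comm]
    rw [e, finsum_eq_sum_of_fintype, sub_eq_iff_eq_add,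
      Finset.sum_erase_add _ _ (by simp),
      ← Finset.sum_subtype_eq_sum_filter]
    simp only [Finset.subtype_univ]
  rw [h1]
  have h2 : ∀ g : G, ∑ y : G with y ∈ P ∧ y ≠ 1, f y =
      ∑ y : G with orderOf y = p, if g⁻¹ * y * g ∈ P then f y else 0 := by
    intro g
    rw [← Finset.sum_filter, Finset.filter_filter]
    refine Finset.sum_bij' (fun y _ => g * y * g⁻¹) (fun y _ => g⁻¹ * y * g) ?_ ?_ ?_ ?_ ?_
    · intro y hy
      simp only [Finset.mem_filter, Finset.mem_univ, true_and] at hy ⊢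
      refine ⟨?_, ?_⟩
      · rw [← h.orderOf_eq_of_mem hy.1 hy.2]
        exact orderOf_injective (MulAut.conj g).toMonoidHom (MulAut.conj g).injective y
      · simpa [mul_assoc] using hy.1
    · intro y hy
      simp only [Finset.mem_filter, Finset.mem_univ, true_and] at hy ⊢
      refine ⟨hy.2, fun h3 => ?_⟩
      have h4 : y = 1 := by
        have : y = g * (g⁻¹ * y * g) * g⁻¹ := by group
        rw [this, h3]; group
      rw [h4, orderOf_one] at hy
      exact h.prime_p.one_lt.ne hy.1
    · intro y _; group
    · intro y _; group
    · intro y _; exact (hf y g).symm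
  have h3 : (Nat.card G : ℂ) * ∑ y : G with y ∈ P ∧ y ≠ 1, f y =
      ∑ g : G, ∑ y : G with orderOf y = p, if g⁻¹ * y * g ∈ P then f y else 0 := by
    rw [← Finset.sum_congr rfl fun g _ => h2 g, Finset.sum_const, Finset.card_univ,
      nsmul_eq_mul, Nat.card_eq_fintype_card]
  rw [h3, Finset.sum_comm, Finset.mul_sum]
  refine Finset.sum_congr rfl fun y hy => ?_
  rw [← Finset.sum_filter, Finset.sum_const, nsmul_eq_mul]
  have h4 := h.card_conj_mem (Finset.mem_filter.mp hy).2
  rw [Nat.card_eq_fintype_card, Fintype.card_subtype] at h4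
  rw [h4]
  push_cast
  rfl

theorem SylowFrobenius.sum_eq (hF : SylowFrobenius G) (f : G → ℂ) :
    ∑ y, f y = f 1 + ∑ p : (Nat.card G).primeFactors, ∑ y : G with orderOf y = p, f y := by
  rw [← Finset.add_sum_erase _ _ (Finset.mem_univ (1 : G)), Finset.sum_coe_sort
    (Nat.card G).primeFactors fun p => ∑ y : G with orderOf y = p, f y]
  congr 1
  have hp1 : ∀ p ∈ (Nat.card G).primeFactors, p ≠ 1 := fun p hp =>
    (Nat.prime_of_mem_primeFactors hp).ne_one
  rw [← Finset.sum_fiberwise_of_maps_to (s := Finset.univ.erase (1 : G))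
    (t := (Nat.card G).primeFactors) (g := orderOf)]
  · refine Finset.sum_congr rfl fun p hp => Finset.sum_congr ?_ fun _ _ => rfl
    ext y
    simp only [Finset.mem_filter, Finset.mem_erase, Finset.mem_univ, and_true, true_and,
      and_iff_right_iff_imp]
    rintro rfl rfl
    exact hp1 _ hp orderOf_one
  · intro y hy
    obtain ⟨p, q, P, x, h, hyP⟩ := hF.exists_mem (Finset.mem_erase.mp hy).1
    have h1 := h.orderOf_eq_of_mem hyP (Finset.mem_erase.mp hy).1
    rw [Nat.mem_primeFactors]
    exact ⟨h1 ▸ h.prime_p, orderOf_dvd_natCard y, Nat.card_pos.ne'⟩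

theorem IsFrobeniusSylow.card_centralizer (h : IsFrobeniusSylow p q P x) {y : G}
    (hy : orderOf y = p) : (Finset.univ.filter fun g : G => y * g * y⁻¹ = g).card = Nat.card P := by
  have hy1 : y ≠ 1 := fun h1 => h.prime_p.one_lt.ne (by rw [← hy, h1, orderOf_one])
  obtain ⟨g₀, a, ⟨ha, ha1⟩, rfl⟩ := h.mem_conjSet (n := 1) hy1
    (by rw [pow_one, ← hy, pow_orderOf_eq_one])
  rw [← Fintype.card_subtype, ← Nat.card_eq_fintype_card]
  refine Nat.card_congr (Equiv.subtypeEquiv (MulAut.conj g₀⁻¹).toEquiv fun g => ?_)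
  have e : g = g₀ * (g₀⁻¹ * g * g₀) * g₀⁻¹ := by group
  change _ ↔ g₀⁻¹ * g * g₀⁻¹⁻¹ ∈ P
  rw [inv_inv]
  constructor
  · intro h1
    refine h.mem_of_commute ha ha1 ?_
    rw [mul_inv_eq_iff_eq_mul] at h1
    calc g₀⁻¹ * g * g₀ * a = g₀⁻¹ * (g * (g₀ * a * g₀⁻¹)) * g₀ := by group
      _ = a * (g₀⁻¹ * g * g₀) := by rw [← h1]; group
  · intro h1
    have h2 := h.commute ha h1
    rw [mul_inv_eq_iff_eq_mul, e]
    calc _ = g₀ * (a * (g₀⁻¹ * g * g₀)) * g₀⁻¹ := by group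
      _ = _ := by rw [h2.eq]; group

end ClassFunctionSums

section OddOrder

variable {G : Type*} [Group G] [Fintype G] [DecidableEq G] {n : ℕ} {χ : Fin n → G → ℂ}

theorem IsCharacterTable.exists_eq_one (hχ : IsCharacterTable G χ) : ∃ i, ∀ g, χ i g = 1 := by
  choose m hm using fun i => hχ.exists_mul_sum i ⊤ 1
  have hG : (Fintype.card G : ℂ) ≠ 0 := Nat.cast_ne_zero.mpr Fintype.card_ne_zero
  have h1 : ∀ i, ∑ x, χ i x = Fintype.card G * m i := by
    intro i
    have : Fintype (⊤ : Subgroup G) := Fintype.ofFinite _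
    have h2 := hm i
    rw [Subgroup.card_top, Nat.card_eq_fintype_card, finsum_eq_sum_of_fintype] at h2
    rw [← h2]
    refine Fintype.sum_equiv Subgroup.topEquiv.symm.toEquiv _ _ fun x => ?_
    simp
  have h2 : ∀ y, ∑ i, (m i : ℂ) * χ i y = 1 := by
    intro y
    refine mul_left_cancel₀ hG ?_
    rw [Finset.mul_sum, mul_one]
    calc ∑ i, (Fintype.card G : ℂ) * (m i * χ i y) = ∑ i, ∑ x, χ i x * χ i y := by
          refine Finset.sum_congr rfl fun i _ => ?_
          rw [← Finset.sum_mul, h1]; ring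
      _ = ∑ x, ∑ g : G, if x * g * y = g then (1 : ℂ) else 0 := by
          rw [Finset.sum_comm]
          refine Finset.sum_congr rfl fun x _ => ?_
          rw [hχ.sum_mul, Finset.sum_boole]
      _ = Fintype.card G := by
          rw [Finset.sum_comm]
          have h3 : ∀ g x : G, x * g * y = g ↔ x = g * (g * y)⁻¹ := fun g x => by
            rw [mul_assoc, eq_mul_inv_iff_mul_eq]
          simp [h3]
  have h3 : ∑ i, (m i : ℂ) * m i = 1 := by
    refine mul_left_cancel₀ hG ?_
    rw [Finset.mul_sum, mul_one]
    calc ∑ i, (Fintype.card G : ℂ) * (m i * m i) = ∑ i, ∑ x, (m i : ℂ) * χ i x := by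
          refine Finset.sum_congr rfl fun i _ => ?_
          rw [← Finset.mul_sum, h1]; ring
      _ = Fintype.card G := by
          rw [Finset.sum_comm, Finset.sum_congr rfl fun x _ => h2 x]; simp
  have h4 : ∑ i, m i * m i = 1 := by exact_mod_cast h3
  obtain ⟨i, -, hi⟩ : ∃ i ∈ Finset.univ, m i * m i ≠ 0 :=
    Finset.exists_ne_zero_of_sum_ne_zero (by rw [h4]; exact one_ne_zero)
  rw [← Finset.add_sum_erase _ _ (Finset.mem_univ i)] at h4
  have h5 : ∑ j ∈ Finset.univ.erase i, m j * m j = 0 := by omega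
  have h6 : m i = 1 := by
    rw [h5, add_zero] at h4
    exact Nat.eq_one_of_mul_eq_one_left h4
  rw [Finset.sum_eq_zero_iff] at h5
  refine ⟨i, fun g => ?_⟩
  rw [← h2 g, ← Finset.add_sum_erase _ _ (Finset.mem_univ i), h6, Finset.sum_eq_zero]
  · simp
  · intro j hj
    rw [mul_self_eq_zero.mp (h5 j hj), Nat.cast_zero, zero_mul]

theorem IsCharacterTable.sum_card_centralizer (hχ : IsCharacterTable G χ) :
    ∑ x : G, (Finset.univ.filter fun g : G => x * g * x⁻¹ = g).card = n * Fintype.card G := by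
  have h1 : ∑ x : G, ((Finset.univ.filter fun g : G => x * g * x⁻¹ = g).card : ℂ) =
      n * Fintype.card G := by
    rw [← Finset.sum_congr rfl fun x _ => hχ.sum_mul x x⁻¹, Finset.sum_comm,
      Finset.sum_congr rfl fun i _ => hχ.sum_mul_inv i]
    simp
  exact_mod_cast h1

theorem charSum_bot {G : Type*} [Group G] {n : ℕ} {χ : Fin n → G → ℂ} (i : Fin n) :
    charSum χ ⊥ 1 i = χ i 1 := by
  rw [charSum, finsum_eq_single _ (1 : (⊥ : Subgroup G))]
  · simp
  · intro a ha
    exact (ha (Subsingleton.elim _ _)).elim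

variable {p q : ℕ} {P : Subgroup G} {x : G} {τ : Fin n → ℤ} {V : Finset (Fin n → ℤ)}

theorem IsCharacterFamily.exists_charSum {G : Type*} [Group G] [Fintype G] {n : ℕ}
    {χ : Fin n → G → ℂ} {P : Subgroup G} {q : ℕ} {τ : Fin n → ℤ} {V : Finset (Fin n → ℤ)}
    (hV : IsCharacterFamily χ P q τ V) {v : Fin n → ℤ}
    (hv : v ∈ insert τ (V : Set (Fin n → ℤ))) :
    ∃ l : P →* ℂˣ, ∀ i, charSum χ P l i = Nat.card P * v i := by
  rcases hv with rfl | hv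
  exacts [hV.exists_left, hV.exists_mem v hv]

theorem IsCharacterFamily.sum_mul_of_disjoint (hχ : IsCharacterTable G χ) {P' : Subgroup G}
    {q' : ℕ} {τ' : Fin n → ℤ} {V' : Finset (Fin n → ℤ)} (hV : IsCharacterFamily χ P q τ V)
    (hV' : IsCharacterFamily χ P' q' τ' V')
    (hdis : ∀ g, ∀ b ∈ P', g * b * g⁻¹ ∈ P → b = 1) {v w : Fin n → ℤ}
    (hv : v ∈ insert τ (V : Set (Fin n → ℤ))) (hw : w ∈ insert τ' (V' : Set (Fin n → ℤ))) :
    (Nat.card P * Nat.card P' : ℤ) * ∑ i, v i * w i = Fintype.card G := by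
  obtain ⟨l, hl⟩ := hV.exists_charSum hv
  obtain ⟨l', hl'⟩ := hV'.exists_charSum hw
  have h1 := hχ.sum_charSum_mul_of_disjoint P P' hdis l l'
  simp_rw [hl, hl'] at h1
  have h2 : (Nat.card P * Nat.card P' : ℂ) * ∑ i, (v i : ℂ) * w i = Fintype.card G := by
    rw [← h1, Finset.mul_sum]
    exact Finset.sum_congr rfl fun i _ => by ring
  exact_mod_cast h2

theorem IsCharacterFamily.sum_mul_degree (hχ : IsCharacterTable G χ)
    (hV : IsCharacterFamily χ P q τ V) {d : Fin n → ℤ} (hd : ∀ i, χ i 1 = d i) {v : Fin n → ℤ}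
    (hv : v ∈ insert τ (V : Set (Fin n → ℤ))) :
    (Nat.card P : ℤ) * ∑ i, v i * d i = Fintype.card G := by
  obtain ⟨l, hl⟩ := hV.exists_charSum hv
  have h1 := hχ.sum_charSum_mul_of_disjoint P ⊥ (fun _ _ hb _ => hb) l 1
  simp_rw [hl, charSum_bot, hd] at h1
  have h2 : (Nat.card P : ℂ) * ∑ i, (v i : ℂ) * d i = Fintype.card G := by
    rw [← h1, Finset.mul_sum]
    exact Finset.sum_congr rfl fun i _ => by ring
  exact_mod_cast h2

theorem IsCharacterFamily.card_orderOf_mul (hV : IsCharacterFamily χ P q τ V)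
    (h : IsFrobeniusSylow p q P x) :
    (Finset.univ.filter fun y : G => orderOf y = p).card * Nat.card P = Fintype.card G *
      V.card := by
  have h1 := h.mul_card_orderOf
  rw [← hV.card_mul, Nat.add_sub_cancel, Nat.card_eq_fintype_card] at h1
  rw [← hV.card_mul]
  refine Nat.eq_of_mul_eq_mul_right h.prime_q.pos ?_
  linarith

theorem IsCharacterFamily.sum_orderOf_mul (hχ : IsCharacterTable G χ)
    (hV : IsCharacterFamily χ P q τ V) (h : IsFrobeniusSylow p q P x) (i : Fin n) :
    (Nat.card P * q : ℂ) * ∑ y : G with orderOf y = p, χ i y * χ i y⁻¹ =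
      Fintype.card G * (Nat.card P * ((τ i : ℂ) ^ 2 + q * ∑ v ∈ V, (v i : ℂ) ^ 2) -
        (τ i + q * ∑ v ∈ V, (v i : ℂ)) ^ 2) := by
  have h1 := h.sum_orderOf (f := fun y => χ i y * χ i y⁻¹) (fun y g => by
    rw [hχ.conj]
    congr 1
    rw [← hχ.conj i y⁻¹ g]
    group)
  rw [h1, ← hV.sum_mul_inv, ← hV.degree, inv_one, Nat.card_eq_fintype_card, sq]

end OddOrder

section OddOrder

variable {G : Type*} [Group G] [Finite G]

theorem SylowFrobenius.two_dvd_card [Nontrivial G] (hF : SylowFrobenius G) : 2 ∣ Nat.card G := by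
  classical
  have : Fintype G := Fintype.ofFinite G
  by_contra h2
  have hoddG : Odd (Nat.card G) := Nat.odd_iff.mpr (Nat.two_dvd_ne_zero.mp h2)
  obtain ⟨n, χ, hχ⟩ := exists_isCharacterTable G
  have hex : ∀ k : (Nat.card G).primeFactors, ∃ (e : ℕ) (P : Subgroup G) (x : G)
      (τ : Fin n → ℤ) (V : Finset (Fin n → ℤ)), IsFrobeniusSylow k e P x ∧
        IsCharacterFamily χ P e τ V := by
    intro k
    have hk := Nat.mem_primeFactors.mp k.2
    have := Fact.mk hk.1
    let P : Sylow k G := default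
    obtain ⟨e, x, h⟩ := hF k P (P.ne_bot_of_dvd_card hk.2.1)
    obtain ⟨τ, V, hV⟩ := h.exists_isCharacterFamily hχ
    exact ⟨e, P, x, τ, V, h, hV⟩
  choose e P x τ V h hV using hex
  obtain ⟨i₀, hi₀⟩ := hχ.exists_eq_one
  choose d hd0 hd using hχ.exists_degree
  have hg0 : 0 < Nat.card G := Nat.card_pos
  have hgt : Nat.card G = Fintype.card G := Nat.card_eq_fintype_card
  have hP0 : ∀ k, 0 < Nat.card (P k) := fun k => Nat.card_pos
  have hPodd : ∀ k, Odd (Nat.card (P k)) := fun k =>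
    hoddG.of_dvd_nat (Subgroup.card_subgroup_dvd_card _)
  have hNdvd : ∀ k, Nat.card (P k) * e k ∣ Nat.card G := fun k => by
    rw [← (h k).card_normalizer]
    exact Subgroup.card_subgroup_dvd_card _
  have heodd : ∀ k, Odd (e k) := fun k => hoddG.of_dvd_nat ((Dvd.intro_left _ rfl).trans (hNdvd k))
  have he3 : ∀ k, 3 ≤ e k := fun k => by
    have h1 := (h k).prime_q.two_le
    have h3 := heodd k
    rcases h1.lt_or_eq with h4 | h4
    · exact h4
    · rw [← h4] at h3
      exact absurd h3 (by decide)
  have hPpow : ∀ k, ∃ m, m ≠ 0 ∧ Nat.card (P k) = (k : ℕ) ^ m := fun k => by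
    have := Fact.mk (h k).prime_p
    obtain ⟨m, hm⟩ := IsPGroup.iff_card.mp (h k).isSchmidt.isPGroup
    refine ⟨m, ?_, hm⟩
    rintro rfl
    have := (h k).lt_card
    rw [hm, pow_zero] at this
    have := he3 k
    omega
  have hinj : Function.Injective fun k => Nat.card (P k) := by
    intro k j hkj
    obtain ⟨m, hm0, hm⟩ := hPpow k
    obtain ⟨l, hl0, hl⟩ := hPpow j
    have h1 : (k : ℕ) ^ m = (j : ℕ) ^ l := by rw [← hm, ← hl]; exact hkj
    apply Subtype.ext
    refine (Nat.prime_dvd_prime_iff_eq (h k).prime_p (h j).prime_p).mp ?_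
    exact (h k).prime_p.dvd_of_dvd_pow (h1 ▸ dvd_pow_self _ hm0)
  have hweven : ∀ k, Even (V k).card := fun k => by
    have h1 := (hV k).card_mul
    have h3 := hPodd k
    rw [← h1] at h3
    rcases Nat.even_or_odd (V k).card with h4 | h4
    · exact h4
    · exact absurd ((h4.mul (heodd k)).add_odd odd_one) (Nat.not_even_iff_odd.mpr h3)
  have hw2 : ∀ k, 2 ≤ (V k).card := fun k => by
    have h1 := (hV k).card_mul
    have h3 := (h k).lt_card
    have h4 := he3 k
    obtain ⟨m, hm⟩ := hweven k
    rcases Nat.eq_zero_or_pos m with rfl | h5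
    · rw [hm] at h1; omega
    · omega
  have hdis : ∀ k j, k ≠ j → ∀ g, ∀ b ∈ P j, g * b * g⁻¹ ∈ P k → b = 1 := by
    intro k j hkj g b hb hgb
    by_contra hb1
    have h1 := (h j).orderOf_eq_of_mem hb hb1
    have h3 := (h k).orderOf_eq_of_mem hgb (fun h => hb1 (by simpa using h))
    have h4 : orderOf (g * b * g⁻¹) = orderOf b :=
      orderOf_injective (MulAut.conj g).toMonoidHom (MulAut.conj g).injective b
    exact hkj (Subtype.ext (by rw [← h3, h4, h1]))
  have hN : ∀ k : (Nat.card G).primeFactors, (Finset.univ.filter fun y : G => orderOf y = k).card *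
      Nat.card (P k) = Fintype.card G * (V k).card := fun k =>
    (hV k).card_orderOf_mul (h k)
  have hG0 : (Fintype.card G : ℂ) ≠ 0 := by exact_mod_cast Fintype.card_ne_zero
  have hPZ : ∀ k, (Nat.card (P k) : ℤ) ≠ 0 := fun k => by exact_mod_cast (hP0 k).ne'
  have hPC : ∀ k, (Nat.card (P k) : ℂ) ≠ 0 := fun k => by exact_mod_cast (hP0 k).ne'
  have heC : ∀ k, (e k : ℂ) ≠ 0 := fun k => by
    exact_mod_cast (lt_of_lt_of_le three_pos (he3 k)).ne'
  have : Nonempty (Nat.card G).primeFactors :=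
    (Nat.nonempty_primeFactors.mpr Finite.one_lt_card).to_subtype
  refine false_of_characterFamilies (i₀ := i₀) (d := fun i => (d i : ℤ))
    (h := fun k => Nat.card (P k)) (e := e) (τ := τ) (V := V) (g := Nat.card G)
      (κ := (Nat.card G).primeFactors)
    ?_ (fun k => (hV k).card_mul) (fun k => (hV k).sum_sub_sq) (fun k => (hV k).sum_left_sub_sq)
    ?_ ?_ (fun k => (hV k).left_of_eq_one i₀ hi₀) (fun k => (hV k).mem_of_eq_one i₀ hi₀) ?_ ?_
    he3 heodd hw2 hweven hinj ?_ ?_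
  · exact fun i => by exact_mod_cast hd0 i
  · intro k v hv w hw
    refine (mul_eq_zero.mp ?_).resolve_left (hPZ k)
    simp only [sub_mul]
    rw [Finset.sum_sub_distrib, mul_sub,
      (hV k).sum_mul_degree hχ (fun i => by rw [hd]; push_cast; rfl) (Or.inr hv),
      (hV k).sum_mul_degree hχ (fun i => by rw [hd]; push_cast; rfl) (Or.inr hw), sub_self]
  · intro k j hkj v v' w w' hv hv' hw hw'
    refine (mul_eq_zero.mp ?_).resolve_left (mul_ne_zero (hPZ k) (hPZ j))
    have h3 : ∀ i, (v i - v' i) * (w i - w' i) =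
        v i * w i - v i * w' i - (v' i * w i - v' i * w' i) := fun i => by ring
    have h4 := fun v hv w hw =>
      (hV k).sum_mul_of_disjoint hχ (hV j) (hdis k j hkj) (v := v) (w := w) hv hw
    simp only [h3, Finset.sum_sub_distrib, mul_sub, h4 _ hv _ hw, h4 _ hv _ hw', h4 _ hv' _ hw,
      h4 _ hv' _ hw', sub_self]
  · have h3 := hF.sum_eq fun y => ((Finset.univ.filter fun g : G => y * g * y⁻¹ = g).card : ℂ)
    have h4 : ∀ k : (Nat.card G).primeFactors, (∑ y : G with orderOf y = k,
        ((Finset.univ.filter fun g : G => y * g * y⁻¹ = g).card : ℂ)) =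
          Fintype.card G * (V k).card := by
      intro k
      rw [Finset.sum_congr rfl fun y hy => by
        rw [(h k).card_centralizer (Finset.mem_filter.mp hy).2], Finset.sum_const, nsmul_eq_mul]
      exact_mod_cast hN k
    rw [Finset.sum_congr rfl fun k _ => h4 k, ← Nat.cast_sum, hχ.sum_card_centralizer] at h3
    have h5 : (Fintype.card G : ℂ) * n = Fintype.card G * (1 + ∑ k, (V k).card : ℕ) := by
      rw [mul_comm, ← Nat.cast_mul, h3]
      push_cast
      rw [mul_add, mul_one, Finset.mul_sum]
      simp
    rw [Fintype.card_fin]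
    exact_mod_cast mul_left_cancel₀ hG0 h5
  · intro i
    have h3 := hF.sum_eq fun y => χ i y * χ i y⁻¹
    rw [hχ.sum_mul_inv, inv_one, hd] at h3
    have h4 : ∀ k : (Nat.card G).primeFactors, ∑ y : G with orderOf y = k, χ i y * χ i y⁻¹ =
        Fintype.card G * ((Nat.card (P k) * ((τ k i : ℂ) ^ 2 + e k * ∑ v ∈ V k, (v i : ℂ) ^ 2) -
          (τ k i + e k * ∑ v ∈ V k, (v i : ℂ)) ^ 2) / (Nat.card (P k) * e k)) := by
      intro k
      rw [← mul_div_assoc, eq_div_iff (mul_ne_zero (hPC k) (heC k)), mul_comm,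
        (hV k).sum_orderOf_mul hχ (h k)]
    rw [Finset.sum_congr rfl fun k _ => h4 k, ← Finset.mul_sum] at h3
    have h5 : (Fintype.card G : ℚ) = d i * d i + Fintype.card G *
        ∑ k, ((Nat.card (P k) : ℚ) * ((τ k i : ℚ) ^ 2 + e k * ∑ v ∈ V k, (v i : ℚ) ^ 2) -
          (τ k i + e k * ∑ v ∈ V k, (v i : ℚ)) ^ 2) / (Nat.card (P k) * e k) := by
      exact_mod_cast h3
    have h6 : (0 : ℚ) < Fintype.card G := by exact_mod_cast Fintype.card_pos
    refine le_of_mul_le_mul_left ?_ h6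
    nlinarith [mul_self_nonneg (d i : ℚ)]
  · intro k
    rw [mul_comm]
    exact Nat.le_of_dvd hg0 (hNdvd k)
  · have h3 := hF.sum_eq fun _ => 1
    have h4 : ∀ k : (Nat.card G).primeFactors, (∑ y : G with orderOf y = k, (1 : ℂ)) =
        Fintype.card G * ((V k).card / Nat.card (P k)) := by
      intro k
      rw [Finset.sum_const, nsmul_eq_mul, mul_one, ← mul_div_assoc, eq_div_iff (hPC k)]
      exact_mod_cast hN k
    rw [Finset.sum_congr rfl fun k _ => h4 k, ← Finset.mul_sum, Finset.sum_const, nsmul_eq_mul,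
      mul_one, Finset.card_univ] at h3
    have h5 : ∑ k, ((V k).card / Nat.card (P k) : ℂ) = 1 - 1 / Fintype.card G := by
      rw [eq_sub_iff_add_eq]
      refine mul_left_cancel₀ hG0 ?_
      rw [mul_add, mul_one_div_cancel hG0, add_comm, ← h3, mul_one]
    have h6 : ∑ k, ((V k).card / Nat.card (P k) : ℚ) = 1 - 1 / Fintype.card G :=
      Rat.cast_injective (α := ℂ) (by push_cast; exact h5)
    rw [h6, Nat.card_eq_fintype_card]

/-- A finite nonabelian simple group all of whose proper subgroups are nilpotent or minimal
non-nilpotent is isomorphic to `A₅`. -/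
theorem nonempty_mulEquiv_alternatingGroup_of_isSimpleGroup {G : Type*} [Group G] [Finite G]
    [IsSimpleGroup G] (hns : ¬ Group.IsSolvable G)
    (hS : ∀ H : Subgroup G, H ≠ ⊤ → NilpotentOrMinimal H) :
    Nonempty (G ≃* alternatingGroup (Fin 5)) :=
  have hF : SylowFrobenius G := fun _ _ P hP => exists_isFrobeniusSylow hns hS P hP
  hF.nonempty_mulEquiv_alternatingGroup hF.two_dvd_card

end OddOrder

section CentralExtensions

open scoped commutatorElement

theorem two_mul_card_le_of_lt {G : Type*} [Group G] [Finite G] {A B : Subgroup G} (h : A < B) :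
    2 * Nat.card A ≤ Nat.card B := by
  obtain ⟨m, hm⟩ := Subgroup.card_dvd_of_le h.le
  have h1 : Nat.card A < Nat.card B := by
    refine lt_of_le_of_ne (Subgroup.card_le_of_le h.le) fun h2 => h.ne ?_
    exact Subgroup.eq_of_le_of_card_ge h.le h2.ge
  rw [hm, mul_comm]
  refine Nat.mul_le_mul_left _ ?_
  by_contra! h3
  interval_cases m
  · simp_all
  · omega

/-- A group of order `4|M|`, where `M` is central, has a commutator subgroup of order at most 2. -/
theorem card_commutator_le_two {T : Type*} [Group T] [Finite T] {M : Subgroup T}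
    (hM : M ≤ Subgroup.center T) (hcard : Nat.card T = 4 * Nat.card M) :
    Nat.card (commutator T) ≤ 2 := by
  have : M.Normal := ⟨fun m hm g => by
    rwa [Subgroup.mem_center_iff.mp (hM hm) g, mul_inv_cancel_right]⟩
  have hM0 : 0 < Nat.card M := Nat.card_pos
  have hq : Nat.card (T ⧸ M) = 2 ^ 2 := by
    have h1 := M.card_eq_card_quotient_mul_card_subgroup
    rw [hcard] at h1
    exact (Nat.eq_of_mul_eq_mul_right hM0 h1).symm
  have : Fact (Nat.Prime 2) := ⟨Nat.prime_two⟩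
  have hcM : commutator T ≤ M := by
    rw [← QuotientGroup.ker_mk' M]
    let := IsPGroup.commGroupOfCardEqPrimeSq hq
    exact Abelianization.commutator_subset_ker (QuotientGroup.mk' M)
  have hcen : ∀ x y z : T, z * ⁅x, y⁆ = ⁅x, y⁆ * z := fun x y z =>
    Subgroup.mem_center_iff.mp (hM (hcM (Subgroup.commutator_mem_commutator trivial trivial))) z
  let φ : T → T →* T := fun y => MonoidHom.mk' (fun x => ⁅x, y⁆) fun x x' => by
    rw [commutatorElement_mul_left_eq_conj_mul, hcen x' y x, mul_inv_cancel_right, ← hcen]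
  have hφ : ∀ x y, φ y x = ⁅x, y⁆ := fun _ _ => rfl
  have hφM : ∀ y, ∀ m ∈ M, φ y m = 1 := fun y m hm => by
    rw [hφ, commutatorElement_eq_one_iff_mul_comm, Subgroup.mem_center_iff.mp (hM hm) y]
  obtain ⟨a, -, haM⟩ : ∃ a ∈ (⊤ : Subgroup T), a ∉ M := SetLike.exists_of_lt
    (lt_top_iff_ne_top.mpr fun h => by
      have h1 := Subgroup.card_top (G := T)
      rw [← h] at h1
      omega)
  let N := M ⊔ Subgroup.zpowers a
  have haN : a ∈ N := Subgroup.mem_sup_right (Subgroup.mem_zpowers a)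
  have hMN : M < N := lt_of_le_of_ne le_sup_left fun h => haM (h ▸ haN)
  have h2N := two_mul_card_le_of_lt hMN
  obtain ⟨b, hb1, hb2⟩ : ∃ b, (∀ S : Subgroup T, M ≤ S → a ∈ S → b ∈ S → S = ⊤) ∧ ⁅a ^ 2, b⁆ =
      1 := by
    rcases eq_or_ne N ⊤ with hN | hN
    · exact ⟨1, fun S hS ha _ => top_le_iff.mp (hN ▸ sup_le hS (by simpa using ha)), by simp⟩
    · obtain ⟨b, -, hbN⟩ : ∃ b ∈ (⊤ : Subgroup T), b ∉ N :=
        SetLike.exists_of_lt (lt_top_iff_ne_top.mpr hN)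
      refine ⟨b, fun S hS ha hb => ?_, ?_⟩
      · have hNS : N < S := lt_of_le_of_ne (sup_le hS (by simpa using ha)) fun h => hbN (h ▸ hb)
        have h3 := two_mul_card_le_of_lt hNS
        exact Subgroup.eq_top_of_le_card _ (by omega)
      · rw [← hφ]
        refine hφM b _ ?_
        have h3 := two_mul_card_le_of_lt (lt_top_iff_ne_top.mpr hN)
        rw [Subgroup.card_top, hcard] at h3
        have h4 : M.relIndex N = 2 := by
          have h5 := (M.subgroupOf N).index_mul_card
          rw [Nat.card_congr (Subgroup.subgroupOfEquivOfLe hMN.le).toEquiv] at h5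
          change M.relIndex N * _ = _ at h5
          exact Nat.eq_of_mul_eq_mul_right hM0 (by omega)
        exact Subgroup.mem_subgroupOf.mp
          (Subgroup.sq_mem_of_index_two (H := M.subgroupOf N) h4 ⟨a, haN⟩)
  let C := Subgroup.zpowers ⁅a, b⁆
  have hC : Nat.card C ≤ 2 := by
    rw [Nat.card_zpowers]
    refine orderOf_le_of_pow_eq_one two_pos ?_
    rw [← hb2, ← hφ, ← hφ, map_pow]
  have h1 : ∀ y, a ∈ C.comap (φ y) → b ∈ C.comap (φ y) → ∀ x, ⁅x, y⁆ ∈ C := fun y ha hb x => by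
    have h2 := hb1 (C.comap (φ y)) (fun m hm => by
      rw [Subgroup.mem_comap, hφM y m hm]; exact C.one_mem) ha hb
    exact Subgroup.mem_comap.mp (h2 ▸ Subgroup.mem_top x)
  have hab : ⁅a, b⁆ ∈ C := Subgroup.mem_zpowers _
  have hba : ⁅b, a⁆ ∈ C := by
    rw [← commutatorElement_inv]
    exact C.inv_mem hab
  have hxa := h1 a (by simp [hφ]) (by simpa [hφ] using hba)
  have hxb := h1 b (by simpa [hφ] using hab) (by simp [hφ])
  have h3 : commutator T ≤ C := by
    rw [commutator_def, Subgroup.commutator_le]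
    intro x _ y _
    refine h1 y ?_ ?_ x <;> rw [Subgroup.mem_comap, hφ, ← commutatorElement_inv]
    exacts [C.inv_mem (hxa y), C.inv_mem (hxb y)]
  exact (Subgroup.card_le_of_le h3).trans hC

/-- A central 2-subgroup of index 60 in a perfect group has order at most 2. -/
theorem card_le_two_of_perfect {E : Type*} [Group E] [Finite E] (hE : commutator E = ⊤)
    {M : Subgroup E} (hM : M ≤ Subgroup.center E) (hM2 : IsPGroup 2 M)
    (hcard : Nat.card E = 60 * Nat.card M) : Nat.card M ≤ 2 := by
  have : Fact (Nat.Prime 2) := ⟨Nat.prime_two⟩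
  have : M.Normal := ⟨fun m hm g => by
    rwa [Subgroup.mem_center_iff.mp (hM hm) g, mul_inv_cancel_right]⟩
  let T : Sylow 2 E := default
  have hMT : M ≤ T := hM2.le_sylow_of_normal T
  obtain ⟨k, hk⟩ := IsPGroup.iff_card.mp hM2
  obtain ⟨m, hm⟩ := IsPGroup.iff_card.mp T.2
  have hidx := T.not_dvd_index
  have hTc : Nat.card T = 4 * Nat.card M := by
    have h1 := (T : Subgroup E).card_mul_index
    have h2 : Nat.card T ∣ 4 * Nat.card M := by
      rw [hm]
      refine Nat.Coprime.dvd_of_dvd_mul_right (k := 2 ^ m) (n := 15) ?_ ?_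
      · exact Nat.Coprime.pow_left _ (by decide)
      · rw [← hm]
        refine (Dvd.intro _ h1).trans ?_
        rw [hcard]; exact ⟨1, by ring⟩
    have h3 : 4 * Nat.card M ∣ Nat.card T := by
      refine Nat.Coprime.dvd_of_dvd_mul_right (n := (T : Subgroup E).index) ?_ ?_
      · rw [hk]
        exact Nat.Coprime.mul_left
          (Nat.Coprime.pow_left 2 ((Nat.Prime.coprime_iff_not_dvd Nat.prime_two).mpr hidx))
          (Nat.Coprime.pow_left _ ((Nat.Prime.coprime_iff_not_dvd Nat.prime_two).mpr hidx))
      · rw [h1, hcard]; exact ⟨15, by ring⟩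
    exact Nat.dvd_antisymm h2 h3
  have hi : (T : Subgroup E).index = 15 := by
    have h1 := (T : Subgroup E).card_mul_index
    rw [hTc, hcard] at h1
    have := Nat.card_pos (α := M)
    nlinarith
  have h4 : Nat.card (M.subgroupOf T) = Nat.card M :=
    Nat.card_congr (Subgroup.subgroupOfEquivOfLe hMT).toEquiv
  have h5 := card_commutator_le_two (T := T) (M := M.subgroupOf T)
    (fun x hx => Subgroup.mem_center_iff.mpr fun y => Subtype.ext
      (Subgroup.mem_center_iff.mp (hM hx) y)) (by rw [h4, hTc])
  rw [← h4]
  refine le_trans (Subgroup.card_le_of_le ?_) h5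
  rintro ⟨z, hzT⟩ hz
  have hzM : z ∈ M := hz
  have key : ∀ (k : ℕ) (g₀ : E), g₀⁻¹ * z ^ k * g₀ ∈ (T : Subgroup E) →
      g₀⁻¹ * z ^ k * g₀ = z ^ k := fun k g₀ _ => by
    rw [Subgroup.mem_center_iff.mp (hM (M.pow_mem hzM k)), inv_mul_cancel_right]
  have h6 := MonoidHom.transfer_eq_pow (Abelianization.of (G := T)) z key
  have h7 : MonoidHom.transfer (Abelianization.of (G := T)) z = 1 := by
    rw [← MonoidHom.mem_ker]
    exact Abelianization.commutator_subset_ker _ (hE ▸ Subgroup.mem_top z)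
  rw [h7, eq_comm, ← MonoidHom.mem_ker, Abelianization.ker_of] at h6
  have h8 : (⟨z, hzT⟩ : T) ^ (T : Subgroup E).index ∈ commutator T := h6
  rw [hi] at h8
  obtain ⟨l, hl⟩ := IsPGroup.iff_orderOf.mp T.2 ⟨z, hzT⟩
  have h9 : Nat.Coprime (orderOf (⟨z, hzT⟩ : T)) 15 := by
    rw [hl]; exact Nat.Coprime.pow_left _ (by decide)
  obtain ⟨j, hj⟩ := exists_pow_eq_self_of_coprime h9.symm
  rw [← hj]
  exact Subgroup.pow_mem _ h8 j

end CentralExtensions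

section SpecialLinear

open Matrix MatrixGroups

/-- The entries of a matrix of trace zero that is diagonal or has zero diagonal. -/
def IsTracelessMonomial (x y z w : ZMod 5) : Prop := x + w = 0 ∧ (x = 0 ∨ (y = 0 ∧ z = 0))

instance (x y z w : ZMod 5) : Decidable (IsTracelessMonomial x y z w) :=
  inferInstanceAs (Decidable (_ ∧ _))

/-- Conjugation by the matrix with entries `a`, `b`, `c`, `d` preserves traceless monomial
matrices of determinant one. -/
def PreservesTracelessMonomial (a b c d : ZMod 5) : Prop :=
  ∀ x y z : ZMod 5, -x * x - y * z = 1 → (x = 0 ∨ (y = 0 ∧ z = 0)) →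
    IsTracelessMonomial ((a * x + b * z) * d - (a * y - b * x) * c)
      ((a * y - b * x) * a - (a * x + b * z) * b)
      ((c * x + d * z) * d - (c * y - d * x) * c)
      ((c * y - d * x) * a - (c * x + d * z) * b)

instance (a b c d : ZMod 5) : Decidable (PreservesTracelessMonomial a b c d) := by
  unfold PreservesTracelessMonomial
  infer_instance

theorem exists_preservesTracelessMonomial : ∀ a b c d : ZMod 5, a * d - b * c = 1 →
    ∃ j : ZMod 5, PreservesTracelessMonomial (a - j * c) (b - j * d) c d := by
  decide +kernel

theorem card_specialLinearGroup_zmod_five : Nat.card SL(2, ZMod 5) = 120 := by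
  have h : Nat.card {v : ZMod 5 × ZMod 5 × ZMod 5 × ZMod 5 //
      v.1 * v.2.2.2 - v.2.1 * v.2.2.1 = 1} = 120 := by
    rw [Nat.card_eq_fintype_card, Fintype.card_subtype]
    decide +kernel
  rw [← h]
  refine Nat.card_congr ⟨fun A => ⟨(A 0 0, A 0 1, A 1 0, A 1 1), ?_⟩, fun v =>
    ⟨!![v.1.1, v.1.2.1; v.1.2.2.1, v.1.2.2.2], ?_⟩, ?_, ?_⟩
  · have := A.det_coe
    rwa [Matrix.det_fin_two] at this
  · rw [Matrix.det_fin_two_of]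
    exact v.2
  · intro A
    ext i j
    fin_cases i <;> fin_cases j <;> rfl
  · intro v
    rfl

theorem card_center_specialLinearGroup_zmod_five :
    Nat.card (Subgroup.center SL(2, ZMod 5)) = 2 := by
  have h : Nat.card {r : ZMod 5 // r ^ 2 = 1} = 2 := by
    rw [Nat.card_eq_fintype_card, Fintype.card_subtype]
    decide +kernel
  refine Eq.trans ?_ h
  refine Nat.card_congr (Equiv.ofBijective (fun A => ⟨A.1 0 0, ?_⟩) ⟨?_, ?_⟩)
  · obtain ⟨r, hr, h1⟩ := Matrix.SpecialLinearGroup.mem_center_iff.mp A.2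
    have h2 : A.1 0 0 = r := by rw [← h1]; simp
    rw [h2]
    exact hr
  · rintro ⟨A, hA⟩ ⟨B, hB⟩ hAB
    obtain ⟨r, hr, h1⟩ := Matrix.SpecialLinearGroup.mem_center_iff.mp hA
    obtain ⟨s, hs, h2⟩ := Matrix.SpecialLinearGroup.mem_center_iff.mp hB
    have h3 : A 0 0 = B 0 0 := congrArg Subtype.val hAB
    have h4 : A 0 0 = r := by rw [← h1]; simp
    have h5 : B 0 0 = s := by rw [← h2]; simp
    refine Subtype.ext (Subtype.ext ?_)
    change (A : Matrix (Fin 2) (Fin 2) (ZMod 5)) = B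
    rw [← h1, ← h2, ← h4, ← h5, h3]
  · rintro ⟨r, hr⟩
    refine ⟨⟨⟨Matrix.scalar (Fin 2) r, ?_⟩, ?_⟩, ?_⟩
    · simpa using hr
    · exact Matrix.SpecialLinearGroup.mem_center_iff.mpr ⟨r, hr, rfl⟩
    · refine Subtype.ext ?_
      change Matrix.scalar (Fin 2) r 0 0 = r
      simp

/-- The traceless monomial matrices in `SL(2, 5)`; together with `±1` they form a quaternion
group. -/
def tracelessMonomials : Set SL(2, ZMod 5) :=
  {A | IsTracelessMonomial (A 0 0) (A 0 1) (A 1 0) (A 1 1)}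

theorem mem_normalizer_tracelessMonomials {A : SL(2, ZMod 5)}
    (h : PreservesTracelessMonomial (A 0 0) (A 0 1) (A 1 0) (A 1 1)) :
    A ∈ Subgroup.normalizer tracelessMonomials := by
  refine Subgroup.mem_normalizer_fintype fun B hB => ?_
  have hd := B.det_coe
  rw [Matrix.det_fin_two] at hd
  have h1 : B 1 1 = -B 0 0 := by linear_combination hB.1
  rw [h1] at hd
  have h2 := h (B 0 0) (B 0 1) (B 1 0) (by linear_combination hd) hB.2
  change IsTracelessMonomial _ _ _ _
  convert h2 using 1 <;>
  · simp [Matrix.mul_apply, Fin.sum_univ_two, Matrix.SpecialLinearGroup.coe_inv,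
      Matrix.adjugate_fin_two, h1]
    try ring

/-- The upper unitriangular matrix with the given entry. -/
def upperUnitriangular (j : ZMod 5) : SL(2, ZMod 5) :=
  ⟨!![1, j; 0, 1], by simp [Matrix.det_fin_two_of]⟩

theorem coe_upperUnitriangular (j : ZMod 5) :
    (upperUnitriangular j : Matrix (Fin 2) (Fin 2) (ZMod 5)) = !![1, j; 0, 1] := rfl

theorem upperUnitriangular_inv (j : ZMod 5) : (upperUnitriangular j)⁻¹ = upperUnitriangular
    (-j) := by
  ext i k
  fin_cases i <;> fin_cases k <;>
    simp [coe_upperUnitriangular, Matrix.SpecialLinearGroup.coe_inv, Matrix.adjugate_fin_two]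

theorem upperUnitriangular_mul (j k : ZMod 5) :
    upperUnitriangular j * upperUnitriangular k = upperUnitriangular (j + k) := by
  ext i l
  fin_cases i <;> fin_cases l <;>
    simp [coe_upperUnitriangular, Matrix.mul_apply, Fin.sum_univ_two, add_comm]

theorem upperUnitriangular_mem_normalizer {j : ZMod 5}
    (h : upperUnitriangular j ∈ Subgroup.normalizer tracelessMonomials) : j = 0 := by
  let D : SL(2, ZMod 5) := ⟨!![2, 0; 0, 3], by rw [Matrix.det_fin_two_of]; decide⟩
  have hD : D ∈ tracelessMonomials := by
    change IsTracelessMonomial 2 0 0 3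
    decide
  have h1 := (h D).mp hD
  rw [upperUnitriangular_inv] at h1
  have h2 : ((upperUnitriangular j * D * upperUnitriangular (-j) : SL(2, ZMod 5)) :
      Matrix (Fin 2) (Fin 2) (ZMod 5)) = !![2, j; 0, 3] := by
    have h3 : (D : Matrix (Fin 2) (Fin 2) (ZMod 5)) = !![2, 0; 0, 3] := rfl
    ext i k
    fin_cases i <;> fin_cases k <;>
      simp [h3, coe_upperUnitriangular, Matrix.mul_apply, Fin.sum_univ_two]
    ring
  have h3 := h1.2
  rw [h2] at h3
  rcases h3 with h3 | h3
  · exact absurd (show (2 : ZMod 5) = 0 from h3) (by decide +revert)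
  · exact h3.1

theorem index_normalizer_tracelessMonomials :
    (Subgroup.normalizer tracelessMonomials).index = 5 := by
  refine Eq.trans ?_ (Nat.card_zmod 5)
  refine (Nat.card_congr (Equiv.ofBijective
    (fun j : ZMod 5 => (QuotientGroup.mk (upperUnitriangular j) : SL(2, ZMod 5) ⧸ _))
      ⟨?_, ?_⟩)).symm
  · intro j k hjk
    have h1 := QuotientGroup.eq.mp hjk
    rw [upperUnitriangular_inv, upperUnitriangular_mul] at h1
    linear_combination -(upperUnitriangular_mem_normalizer h1)
  · intro q
    obtain ⟨A, rfl⟩ := QuotientGroup.mk_surjective q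
    have hd := A.det_coe
    rw [Matrix.det_fin_two] at hd
    obtain ⟨j, hj⟩ := exists_preservesTracelessMonomial _ _ _ _ hd
    refine ⟨j, QuotientGroup.eq.mpr (mem_normalizer_tracelessMonomials ?_)⟩
    rw [upperUnitriangular_inv]
    convert hj using 1 <;>
      simp [coe_upperUnitriangular, Matrix.mul_apply, Fin.sum_univ_two, sub_eq_add_neg]

theorem center_le_normalizer_set {G : Type*} [Group G] (S : Set G) :
    Subgroup.center G ≤ Subgroup.normalizer S := by
  intro z hz g
  rw [← Subgroup.mem_center_iff.mp hz g, mul_inv_cancel_right]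

theorem isSimpleGroup_projectiveSpecialLinearGroup_zmod_five :
    IsSimpleGroup (SL(2, ZMod 5) ⧸ Subgroup.center SL(2, ZMod 5)) := by
  have : Fact (Nat.Prime 5) := ⟨Nat.prime_five⟩
  exact Matrix.ProjectiveSpecialLinearGroup.rank_two_simple (by rw [Nat.card_zmod]; norm_num)

theorem commutator_specialLinearGroup_zmod_five : commutator SL(2, ZMod 5) = ⊤ := by
  have : Fact (Nat.Prime 5) := ⟨Nat.prime_five⟩
  have h1 : (2 : ZMod 5) ≠ 0 := by decide +revert
  have h2 : (2 : ZMod 5) ^ 2 ≠ 1 := by decide +revert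
  exact SL2.commutator_eq_top (a := (2 : ZMod 5)) h1 h2

theorem nonempty_mulEquiv_projectiveSpecialLinearGroup_zmod_five :
    Nonempty (SL(2, ZMod 5) ⧸ Subgroup.center SL(2, ZMod 5) ≃* alternatingGroup (Fin 5)) := by
  have := isSimpleGroup_projectiveSpecialLinearGroup_zmod_five
  let H := (Subgroup.normalizer tracelessMonomials).map
    (QuotientGroup.mk' (Subgroup.center SL(2, ZMod 5)))
  have hH : H.index = 5 := by
    refine Eq.trans ?_ index_normalizer_tracelessMonomials
    refine Subgroup.index_map_eq _ (QuotientGroup.mk'_surjective _) ?_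
    rw [QuotientGroup.ker_mk']
    exact center_le_normalizer_set _
  have hc : Nat.card (SL(2, ZMod 5) ⧸ Subgroup.center SL(2, ZMod 5)) = 60 := by
    have h1 := (Subgroup.center SL(2, ZMod 5)).card_eq_card_quotient_mul_card_subgroup
    rw [card_specialLinearGroup_zmod_five, card_center_specialLinearGroup_zmod_five] at h1
    omega
  refine nonempty_mulEquiv_alternatingGroup (α := (SL(2, ZMod 5) ⧸ Subgroup.center SL(2, ZMod 5)) ⧸
    H)
    hc hH ?_
  have hH1 : H ≠ ⊤ := fun h => by rw [h, Subgroup.index_top] at hH; omega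
  obtain ⟨g, -, hg⟩ := SetLike.exists_of_lt hH1.lt_top
  refine ⟨g, ((1 : SL(2, ZMod 5) ⧸ Subgroup.center SL(2, ZMod 5)) : _ ⧸ H), fun h => hg ?_⟩
  have h2 := QuotientGroup.eq.mp h.symm
  simpa using h2

end SpecialLinear

section CoversOfTheAlternatingGroup

theorem nonempty_mulEquiv_of_surjective {S K L : Type*} [Group S] [Group K] [Group L] [Finite S]
    [Finite K] [Finite L] (hS : Nat.card S = 60) {f : K →* S} {g : L →* S}
    (hf : Function.Surjective f) (hg : Function.Surjective g)
    (hfc : f.ker ≤ Subgroup.center K) (hgc : g.ker ≤ Subgroup.center L)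
    (hf2 : Nat.card f.ker = 2) (hg2 : Nat.card g.ker = 2)
    (hK : commutator K = ⊤) (hL : commutator L = ⊤) : Nonempty (K ≃* L) := by
  have hcard : ∀ {T : Type _} [Group T] [Finite T] {h : T →* S}, Function.Surjective h →
      Nat.card T = 60 * Nat.card h.ker := fun {T} _ _ {h} hh => by
    rw [h.ker.card_eq_card_quotient_mul_card_subgroup, ← hS,
      Nat.card_congr (QuotientGroup.quotientKerEquivOfSurjective h hh).toEquiv]
  have hcardK : Nat.card K = 120 := by rw [hcard hf, hf2]
  have hcardL : Nat.card L = 120 := by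
    rw [g.ker.card_eq_card_quotient_mul_card_subgroup, hg2,
      Nat.card_congr (QuotientGroup.quotientKerEquivOfSurjective g hg).toEquiv, hS]
  let F : Subgroup (K × L) := (f.comp (MonoidHom.fst K L)).eqLocus (g.comp (MonoidHom.snd K L))
  have hF : ∀ x : K × L, x ∈ F ↔ f x.1 = g x.2 := fun x => Iff.rfl
  let h : F →* S := (f.comp (MonoidHom.fst K L)).comp F.subtype
  have hh : Function.Surjective h := fun s => by
    obtain ⟨a, rfl⟩ := hf s
    obtain ⟨b, hb⟩ := hg (f a)
    exact ⟨⟨(a, b), hb.symm⟩, rfl⟩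
  have hh4 : Nat.card h.ker = 4 := by
    have h1 : Nat.card (f.ker × g.ker) = 4 := by rw [Nat.card_prod, hf2, hg2]
    rw [← h1]
    refine Nat.card_congr ⟨fun x => (⟨x.1.1.1, x.2⟩, ⟨x.1.1.2, ?_⟩),
      fun y => ⟨⟨(y.1.1, y.2.1), ?_⟩, y.1.2⟩, fun _ => rfl, fun _ => rfl⟩
    · exact (x.1.2 : f x.1.1.1 = g x.1.1.2).symm.trans x.2
    · exact (show f y.1.1 = 1 from y.1.2).trans (show g y.2.1 = 1 from y.2.2).symm
  have hhc : h.ker ≤ Subgroup.center F := by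
    rintro ⟨⟨a, b⟩, hab⟩ h1
    have ha : f a = 1 := h1
    have hb : g b = 1 := ((hF _).mp hab).symm.trans ha
    refine Subgroup.mem_center_iff.mpr fun y => Subtype.ext (Prod.ext ?_ ?_)
    · exact Subgroup.mem_center_iff.mp (hfc ha) y.1.1
    · exact Subgroup.mem_center_iff.mp (hgc hb) y.1.2
  have hcardF : Nat.card F = 240 := by
    rw [h.ker.card_eq_card_quotient_mul_card_subgroup, hh4,
      Nat.card_congr (QuotientGroup.quotientKerEquivOfSurjective h hh).toEquiv, hS]
  have hfst : F.map (MonoidHom.fst K L) = ⊤ := by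
    refine (Subgroup.eq_top_iff' _).mpr fun a => ?_
    obtain ⟨b, hb⟩ := hg (f a)
    exact ⟨(a, b), hb.symm, rfl⟩
  have hsnd : F.map (MonoidHom.snd K L) = ⊤ := by
    refine (Subgroup.eq_top_iff' _).mpr fun b => ?_
    obtain ⟨a, ha⟩ := hf (g b)
    exact ⟨(a, b), ha, rfl⟩
  have hfstE : ⁅F, F⁆.map (MonoidHom.fst K L) = ⊤ := by
    rw [Subgroup.map_commutator, hfst, ← commutator_def, hK]
  have hsndE : ⁅F, F⁆.map (MonoidHom.snd K L) = ⊤ := by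
    rw [Subgroup.map_commutator, hsnd, ← commutator_def, hL]
  have hEF : ⁅F, F⁆ ≤ F := Subgroup.commutator_le_self F
  have hs1 : Function.Surjective ((MonoidHom.fst K L).comp ⁅F, F⁆.subtype) := fun a => by
    obtain ⟨x, hx, rfl⟩ := (Subgroup.eq_top_iff' _).mp hfstE a
    exact ⟨⟨x, hx⟩, rfl⟩
  have hs2 : Function.Surjective ((MonoidHom.snd K L).comp ⁅F, F⁆.subtype) := fun a => by
    obtain ⟨x, hx, rfl⟩ := (Subgroup.eq_top_iff' _).mp hsndE a
    exact ⟨⟨x, hx⟩, rfl⟩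
  rcases hEF.eq_or_lt with hE | hE
  · exfalso
    have hp : commutator F = ⊤ := by
      refine Subgroup.map_injective F.subtype_injective ?_
      rw [commutator_def, Subgroup.map_commutator, ← MonoidHom.range_eq_map, Subgroup.range_subtype,
        hE]
    have h1 := card_le_two_of_perfect hp hhc (IsPGroup.of_card (n := 2) (by rw [hh4]; rfl))
      (by rw [hcardF, hh4])
    omega
  · have h1 := two_mul_card_le_of_lt hE
    rw [hcardF] at h1
    have h2 : Nat.card K ≤ Nat.card (⁅F, F⁆ : Subgroup (K × L)) :=
        Nat.card_le_card_of_surjective _ hs1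
    have h3 : Nat.card (⁅F, F⁆ : Subgroup (K × L)) = 120 := by omega
    have e1 := MulEquiv.ofBijective _ ((Nat.bijective_iff_surjective_and_card _).mpr
      ⟨hs1, h3.trans hcardK.symm⟩)
    have e2 := MulEquiv.ofBijective _ ((Nat.bijective_iff_surjective_and_card _).mpr
      ⟨hs2, h3.trans hcardL.symm⟩)
    exact ⟨e1.symm.trans e2⟩

theorem MinimalNonNilpotent.exists_prime_eq_or_eq {G : Type*} [Group G] [Finite G]
    {A : Subgroup G} (h : MinimalNonNilpotent A) :
    ∃ p q : ℕ, ∀ r : ℕ, r.Prime → r ∣ Nat.card A → r = p ∨ r = q := by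
  obtain ⟨p, q, P, x, hs⟩ := exists_isSchmidt h
  have := Fact.mk hs.prime_p
  have := Fact.mk hs.prime_q
  refine ⟨p, q, fun r hr hd => ?_⟩
  rw [hs.card_eq, ← Nat.card_zpowers] at hd
  obtain ⟨m, hm⟩ := IsPGroup.iff_card.mp hs.isPGroup
  obtain ⟨n, hn⟩ := IsPGroup.iff_card.mp hs.isPGroup_zpowers
  rw [hm, hn] at hd
  rcases hr.dvd_mul.mp hd with h1 | h1
  · exact Or.inl ((Nat.prime_dvd_prime_iff_eq hr hs.prime_p).mp (hr.dvd_of_dvd_pow h1))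
  · exact Or.inr ((Nat.prime_dvd_prime_iff_eq hr hs.prime_q).mp (hr.dvd_of_dvd_pow h1))

section Dihedral

variable {K S : Type*} [Group K] [Group S] [Finite S] [IsSimpleGroup S]
  {f : K →* S} {p : ℕ} {c t : S}

theorem minimalNonNilpotent_comap_normalizer (hf : Function.Surjective f)
    (hK : ∀ H : Subgroup K, H ≠ ⊤ → NilpotentOrMinimal H) (hp : p.Prime) (hp2 : p ≠ 2)
    (hc : c ^ p = 1) (ht : t ^ 2 = 1) (hct : t * c * t⁻¹ = c⁻¹) (hn : ¬ Commute t c)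
    (hS : Subgroup.zpowers c ≠ ⊤) :
    MinimalNonNilpotent ((Subgroup.normalizer (Subgroup.zpowers c : Set S)).comap f) ∧
      t ∈ Subgroup.normalizer (Subgroup.zpowers c : Set S) := by
  have := Fact.mk hp
  have := Fact.mk Nat.prime_two
  have hc1 : c ≠ 1 := fun h => hn (h ▸ Commute.one_right t)
  have ht1 : t ≠ 1 := fun h => hn (h ▸ Commute.one_left c)
  have htN : t ∈ Subgroup.normalizer (Subgroup.zpowers c : Set S) := by
    refine Subgroup.mem_normalizer_fintype fun n hn => ?_
    obtain ⟨k, rfl⟩ := hn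
    refine ⟨-k, ?_⟩
    change c ^ (-k) = t * c ^ k * t⁻¹
    rw [← conj_zpow, hct, inv_zpow, zpow_neg]
  refine ⟨?_, htN⟩
  have hN : Subgroup.normalizer (Subgroup.zpowers c : Set S) ≠ ⊤ :=
    normalizer_ne_top (fun h => hc1 (Subgroup.zpowers_eq_bot.mp h)) hS
  have h1 : (Subgroup.normalizer (Subgroup.zpowers c : Set S)).comap f ≠ ⊤ := fun h => hN <| by
    rw [← Subgroup.map_comap_eq_self_of_surjective hf (Subgroup.normalizer _), h,
      Subgroup.map_top_of_surjective f hf]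
  refine (hK _ h1).resolve_left fun h2 => hn ?_
  have h3 := isNilpotent_map f h2
  rw [Subgroup.map_comap_eq_self_of_surjective hf] at h3
  refine commute_of_isPGroup_of_isNilpotent hp2.symm (A := Subgroup.zpowers t)
    (B := Subgroup.zpowers c) (C := Subgroup.normalizer (Subgroup.zpowers c : Set S)) ?_ ?_ ?_ ?_ h3
    (Subgroup.mem_zpowers t) (Subgroup.mem_zpowers c)
  · exact IsPGroup.of_card (n := 1) (by rw [Nat.card_zpowers, orderOf_eq_prime ht ht1, pow_one])
  · exact IsPGroup.of_card (n := 1) (by rw [Nat.card_zpowers, orderOf_eq_prime hc hc1, pow_one])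
  · rwa [Subgroup.zpowers_le]
  · exact Subgroup.le_normalizer

theorem zpowers_ne_top_of_not_commute {S : Type*} [Group S] {c t : S} (hn : ¬ Commute t c) :
    Subgroup.zpowers c ≠ ⊤ := fun h => by
  obtain ⟨k, rfl⟩ := (Subgroup.eq_top_iff' _).mp h t
  exact hn (Commute.zpow_left rfl k)

/-- Only the primes dividing the order of a dihedral subgroup can divide the order of the kernel. -/
theorem eq_two_or_eq_of_dvd_card_ker [Finite K] (hf : Function.Surjective f)
    (hK : ∀ H : Subgroup K, H ≠ ⊤ → NilpotentOrMinimal H) (hp : p.Prime) (hp2 : p ≠ 2)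
    (hc : c ^ p = 1) (ht : t ^ 2 = 1) (hct : t * c * t⁻¹ = c⁻¹) (hn : ¬ Commute t c)
    {r : ℕ} (hr : r.Prime) (hrd : r ∣ Nat.card f.ker) : r = 2 ∨ r = p := by
  have := Fact.mk hp
  have := Fact.mk Nat.prime_two
  have hc1 : c ≠ 1 := fun h => hn (h ▸ Commute.one_right t)
  have ht1 : t ≠ 1 := fun h => hn (h ▸ Commute.one_left c)
  obtain ⟨hA, htN⟩ := minimalNonNilpotent_comap_normalizer hf hK hp hp2 hc ht hct hn
    (zpowers_ne_top_of_not_commute hn)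
  obtain ⟨q₁, q₂, hq⟩ := hA.exists_prime_eq_or_eq
  set N := Subgroup.normalizer (Subgroup.zpowers c : Set S)
  have hNA : Nat.card N ∣ Nat.card (N.comap f) := by
    have h1 := Subgroup.card_dvd_of_surjective (f.subgroupComap N) 
      (MonoidHom.subgroupComap_surjective_of_surjective f N hf)
    exact h1
  have h2 := hq 2 Nat.prime_two ((dvd_of_eq (orderOf_eq_prime ht ht1).symm).trans
    ((Subgroup.orderOf_dvd_natCard N htN).trans hNA))
  have h3 := hq p hp ((dvd_of_eq (orderOf_eq_prime hc hc1).symm).trans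
    ((Subgroup.orderOf_dvd_natCard N (Subgroup.le_normalizer (Subgroup.mem_zpowers c))).trans hNA))
  have h4 := hq r hr (hrd.trans (Subgroup.card_dvd_of_le (MonoidHom.ker_le_comap f N)))
  omega

theorem ker_le_center_of_isPGroup_two [Finite K] (hf : Function.Surjective f)
    (hK : ∀ H : Subgroup K, H ≠ ⊤ → NilpotentOrMinimal H) (hp : p.Prime) (hp2 : p ≠ 2)
    (hc : c ^ p = 1) (ht : t ^ 2 = 1) (hct : t * c * t⁻¹ = c⁻¹) (hn : ¬ Commute t c)
    (hM : IsPGroup 2 f.ker) (hperf : commutator K = ⊤) : f.ker ≤ Subgroup.center K := by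
  have := Fact.mk hp
  have := Fact.mk Nat.prime_two
  have hc1 : c ≠ 1 := fun h => hn (h ▸ Commute.one_right t)
  obtain ⟨hA, htN⟩ := minimalNonNilpotent_comap_normalizer hf hK hp hp2 hc ht hct hn
    (zpowers_ne_top_of_not_commute hn)
  set N := Subgroup.normalizer (Subgroup.zpowers c : Set S) with hNdef
  have hlt : (Subgroup.zpowers c).comap f < N.comap f := by
    rw [Subgroup.comap_lt_comap_of_surjective hf]
    refine lt_of_le_of_ne Subgroup.le_normalizer fun h => hn ?_
    rw [← h] at htN
    obtain ⟨k, rfl⟩ := htN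
    exact Commute.zpow_left rfl k
  have hB := hA.isNilpotent_of_lt hlt
  have hcB : p ∣ Nat.card ((Subgroup.zpowers c).comap f) := by
    have h1 := Subgroup.card_dvd_of_surjective (f.subgroupComap (Subgroup.zpowers c))
      (MonoidHom.subgroupComap_surjective_of_surjective f _ hf)
    rwa [Nat.card_zpowers, orderOf_eq_prime hc hc1] at h1
  obtain ⟨⟨y, hyB⟩, hy⟩ := exists_prime_orderOf_dvd_card' p hcB
  rw [Subgroup.orderOf_mk] at hy
  have hyp : IsPGroup p (Subgroup.zpowers y) :=
    IsPGroup.of_card (n := 1) (by rw [Nat.card_zpowers, hy, pow_one])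
  have hyC : y ∈ Subgroup.centralizer (f.ker : Set K) := by
    refine Subgroup.mem_centralizer_iff.mpr fun z hz => ?_
    exact commute_of_isPGroup_of_isNilpotent hp2.symm hM hyp (MonoidHom.ker_le_comap f _)
      (by rwa [Subgroup.zpowers_le]) hB hz (Subgroup.mem_zpowers y)
  have hyM : f y ≠ 1 := fun h => by
    have h1 := IsPGroup.disjoint_of_ne p 2 hp2 _ _ hyp hM
    have h2 : y = 1 := Subgroup.disjoint_def.mp h1 (Subgroup.mem_zpowers y) h
    rw [h2, orderOf_one] at hy
    exact hp.one_lt.ne hy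
  have hmap : (Subgroup.centralizer (f.ker : Set K)).map f = ⊤ := by
    have h1 : ((Subgroup.centralizer (f.ker : Set K)).map f).Normal :=
      Subgroup.Normal.map inferInstance f hf
    refine h1.eq_bot_or_eq_top.resolve_left fun h2 => hyM ?_
    rw [← Subgroup.mem_bot, ← h2]
    exact ⟨y, hyC, rfl⟩
  have hsup : Subgroup.centralizer (f.ker : Set K) ⊔ f.ker = ⊤ := by
    rw [← Subgroup.comap_map_eq, hmap, Subgroup.comap_top]
  have hperf' : Group.IsPerfect K := ⟨hperf⟩
  set C := Subgroup.centralizer (f.ker : Set K) with hC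
  have h1 : IsPGroup 2 (K ⧸ C) := by
    refine hM.of_surjective ((QuotientGroup.mk' C).comp f.ker.subtype) ?_
    rw [← MonoidHom.range_eq_top, MonoidHom.range_comp, Subgroup.range_subtype]
    rw [← Subgroup.map_top_of_surjective _ (QuotientGroup.mk'_surjective C), ← hsup,
      Subgroup.map_sup, QuotientGroup.map_mk'_self, bot_sup_eq]
  have h2 : Subsingleton (K ⧸ C) := by
    by_contra h3
    rw [not_subsingleton_iff_nontrivial] at h3
    exact Group.IsPerfect.not_isNilpotent (K ⧸ C) h1.isNilpotent
  intro z hz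
  refine Subgroup.mem_center_iff.mpr fun g => ?_
  have hg : g ∈ C := (QuotientGroup.eq_one_iff g).mp (Subsingleton.elim _ _)
  exact (Subgroup.mem_centralizer_iff.mp hg z hz).symm

end Dihedral

end CoversOfTheAlternatingGroup

section CoversOfTheAlternatingGroup

open Matrix MatrixGroups

theorem card_alternatingGroup_fin_five : Nat.card (alternatingGroup (Fin 5)) = 60 := by
  have h := two_mul_nat_card_alternatingGroup (α := Fin 5)
  rw [Nat.card_perm, Nat.card_fin] at h
  have : Nat.factorial 5 = 120 := rfl
  omega

theorem isPGroup_two_ker_and_le_center {K : Type*} [Group K] [Finite K]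
    (hperf : commutator K = ⊤) (hK : ∀ H : Subgroup K, H ≠ ⊤ → NilpotentOrMinimal H)
    {f : K →* alternatingGroup (Fin 5)} (hf : Function.Surjective f) :
    IsPGroup 2 f.ker ∧ f.ker ≤ Subgroup.center K := by
  have : IsSimpleGroup (alternatingGroup (Fin 5)) := alternatingGroup.isSimpleGroup (by simp)
  let c₅ : alternatingGroup (Fin 5) := ⟨finRotate 5, Equiv.Perm.mem_alternatingGroup.mpr
      (by decide)⟩
  let t₅ : alternatingGroup (Fin 5) := ⟨Equiv.swap 1 4 * Equiv.swap 2 3,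
      Equiv.Perm.mem_alternatingGroup.mpr (by decide)⟩
  let c₃ : alternatingGroup (Fin 5) := ⟨Equiv.swap 0 1 * Equiv.swap 1 2,
      Equiv.Perm.mem_alternatingGroup.mpr (by decide)⟩
  let t₃ : alternatingGroup (Fin 5) := ⟨Equiv.swap 0 1 * Equiv.swap 3 4,
      Equiv.Perm.mem_alternatingGroup.mpr (by decide)⟩
  have hc₅ : c₅ ^ 5 = 1 := by decide
  have ht₅ : t₅ ^ 2 = 1 := by decide
  have hct₅ : t₅ * c₅ * t₅⁻¹ = c₅⁻¹ := by decide
  have hn₅ : ¬ Commute t₅ c₅ := fun h => absurd h.eq (by decide)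
  have hc₃ : c₃ ^ 3 = 1 := by decide
  have ht₃ : t₃ ^ 2 = 1 := by decide
  have hct₃ : t₃ * c₃ * t₃⁻¹ = c₃⁻¹ := by decide
  have hn₃ : ¬ Commute t₃ c₃ := fun h => absurd h.eq (by decide)
  have h2 : ∀ r : ℕ, r.Prime → r ∣ Nat.card f.ker → r = 2 := fun r hr hd => by
    have h5 := eq_two_or_eq_of_dvd_card_ker hf hK Nat.prime_five
        (by norm_num) hc₅ ht₅ hct₅ hn₅ hr hd
    have h3 := eq_two_or_eq_of_dvd_card_ker hf hK Nat.prime_three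
        (by norm_num) hc₃ ht₃ hct₃ hn₃ hr hd
    omega
  have hM : IsPGroup 2 f.ker := by
    refine IsPGroup.of_card (n := (Nat.card f.ker).primeFactorsList.length) ?_
    exact Nat.eq_prime_pow_of_unique_prime_dvd Nat.card_pos.ne' fun hr hd => h2 _ hr hd
  exact ⟨hM, ker_le_center_of_isPGroup_two hf hK Nat.prime_five (by norm_num) hc₅ ht₅ hct₅ hn₅ hM
    hperf⟩

theorem exists_surjective_specialLinearGroup :
    ∃ g : SL(2, ZMod 5) →* alternatingGroup (Fin 5), Function.Surjective g ∧
      g.ker = Subgroup.center SL(2, ZMod 5) := by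
  obtain ⟨e⟩ := nonempty_mulEquiv_projectiveSpecialLinearGroup_zmod_five
  refine ⟨e.toMonoidHom.comp (QuotientGroup.mk' _), e.surjective.comp
    (QuotientGroup.mk'_surjective _), ?_⟩
  ext x
  rw [MonoidHom.mem_ker, ← QuotientGroup.eq_one_iff]
  exact e.map_eq_one_iff

theorem nonempty_mulEquiv_of_surjective_alternatingGroup {K : Type*} [Group K] [Finite K]
    (hperf : commutator K = ⊤) (hK : ∀ H : Subgroup K, H ≠ ⊤ → NilpotentOrMinimal H)
    {f : K →* alternatingGroup (Fin 5)} (hf : Function.Surjective f) :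
    Nonempty (K ≃* alternatingGroup (Fin 5)) ∨ Nonempty (K ≃* SL(2, ZMod 5)) := by
  obtain ⟨hM, hc⟩ := isPGroup_two_ker_and_le_center hperf hK hf
  have hcard : Nat.card K = 60 * Nat.card f.ker := by
    rw [f.ker.card_eq_card_quotient_mul_card_subgroup, ← card_alternatingGroup_fin_five,
      Nat.card_congr (QuotientGroup.quotientKerEquivOfSurjective f hf).toEquiv]
  have h2 := card_le_two_of_perfect hperf hc hM hcard
  have h0 : 0 < Nat.card f.ker := Nat.card_pos
  obtain h1 | h1 : Nat.card f.ker = 1 ∨ Nat.card f.ker = 2 := by omega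
  · left
    rw [Subgroup.card_eq_one, MonoidHom.ker_eq_bot_iff] at h1
    exact ⟨MulEquiv.ofBijective f ⟨h1, hf⟩⟩
  · right
    obtain ⟨g, hg, hgk⟩ := exists_surjective_specialLinearGroup
    exact nonempty_mulEquiv_of_surjective card_alternatingGroup_fin_five hf hg hc hgk.le h1
      (by rw [hgk, card_center_specialLinearGroup_zmod_five]) hperf
      commutator_specialLinearGroup_zmod_five

/-- The identity and the double transpositions fixing the last point. -/
def kleinFourPerms : Finset (Equiv.Perm (Fin 5)) :=
  {1, Equiv.swap 0 1 * Equiv.swap 2 3, Equiv.swap 0 2 * Equiv.swap 1 3,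
    Equiv.swap 0 3 * Equiv.swap 1 2}

theorem kleinFourPerms_mul : ∀ x ∈ kleinFourPerms, ∀ y ∈ kleinFourPerms,
    x * y ∈ kleinFourPerms := by
  decide +kernel

theorem kleinFourPerms_inv : ∀ x ∈ kleinFourPerms, x⁻¹ ∈ kleinFourPerms := by
  decide +kernel

theorem kleinFourPerms_sign : ∀ x ∈ kleinFourPerms, Equiv.Perm.sign x = 1 := by
  decide +kernel

/-- The normal four-subgroup of the stabilizer of a point in `A₅`. -/
def kleinFourSubgroup : Subgroup (alternatingGroup (Fin 5)) where
  carrier := {x | (x : Equiv.Perm (Fin 5)) ∈ kleinFourPerms}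
  one_mem' := by
    change (1 : Equiv.Perm (Fin 5)) ∈ kleinFourPerms
    decide
  mul_mem' := fun {x y} hx hy => kleinFourPerms_mul x hx y hy
  inv_mem' := fun {x} hx => kleinFourPerms_inv x hx

theorem card_kleinFourSubgroup : Nat.card kleinFourSubgroup = 4 := by
  have h : Nat.card kleinFourPerms = 4 := by
    rw [Nat.card_eq_fintype_card, Fintype.card_coe]
    decide
  refine Eq.trans (Nat.card_congr ⟨fun x => ⟨x.1.1, x.2⟩, fun x => ⟨⟨x.1,
    Equiv.Perm.mem_alternatingGroup.mpr (kleinFourPerms_sign _ x.2)⟩, x.2⟩, fun _ => rfl,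
    fun _ => rfl⟩) h

theorem not_isNilpotent_normalizer_kleinFourSubgroup :
    ¬ Group.IsNilpotent (Subgroup.normalizer (kleinFourSubgroup :
      Set (alternatingGroup (Fin 5)))) := by
  intro h
  have := Fact.mk Nat.prime_two
  have := Fact.mk Nat.prime_three
  let s : Equiv.Perm (Fin 5) := Equiv.swap 0 1 * Equiv.swap 1 2
  let c : alternatingGroup (Fin 5) := ⟨s, Equiv.Perm.mem_alternatingGroup.mpr (by decide)⟩
  let t : alternatingGroup (Fin 5) := ⟨Equiv.swap 0 1 * Equiv.swap 2 3,
    Equiv.Perm.mem_alternatingGroup.mpr (by decide)⟩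
  have hs : ∀ x ∈ kleinFourPerms, s * x * s⁻¹ ∈ kleinFourPerms := by decide +kernel
  have hc : c ∈ Subgroup.normalizer (kleinFourSubgroup : Set (alternatingGroup (Fin 5))) :=
    Subgroup.mem_normalizer_fintype fun x hx => hs x hx
  have ht : t ∈ kleinFourSubgroup := by
    change Equiv.swap 0 1 * Equiv.swap 2 3 ∈ kleinFourPerms
    decide
  have hc3 : orderOf c = 3 := orderOf_eq_prime (by decide) (by decide)
  have h1 : Commute t c := commute_of_isPGroup_of_isNilpotent (p := 2) (q := 3) (by norm_num)
    (IsPGroup.of_card (n := 2) card_kleinFourSubgroup)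
    (IsPGroup.of_card (n := 1) (by rw [Nat.card_zpowers, hc3, pow_one]))
    Subgroup.le_normalizer (by rwa [Subgroup.zpowers_le]) h ht (Subgroup.mem_zpowers c)
  exact absurd h1.eq (by decide)

/-- A perfect cover of `A₅` with 2-group kernel has a Sylow subgroup whose normalizer is proper and
not nilpotent. -/
theorem exists_sylow_two_not_isNilpotent_normalizer {K : Type*} [Group K] [Finite K]
    {f : K →* alternatingGroup (Fin 5)} (hf : Function.Surjective f) (hM : IsPGroup 2 f.ker) :
    ∃ P : Sylow 2 K, ¬ Group.IsNilpotent (Subgroup.normalizer ((P : Subgroup K) : Set K)) ∧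
      Subgroup.normalizer ((P : Subgroup K) : Set K) ≠ ⊤ := by
  have := Fact.mk Nat.prime_two
  have : IsSimpleGroup (alternatingGroup (Fin 5)) := alternatingGroup.isSimpleGroup (by simp)
  have h1 := card_kleinFourSubgroup
  have h2 := kleinFourSubgroup.card_mul_index
  rw [h1, card_alternatingGroup_fin_five] at h2
  have hV2 : IsPGroup 2 kleinFourSubgroup := IsPGroup.of_card (n := 2) h1
  have hidx : ¬ 2 ∣ (kleinFourSubgroup.comap f).index := by
    rw [Subgroup.index_comap_of_surjective _ hf]
    omega
  have hN := Subgroup.comap_normalizer_eq_of_surjective kleinFourSubgroup hf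
  refine ⟨(hV2.comap_of_ker_isPGroup f hM).toSylow hidx, ?_⟩
  change ¬ Group.IsNilpotent (Subgroup.normalizer ((kleinFourSubgroup.comap f : Subgroup K) :
      Set K)) ∧
    Subgroup.normalizer ((kleinFourSubgroup.comap f : Subgroup K) : Set K) ≠ ⊤
  rw [← hN]
  constructor
  · intro h3
    have h4 := isNilpotent_map f h3
    rw [Subgroup.map_comap_eq_self_of_surjective hf] at h4
    exact not_isNilpotent_normalizer_kleinFourSubgroup h4
  · intro h3
    refine normalizer_ne_top (H := kleinFourSubgroup) (fun h => ?_) (fun h => ?_) ?_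
    · rw [h, Subgroup.card_bot] at h1
      omega
    · rw [h, Subgroup.card_top, card_alternatingGroup_fin_five] at h1
      omega
    · rw [← Subgroup.map_comap_eq_self_of_surjective hf (Subgroup.normalizer _), h3,
        Subgroup.map_top_of_surjective f hf]

end CoversOfTheAlternatingGroup

section MinimalNonSolvable

open Matrix MatrixGroups

theorem commutator_eq_top_of_forall_isSolvable {K : Type*} [Group K]
    (hns : ¬ Group.IsSolvable K) (hmin : ∀ H : Subgroup K, H ≠ ⊤ → Group.IsSolvable H) :
    commutator K = ⊤ := by
  by_contra h
  refine hns ((Group.isSolvable_iff_subgroup_quotient (commutator K)).mpr ⟨hmin _ h, ?_⟩)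
  exact Group.isSolvable_of_comm (G := Abelianization K) mul_comm

/-- If a quotient of a perfect group is covered by a solvable subgroup, it is trivial. -/
theorem le_of_normal_of_isCoatom {K : Type*} [Group K] (hns : ¬ Group.IsSolvable K)
    (hmin : ∀ H : Subgroup K, H ≠ ⊤ → Group.IsSolvable H) {N X : Subgroup K} [hN : N.Normal]
    (hN' : N ≠ ⊤) (hX : IsCoatom X) : N ≤ X := by
  by_contra h
  have hsup : X ⊔ N = ⊤ := hX.2 _ (left_lt_sup.mpr h)
  have := hmin X hX.1
  refine hns ((Group.isSolvable_iff_subgroup_quotient N).mpr ⟨hmin N hN', ?_⟩)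
  refine Group.isSolvable_of_surjective (f := (QuotientGroup.mk' N).comp X.subtype) ?_
  rw [← MonoidHom.range_eq_top, MonoidHom.range_comp, Subgroup.range_subtype,
    ← Subgroup.map_top_of_surjective _ (QuotientGroup.mk'_surjective N), ← hsup,
    Subgroup.map_sup, QuotientGroup.map_mk'_self, sup_bot_eq]

theorem isNilpotent_of_normal_of_forall_isSolvable {K : Type*} [Group K] [Finite K]
    (hns : ¬ Group.IsSolvable K) (hmin : ∀ H : Subgroup K, H ≠ ⊤ → Group.IsSolvable H)
    {N : Subgroup K} (hN : N.Normal) (hN' : N ≠ ⊤) : Group.IsNilpotent N := by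
  refine isNilpotent_of_le (B := frattini K) ?_ frattini_nilpotent
  exact le_iInf₂ fun X hX => le_of_normal_of_isCoatom hns hmin hN' hX

theorem exists_normal_isSimpleGroup_quotient (K : Type*) [Group K] [Finite K] [Nontrivial K] :
    ∃ (M : Subgroup K) (_ : M.Normal), M ≠ ⊤ ∧ IsSimpleGroup (K ⧸ M) := by
  obtain ⟨M, ⟨hM, hM1⟩, hmax⟩ := (Set.toFinite {N : Subgroup K | N.Normal ∧ N ≠ ⊤}).exists_maximal
    ⟨⊥, inferInstance, bot_ne_top⟩
  have : Nontrivial (K ⧸ M) := QuotientGroup.nontrivial_iff.mpr hM1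
  refine ⟨M, hM, hM1, { eq_bot_or_eq_top_of_normal := fun N hN => ?_ }⟩
  have h1 : M ≤ N.comap (QuotientGroup.mk' M) := by
    conv_lhs => rw [← QuotientGroup.ker_mk' M]
    exact MonoidHom.ker_le_comap _ _
  have h2 := Subgroup.map_comap_eq_self_of_surjective (QuotientGroup.mk'_surjective M) N
  by_cases h3 : N.comap (QuotientGroup.mk' M) = ⊤
  · right
    rw [← h2, h3, Subgroup.map_top_of_surjective _ (QuotientGroup.mk'_surjective M)]
  · left
    have h4 := hmax (y := N.comap (QuotientGroup.mk' M)) ⟨inferInstance, h3⟩ h1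
    rw [← h2, le_antisymm h4 h1, QuotientGroup.map_mk'_self]

theorem exists_surjective_alternatingGroup {K : Type*} [Group K] [Finite K]
    (hns : ¬ Group.IsSolvable K) (hmin : ∀ H : Subgroup K, H ≠ ⊤ → Group.IsSolvable H)
    (hK : ∀ H : Subgroup K, H ≠ ⊤ → NilpotentOrMinimal H) :
    ∃ f : K →* alternatingGroup (Fin 5), Function.Surjective f := by
  have : Nontrivial K := by
    by_contra h
    rw [not_nontrivial_iff_subsingleton] at h
    exact hns inferInstance
  obtain ⟨M, hM, hM1, hS⟩ := exists_normal_isSimpleGroup_quotient K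
  obtain ⟨e⟩ := nonempty_mulEquiv_alternatingGroup_of_isSimpleGroup (G := K ⧸ M)
    (fun h => hns ((Group.isSolvable_iff_subgroup_quotient M).mpr ⟨hmin M hM1, h⟩))
    (fun H hH => by
      have h1 := Subgroup.map_comap_eq_self_of_surjective (QuotientGroup.mk'_surjective M) H
      rw [← h1]
      refine (hK _ fun h2 => hH ?_).map _
      rw [← h1, h2, Subgroup.map_top_of_surjective _ (QuotientGroup.mk'_surjective M)])
  exact ⟨e.toMonoidHom.comp (QuotientGroup.mk' M),
    e.surjective.comp (QuotientGroup.mk'_surjective M)⟩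

theorem exists_minimal_not_isSolvable {G : Type*} [Group G] [Finite G]
    (hns : ¬ Group.IsSolvable G) : ∃ K : Subgroup G, ¬ Group.IsSolvable K ∧
      ∀ H : Subgroup K, H ≠ ⊤ → Group.IsSolvable H := by
  obtain ⟨K, hK, hmin⟩ := (Set.toFinite {H : Subgroup G | ¬ Group.IsSolvable H}).exists_minimal
    ⟨⊤, fun h => hns (Group.isSolvable_of_surjective (f := (⊤ : Subgroup G).subtype)
      fun g => ⟨⟨g, trivial⟩, rfl⟩)⟩
  refine ⟨K, hK, fun H hH => ?_⟩
  by_contra h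
  have h1 : ¬ Group.IsSolvable (H.map K.subtype) := fun h1 => h <|
    Group.isSolvable_of_surjective
      (f := (H.equivMapOfInjective K.subtype K.subtype_injective).symm.toMonoidHom)
      (H.equivMapOfInjective K.subtype K.subtype_injective).symm.surjective
  refine hH ((Subgroup.eq_top_iff' H).mpr fun x => ?_)
  obtain ⟨y, hy, hyx⟩ := hmin h1 (Subgroup.map_subtype_le H) x.2
  rwa [← K.subtype_injective hyx]

/-- A normal subgroup is the whole group if some Sylow subgroup of it has a normalizer in it that
is proper and not nilpotent. -/
theorem eq_top_of_not_isNilpotent_normalizer {G : Type*} [Group G] [Finite G]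
    (hG : ∀ H : Subgroup G, ¬ H.Normal → NilpotentOrMinimal H) {K : Subgroup G} [hKn : K.Normal]
    {p : ℕ} [Fact p.Prime] (P : Sylow p K)
    (h1 : ¬ Group.IsNilpotent (Subgroup.normalizer ((P : Subgroup K) : Set K)))
    (h2 : Subgroup.normalizer ((P : Subgroup K) : Set K) ≠ ⊤) : K = ⊤ := by
  by_contra hK
  have hF := P.normalizer_sup_eq_top
  set R := Subgroup.normalizer (((P : Subgroup K).map K.subtype : Subgroup G) : Set G) with hR
  have hRK : R.comap K.subtype = Subgroup.normalizer ((P : Subgroup K) : Set K) := by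
    ext x
    rw [Subgroup.mem_comap, mem_normalizer_iff_map_conj, mem_normalizer_iff_map_conj]
    rw [← (Subgroup.map_injective K.subtype_injective).eq_iff, Subgroup.map_map, Subgroup.map_map]
    rfl
  have hlt : (R.comap K.subtype).map K.subtype < R := by
    refine lt_of_le_of_ne (Subgroup.map_comap_le _ _) fun h => hK ?_
    rw [← hF, eq_comm, sup_eq_right, ← h]
    exact Subgroup.map_subtype_le _
  have hRn : R.Normal := by
    by_contra h
    have h3 := (hG R h).isNilpotent_of_lt hlt
    rw [hRK] at h3
    exact h1 (isNilpotent_of_isNilpotent_map K.subtype_injective h3)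
  have h4 : (R.comap K.subtype).Normal := inferInstance
  rw [hRK] at h4
  have h5 := Subgroup.normalizer_eq_top_iff.mpr h4
  exact h2 (P.normalizer_normalizer.symm.trans h5)

theorem nonempty_mulEquiv_of_paraNilHamiltonian {G : Type*} [Group G] [Finite G]
    (hns : ¬ Group.IsSolvable G) (hG : ParaNilHamiltonian G) :
    Nonempty (G ≃* alternatingGroup (Fin 5)) ∨ Nonempty (G ≃* SL(2, ZMod 5)) := by
  obtain ⟨K, hKns, hmin⟩ := exists_minimal_not_isSolvable hns
  have hKn : K.Normal := by
    by_contra h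
    exact hKns (NilpotentOrMinimal.isSolvable (hG.2 K h))
  have hK : ∀ H : Subgroup K, H ≠ ⊤ → NilpotentOrMinimal H := fun H hH => by
    by_cases hn : H.Normal
    · exact Or.inl (isNilpotent_of_normal_of_forall_isSolvable hKns hmin hn hH)
    · have h1 : ¬ (H.map K.subtype).Normal := fun h1 => hn <| by
        rw [← Subgroup.comap_map_eq_self_of_injective K.subtype_injective H]
        infer_instance
      exact NilpotentOrMinimal.of_mulEquiv (hG.2 _ h1)
        (H.equivMapOfInjective K.subtype K.subtype_injective).symm
  have hperf := commutator_eq_top_of_forall_isSolvable hKns hmin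
  obtain ⟨f, hf⟩ := exists_surjective_alternatingGroup hKns hmin hK
  obtain ⟨P, hP1, hP2⟩ := exists_sylow_two_not_isNilpotent_normalizer hf
    (isPGroup_two_ker_and_le_center hperf hK hf).1
  have := Fact.mk Nat.prime_two
  obtain rfl := eq_top_of_not_isNilpotent_normalizer hG.2 P hP1 hP2
  exact (nonempty_mulEquiv_of_surjective_alternatingGroup hperf hK hf).imp
    (fun ⟨e⟩ => ⟨Subgroup.topEquiv.symm.trans e⟩) (fun ⟨e⟩ => ⟨Subgroup.topEquiv.symm.trans e⟩)

end MinimalNonSolvable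

/-- A finite insoluble para-Nil-Hamiltonian group is isomorphic to $A_5$ or to
$\mathrm{SL}(2,5)$; in particular the only prime divisors of its order are 2, 3 and 5. -/
theorem stmt_4 {G : Type*} [Group G] [Finite G]
    (hinsol : ¬ IsSolvable G) (hpara : ParaNilHamiltonian G) :
    (Nonempty (G ≃* ↥(alternatingGroup (Fin 5))) ∨
      Nonempty (G ≃* Matrix.SpecialLinearGroup (Fin 2) (ZMod 5))) ∧
    (∀ r : ℕ, r.Prime → r ∣ Nat.card G → r = 2 ∨ r = 3 ∨ r = 5) := by
  have h := nonempty_mulEquiv_of_paraNilHamiltonian hinsol hpara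
  refine ⟨h, fun r hr hd => ?_⟩
  have h1 : r ∣ 2 ^ 3 * (3 * 5) := by
    rcases h with ⟨⟨e⟩⟩ | ⟨⟨e⟩⟩
    · rw [Nat.card_congr e.toEquiv, card_alternatingGroup_fin_five] at hd
      exact hd.trans (by norm_num)
    · rw [Nat.card_congr e.toEquiv, card_specialLinearGroup_zmod_five] at hd
      exact hd.trans (by norm_num)
  rcases hr.dvd_mul.mp h1 with h2 | h2
  · exact Or.inl ((Nat.prime_dvd_prime_iff_eq hr Nat.prime_two).mp (hr.dvd_of_dvd_pow h2))
  · rcases hr.dvd_mul.mp h2 with h3 | h3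
    · exact Or.inr (Or.inl ((Nat.prime_dvd_prime_iff_eq hr Nat.prime_three).mp h3))
    · exact Or.inr (Or.inr ((Nat.prime_dvd_prime_iff_eq hr Nat.prime_five).mp h3))
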